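/- Let f : (0,∞) → ℂ be locally absolutely continuous, of bounded variation on (0,∞), with lim_{t→∞} f(t) = 0 (so that its derivative f' is Lebesgue integrable on (0,∞)). Suppose in addition that the T-transform Tf' is Lebesgue integrable on (0,∞). Then for every x > 0 the sine Fourier transform satisfies f̂_s(x) = ∫_0^∞ f(t) sin(xt) dt = (1/x) f(π/(2x)) + F(x), where the function F satisfies ‖F‖_{L^1(0,∞)} ≤ C (‖f'‖_{L^1(0,∞)} + ‖Tf'‖_{L^1(0,∞)}) for an absolute constant C > 0. -/

import Mathlib

open MeasureTheory Filter Set Real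
open scoped ENNReal

/-- Weighted row sums of the Hilbert matrix. -/
lemma sum_hilbert_row_le (j N : ℕ) :
    ∑ k ∈ Finset.range N, (√(j + 1) / √(k + 1)) / (j + k + 1 : ℝ) ≤ 5 := by
  have hj : (0 : ℝ) < j + 1 := by positivity
  have key : ∀ N : ℕ, ∑ k ∈ Finset.range N, 1 / (√(k + 1) * (j + k + 1 : ℝ)) ≤
      if N ≤ j + 1 then 2 * √N / (j + 1) else 5 / √(j + 1) - 2 / √N := by
    intro N
    induction N with
    | zero => simp
    | succ N ih =>
      rw [Finset.sum_range_succ]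
      have hN : (0 : ℝ) < N + 1 := by positivity
      have hsN : 0 < √((N : ℝ) + 1) := Real.sqrt_pos.2 hN
      have h1 : 1 / √((N : ℝ) + 1) ≤ 2 * (√((N : ℝ) + 1) - √N) := by
        have h2 : √((N : ℝ) + 1) ^ 2 = N + 1 := Real.sq_sqrt hN.le
        have h3 : √(N : ℝ) ^ 2 = N := Real.sq_sqrt (by positivity)
        rw [div_le_iff₀ hsN]
        nlinarith [sq_nonneg (√((N : ℝ) + 1) - √N)]
      split_ifs at ih with h
      · split_ifs with h'
        · have h4 : 1 / (√((N : ℝ) + 1) * (j + N + 1)) ≤ 2 * (√((N : ℝ) + 1) - √N) / (j + 1) := by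
            rw [← div_div]
            have h5 : 0 ≤ 1 / √((N : ℝ) + 1) := by positivity
            gcongr
            · exact h5.trans h1
            · linarith [(Nat.cast_nonneg N : (0:ℝ) ≤ N)]
          push_cast
          calc _ ≤ _ := add_le_add ih h4
            _ = _ := by ring
        · have hNj : N = j + 1 := by omega
          subst hNj
          push_cast at *
          have hj2 : √((j : ℝ) + 1) ≤ √((j : ℝ) + 1 + 1) := Real.sqrt_le_sqrt (by linarith)
          have hs : 0 < √((j : ℝ) + 1) := Real.sqrt_pos.2 hj
          have e1 : 2 * √((j : ℝ) + 1) / (j + 1) = 2 / √((j : ℝ) + 1) := by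
            rw [div_eq_div_iff hj.ne' hs.ne', mul_assoc, Real.mul_self_sqrt hj.le]
          have e2 : 1 / (√((j : ℝ) + 1 + 1) * (j + (j + 1) + 1)) ≤ 1 / √((j : ℝ) + 1) := by
            apply one_div_le_one_div_of_le hs
            nlinarith [(Nat.cast_nonneg j : (0:ℝ) ≤ j)]
          have e3 : 2 / √((j : ℝ) + 1 + 1) ≤ 2 / √((j : ℝ) + 1) := by gcongr
          rw [e1] at ih
          calc _ ≤ _ := add_le_add ih e2
            _ = 5 / √((j : ℝ) + 1) - 2 / √((j : ℝ) + 1) := by ring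
            _ ≤ _ := by linarith
      · rw [if_neg (by omega)]
        have hN0 : (0 : ℝ) < N := by exact_mod_cast (by omega : 0 < N)
        have hs0 : 0 < √(N : ℝ) := Real.sqrt_pos.2 hN0
        have e : 1 / (√((N : ℝ) + 1) * (j + N + 1)) ≤ 2 / √N - 2 / √(N + 1) := by
          have h2 : √((N : ℝ) + 1) ^ 2 = N + 1 := Real.sq_sqrt hN.le
          have h3 : √(N : ℝ) ^ 2 = N := Real.sq_sqrt (by positivity)
          have hle : √(N : ℝ) ≤ √((N : ℝ) + 1) := Real.sqrt_le_sqrt (by linarith)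
          calc 1 / (√((N : ℝ) + 1) * (j + N + 1)) ≤ 1 / (√((N : ℝ) + 1) * (N + 1)) := by
                gcongr; linarith
            _ ≤ 2 * (√((N : ℝ) + 1) - √N) / (N + 1) := by
                rw [← div_div]; gcongr
            _ ≤ 2 * (√((N : ℝ) + 1) - √N) / (√N * √(N + 1)) := by
                gcongr
                nlinarith
            _ = _ := by field_simp
        push_cast
        linarith
  have hs : 0 < √((j : ℝ) + 1) := Real.sqrt_pos.2 hj
  have h2 : ∑ k ∈ Finset.range N, 1 / (√(k + 1) * (j + k + 1 : ℝ)) ≤ 5 / √(j + 1) := by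
    refine (key N).trans ?_
    split_ifs with h
    · have hNj : √(N : ℝ) ≤ √((j : ℝ) + 1) := Real.sqrt_le_sqrt (by exact_mod_cast h)
      rw [div_le_div_iff₀ hj hs]
      nlinarith [Real.mul_self_sqrt hj.le]
    · have : 0 ≤ 2 / √(N : ℝ) := by positivity
      linarith
  calc _ = √(j + 1) * ∑ k ∈ Finset.range N, 1 / (√(k + 1) * (j + k + 1 : ℝ)) := by
        rw [Finset.mul_sum]
        refine Finset.sum_congr rfl fun k _ => ?_
        rw [div_div, mul_one_div]
    _ ≤ √(j + 1) * (5 / √(j + 1)) := by gcongr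
    _ = 5 := by field_simp

/-- Hilbert's double series inequality, with a non-sharp constant. -/
lemma sum_sum_hilbert_le (x y : ℕ → ℝ) (N : ℕ) :
    ∑ j ∈ Finset.range N, ∑ k ∈ Finset.range N, x j * y k / (j + k + 1 : ℝ) ≤
      5 / 2 * (∑ j ∈ Finset.range N, x j ^ 2 + ∑ k ∈ Finset.range N, y k ^ 2) := by
  have h : ∀ j k : ℕ, x j * y k / (j + k + 1 : ℝ) ≤
      x j ^ 2 / 2 * ((√(j + 1) / √(k + 1)) / (j + k + 1 : ℝ)) +
      y k ^ 2 / 2 * ((√(k + 1) / √(j + 1)) / (k + j + 1 : ℝ)) := by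
    intro j k
    have hs : 0 < √((j : ℝ) + 1) := Real.sqrt_pos.2 (by positivity)
    have ht : 0 < √((k : ℝ) + 1) := Real.sqrt_pos.2 (by positivity)
    have e : (k + j + 1 : ℝ) = j + k + 1 := by ring
    have hp : (0 : ℝ) < j + k + 1 := by positivity
    rw [e, ← mul_div_assoc, ← mul_div_assoc (y k ^ 2 / 2), ← add_div]
    gcongr
    have : x j ^ 2 / 2 * (√(j + 1) / √(k + 1)) + y k ^ 2 / 2 * (√(k + 1) / √(j + 1)) - x j * y k
        = (x j * √(j + 1) - y k * √(k + 1)) ^ 2 / (2 * √(k + 1) * √(j + 1)) := by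
      field_simp
      ring
    have h2 : 0 ≤ (x j * √(j + 1) - y k * √(k + 1)) ^ 2 / (2 * √(k + 1) * √(j + 1)) := by
      positivity
    linarith
  calc _ ≤ ∑ j ∈ Finset.range N, ∑ k ∈ Finset.range N,
        (x j ^ 2 / 2 * ((√(j + 1) / √(k + 1)) / (j + k + 1 : ℝ)) +
      y k ^ 2 / 2 * ((√(k + 1) / √(j + 1)) / (k + j + 1 : ℝ))) :=
        Finset.sum_le_sum fun j _ => Finset.sum_le_sum fun k _ => h j k
    _ = ∑ j ∈ Finset.range N, x j ^ 2 / 2 *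
          ∑ k ∈ Finset.range N, ((√(j + 1) / √(k + 1)) / (j + k + 1 : ℝ)) +
        ∑ k ∈ Finset.range N, y k ^ 2 / 2 *
          ∑ j ∈ Finset.range N, ((√(k + 1) / √(j + 1)) / (k + j + 1 : ℝ)) := by
        simp_rw [Finset.sum_add_distrib, Finset.mul_sum]
        congr 1
        exact Finset.sum_comm
    _ ≤ ∑ j ∈ Finset.range N, x j ^ 2 / 2 * 5 + ∑ k ∈ Finset.range N, y k ^ 2 / 2 * 5 := by
        gcongr with j _ k _
        · exact sum_hilbert_row_le j N
        · exact sum_hilbert_row_le k N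
    _ = _ := by
        rw [mul_add, Finset.mul_sum, Finset.mul_sum]
        congr 1 <;> exact Finset.sum_congr rfl fun k _ => by ring

/-- The `n`-th Fourier coefficient of a function on `[0, 2π]`. -/
noncomputable def angularCoeff (n : ℤ) (f : ℝ → ℂ) : ℂ :=
  (2 * π : ℂ)⁻¹ * ∫ θ in (0 : ℝ)..2 * π, Complex.exp (-(n * θ * Complex.I)) * f θ

lemma angularCoeff_eq_fourierCoeffOn (n : ℤ) (f : ℝ → ℂ) :
    angularCoeff n f = fourierCoeffOn Real.two_pi_pos f n := by
  rw [fourierCoeffOn_eq_integral, angularCoeff]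
  simp only [fourier_coe_apply, smul_eq_mul, sub_zero, Complex.real_smul]
  congr 1
  · push_cast; simp
  · refine intervalIntegral.integral_congr fun θ _ => ?_
    congr 2
    have : (π : ℂ) ≠ 0 := by exact_mod_cast Real.pi_ne_zero
    push_cast
    field_simp

lemma memLp_restrict_Ioc_of_continuous {E : Type*} [NormedAddCommGroup E] {f : ℝ → E}
    [SecondCountableTopologyEither ℝ E] (hf : Continuous f) (p : ENNReal) {a b : ℝ} :
    MemLp f p (volume.restrict (Ioc a b)) := by
  obtain ⟨C, hC⟩ := isCompact_Icc.exists_bound_of_continuousOn (hf.continuousOn (s := Icc a b))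
  refine MemLp.of_bound hf.aestronglyMeasurable C ?_
  filter_upwards [ae_restrict_mem measurableSet_Ioc] with t ht
  exact hC t (Ioc_subset_Icc_self ht)

/-- Bessel's inequality. -/
lemma sum_norm_sq_angularCoeff_le {f : ℝ → ℂ}
    (hf : MemLp f 2 (volume.restrict (Ioc 0 (2 * π)))) (N : ℕ) :
    ∑ k ∈ Finset.range N, ‖angularCoeff k f‖ ^ 2 ≤
      (2 * π)⁻¹ * ∫ θ in (0 : ℝ)..2 * π, ‖f θ‖ ^ 2 := by
  have h := hasSum_sq_fourierCoeffOn Real.two_pi_pos hf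
  have h2 := sum_le_hasSum ((Finset.range N).map ⟨((↑) : ℕ → ℤ), Nat.cast_injective⟩)
    (fun i _ => by positivity) h
  simpa [angularCoeff_eq_fourierCoeffOn] using h2

lemma norm_angularCoeff_le (n : ℤ) (f : ℝ → ℂ) :
    ‖angularCoeff n f‖ ≤ (2 * π)⁻¹ * ∫ θ in (0 : ℝ)..2 * π, ‖f θ‖ := by
  rw [angularCoeff, norm_mul]
  have e : ‖(2 * π : ℂ)⁻¹‖ = (2 * π)⁻¹ := by
    rw [norm_inv]; simp [abs_of_pos Real.pi_pos]
  rw [e]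
  gcongr
  refine (intervalIntegral.norm_integral_le_integral_norm Real.two_pi_pos.le).trans (le_of_eq ?_)
  refine intervalIntegral.integral_congr fun θ _ => ?_
  simp only [norm_mul]
  have : ‖Complex.exp (-(n * θ * Complex.I))‖ = 1 := by
    have := Complex.norm_exp_ofReal_mul_I (-(n * θ))
    push_cast at this
    rwa [neg_mul] at this
  rw [this, one_mul]

lemma angularCoeff_circleMap_mul_pow (n : ℤ) (j : ℕ) (f : ℝ → ℂ) :
    angularCoeff n (fun θ => circleMap 0 1 θ ^ j * f θ) = angularCoeff (n - j) f := by
  unfold angularCoeff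
  congr 1
  refine intervalIntegral.integral_congr fun θ _ => ?_
  simp only [circleMap, zero_add, Complex.ofReal_one, one_mul]
  rw [← Complex.exp_nat_mul, ← mul_assoc, ← Complex.exp_add]
  congr 2
  push_cast
  ring

lemma angularCoeff_const_mul (n : ℤ) (c : ℂ) (f : ℝ → ℂ) :
    angularCoeff n (fun θ => c * f θ) = c * angularCoeff n f := by
  unfold angularCoeff
  simp_rw [mul_left_comm _ c]
  rw [intervalIntegral.integral_const_mul]
  ring

lemma angularCoeff_add (n : ℤ) {f g : ℝ → ℂ} (hf : IntervalIntegrable f volume 0 (2 * π))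
    (hg : IntervalIntegrable g volume 0 (2 * π)) :
    angularCoeff n (fun θ => f θ + g θ) = angularCoeff n f + angularCoeff n g := by
  unfold angularCoeff
  simp_rw [mul_add]
  rw [intervalIntegral.integral_add, mul_add]
  · exact hf.continuousOn_mul (by fun_prop)
  · exact hg.continuousOn_mul (by fun_prop)

lemma angularCoeff_sum {ι : Type*} (n : ℤ) (s : Finset ι) {f : ι → ℝ → ℂ}
    (hf : ∀ i ∈ s, IntervalIntegrable (f i) volume 0 (2 * π)) :
    angularCoeff n (fun θ => ∑ i ∈ s, f i θ) = ∑ i ∈ s, angularCoeff n (f i) := by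
  unfold angularCoeff
  simp_rw [Finset.mul_sum]
  rw [intervalIntegral.integral_finsetSum, Finset.mul_sum]
  intro i hi
  exact (hf i hi).continuousOn_mul (by fun_prop)

/-- The zeroth Fourier coefficient of an analytic function is its value at the centre. -/
lemma angularCoeff_zero_of_diffContOnCl {F : ℂ → ℂ}
    (hF : DiffContOnCl ℂ F (Metric.ball 0 1)) :
    angularCoeff 0 (fun θ => F (circleMap 0 1 θ)) = F 0 := by
  have h : DiffContOnCl ℂ F (Metric.ball 0 |(1 : ℝ)|) := by simpa using hF
  rw [← h.circleAverage, Real.circleAverage_def, angularCoeff, Complex.real_smul]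
  simp

/-- Analytic functions have no negative Fourier coefficients. -/
lemma angularCoeff_neg_of_diffContOnCl {F : ℂ → ℂ}
    (hF : DiffContOnCl ℂ F (Metric.ball 0 1)) {n : ℤ} (hn : n < 0) :
    angularCoeff n (fun θ => F (circleMap 0 1 θ)) = 0 := by
  obtain ⟨m, hm⟩ := Int.eq_ofNat_of_zero_le (by omega : 0 ≤ -n)
  have h1 : DiffContOnCl ℂ (fun z => z ^ m * F z) (Metric.ball 0 1) := by
    simpa using
      (Differentiable.diffContOnCl (by fun_prop : Differentiable ℂ fun z : ℂ => z ^ m)).smul hF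
  have h2 := angularCoeff_zero_of_diffContOnCl h1
  rw [angularCoeff_circleMap_mul_pow] at h2
  have e : n = 0 - (m : ℤ) := by omega
  rw [e, h2, zero_pow (by omega), zero_mul]

lemma continuous_comp_circleMap {F : ℂ → ℂ} (hF : DiffContOnCl ℂ F (Metric.ball 0 1)) :
    Continuous fun θ => F (circleMap 0 1 θ) := by
  have := hF.continuousOn_ball
  refine this.comp_continuous (continuous_circleMap 0 1) fun θ => ?_
  simp [circleMap]

open Polynomial in
/-- Fourier coefficients of a polynomial times an analytic function. -/
lemma angularCoeff_polynomial_mul {F : ℂ → ℂ} (hF : DiffContOnCl ℂ F (Metric.ball 0 1))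
    (Φ : ℂ[X]) (n : ℕ) :
    angularCoeff n (fun θ => Φ.eval (circleMap 0 1 θ) * F (circleMap 0 1 θ)) =
      ∑ j ∈ Finset.range (n + 1),
        Φ.coeff j * angularCoeff ((n - j : ℕ) : ℤ) (fun θ => F (circleMap 0 1 θ)) := by
  have hc := continuous_comp_circleMap hF
  have e : (fun θ => Φ.eval (circleMap 0 1 θ) * F (circleMap 0 1 θ)) = fun θ =>
      ∑ j ∈ Finset.range (Φ.natDegree + 1 + (n + 1)),
        Φ.coeff j * (circleMap 0 1 θ ^ j * F (circleMap 0 1 θ)) := by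
    ext θ
    rw [Polynomial.eval_eq_sum_range' (n := Φ.natDegree + 1 + (n + 1)) (by omega), Finset.sum_mul]
    simp_rw [mul_assoc]
  rw [e, angularCoeff_sum]
  swap
  · intro i _
    exact (continuous_const.mul (((continuous_circleMap 0 1).pow i).mul hc)).intervalIntegrable _ _
  simp_rw [angularCoeff_const_mul, angularCoeff_circleMap_mul_pow]
  rw [add_comm, Finset.sum_range_add, add_eq_left.2]
  · refine Finset.sum_congr rfl fun j hj => ?_
    have : j ≤ n := by simpa [Nat.lt_succ_iff] using hj
    rw [Nat.cast_sub this]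
  · refine Finset.sum_eq_zero fun j _ => ?_
    rw [angularCoeff_neg_of_diffContOnCl hF (by push_cast; omega), mul_zero]

open Polynomial in
/-- Hardy's inequality for an analytic function dominated by the square of a polynomial without
zeros in the disc. -/
lemma sum_angularCoeff_div_le_of_norm_le_sq {F : ℂ → ℂ} (hF : DiffContOnCl ℂ F (Metric.ball 0 1))
    (Φ : ℂ[X]) (hΦ : ∀ z ∈ Metric.closedBall (0 : ℂ) 1, Φ.eval z ≠ 0)
    (hle : ∀ z ∈ Metric.closedBall (0 : ℂ) 1, ‖F z‖ ≤ ‖Φ.eval z‖ ^ 2) (N : ℕ) :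
    ∑ n ∈ Finset.range N, ‖angularCoeff n (fun θ => F (circleMap 0 1 θ))‖ / (n + 1 : ℝ) ≤
      5 * ∑ j ∈ Φ.support, ‖Φ.coeff j‖ ^ 2 := by
  set G : ℂ → ℂ := fun z => F z / Φ.eval z with hG
  have hd : DiffContOnCl ℂ G (Metric.ball 0 1) := by
    refine ⟨hF.differentiableOn.div (by fun_prop) fun z hz =>
      hΦ z (Metric.ball_subset_closedBall hz), ?_⟩
    rw [closure_ball _ one_ne_zero]
    exact hF.continuousOn_ball.div (by fun_prop) hΦ
  set g : ℕ → ℂ := fun k => angularCoeff k (fun θ => G (circleMap 0 1 θ)) with hg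
  have hmem : ∀ θ, circleMap 0 1 θ ∈ Metric.closedBall (0 : ℂ) 1 := fun θ => by simp [circleMap]
  have hcoef : ∀ n : ℕ, angularCoeff n (fun θ => F (circleMap 0 1 θ)) =
      ∑ j ∈ Finset.range (n + 1), Φ.coeff j * g (n - j) := by
    intro n
    rw [← angularCoeff_polynomial_mul hd]
    congr 1
    ext θ
    rw [hG, mul_div_cancel₀ _ (hΦ _ (hmem θ))]
  have hP : ∑ j ∈ Finset.range N, ‖Φ.coeff j‖ ^ 2 ≤ ∑ j ∈ Φ.support, ‖Φ.coeff j‖ ^ 2 := by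
    rw [← Finset.sum_filter_add_sum_filter_not (Finset.range N) (fun j => j ∈ Φ.support)]
    rw [add_eq_left.2]
    · refine Finset.sum_le_sum_of_subset_of_nonneg (fun j hj => ?_) fun _ _ _ => by positivity
      exact (Finset.mem_filter.1 hj).2
    · refine Finset.sum_eq_zero fun j hj => ?_
      have := (Finset.mem_filter.1 hj).2
      rw [Polynomial.notMem_support_iff.1 this]
      simp
  have hGc := continuous_comp_circleMap hd
  have hg2 : ∑ k ∈ Finset.range N, ‖g k‖ ^ 2 ≤ ∑ j ∈ Φ.support, ‖Φ.coeff j‖ ^ 2 := by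
    have hm : MemLp (fun θ => G (circleMap 0 1 θ)) 2 (volume.restrict (Ioc 0 (2 * π))) :=
      memLp_restrict_Ioc_of_continuous hGc 2
    refine (sum_norm_sq_angularCoeff_le hm N).trans ?_
    rw [Polynomial.sum_sq_norm_coeff_eq_circleAverage, Real.circleAverage_def, smul_eq_mul]
    gcongr
    refine intervalIntegral.integral_mono_on Real.two_pi_pos.le
      ((hGc.norm.pow 2).intervalIntegrable _ _)
      (Continuous.intervalIntegrable (by fun_prop) _ _) fun θ _ => ?_
    gcongr
    rw [hG, norm_div, div_le_iff₀ (norm_pos_iff.2 (hΦ _ (hmem θ))), ← sq]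
    exact hle _ (hmem θ)
  calc _ ≤ ∑ n ∈ Finset.range N, ∑ j ∈ Finset.range (n + 1),
        ‖Φ.coeff j‖ * ‖g (n - j)‖ / (j + (n - j : ℕ) + 1 : ℝ) := by
        refine Finset.sum_le_sum fun n _ => ?_
        rw [hcoef]
        calc _ ≤ (∑ j ∈ Finset.range (n + 1), ‖Φ.coeff j‖ * ‖g (n - j)‖) / (n + 1 : ℝ) := by
              gcongr
              refine (norm_sum_le _ _).trans (le_of_eq ?_)
              simp_rw [norm_mul]
          _ = _ := by
              rw [Finset.sum_div]
              refine Finset.sum_congr rfl fun j hj => ?_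
              have : j ≤ n := by simpa [Nat.lt_succ_iff] using hj
              rw [Nat.cast_sub this]
              congr 1
              ring
    _ ≤ ∑ j ∈ Finset.range N, ∑ k ∈ Finset.range N,
          ‖Φ.coeff j‖ * ‖g k‖ / (j + k + 1 : ℝ) := by
        rw [Finset.sum_range_diag_flip N
          (fun j k => ‖Φ.coeff j‖ * ‖g k‖ / (j + (k : ℕ) + 1 : ℝ))]
        refine Finset.sum_le_sum fun j _ =>
          Finset.sum_le_sum_of_subset_of_nonneg ?_ fun _ _ _ => by positivity
        exact Finset.range_subset_range.2 (Nat.sub_le _ _)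
    _ ≤ 5 / 2 * (∑ j ∈ Finset.range N, ‖Φ.coeff j‖ ^ 2 + ∑ k ∈ Finset.range N, ‖g k‖ ^ 2) :=
        sum_sum_hilbert_le _ _ N
    _ ≤ _ := by linarith

open Polynomial in
/-- Real parts of polynomials are dense in the real continuous functions on the unit circle. -/
lemma exists_polynomial_re_near {K : ℂ → ℝ} (hK : ContinuousOn K (Metric.sphere 0 1)) {ε : ℝ}
    (hε : 0 < ε) :
    ∃ Φ : ℂ[X], (Φ.coeff 0).im = 0 ∧ ∀ z ∈ Metric.sphere (0 : ℂ) 1, |(Φ.eval z).re - K z| < ε := by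
  have : Fact (0 < 2 * π) := ⟨Real.two_pi_pos⟩
  have hspan : ∀ p ∈ Submodule.span ℂ (range (@fourier (2 * π))), ∀ a : ℂ, ∃ Φ : ℂ[X],
      ∀ x : AddCircle (2 * π), (Φ.eval (AddCircle.toCircle x : ℂ)).re = (a * p x).re := by
    intro p hp
    induction hp using Submodule.span_induction with
    | mem p hp =>
      obtain ⟨n, rfl⟩ := hp
      intro a
      obtain ⟨m, rfl | rfl⟩ := n.eq_nat_or_neg
      · refine ⟨C a * X ^ m, fun x => ?_⟩
        simp [fourier_apply, AddCircle.toCircle_nsmul]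
      · refine ⟨C (starRingEnd ℂ a) * X ^ m, fun x => ?_⟩
        rw [fourier_neg, eval_mul, eval_C, eval_pow, eval_X, fourier_apply, natCast_zsmul,
          AddCircle.toCircle_nsmul, Circle.coe_pow, ← Complex.conj_re, map_mul, Complex.conj_conj,
          ← Complex.conj_re, map_mul, ← Complex.conj_re]
    | zero => exact fun a => ⟨0, fun x => by simp⟩
    | add p q _ _ hp hq =>
      intro a
      obtain ⟨Φ, hΦ⟩ := hp a
      obtain ⟨Ψ, hΨ⟩ := hq a
      refine ⟨Φ + Ψ, fun x => ?_⟩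
      simp only [eval_add, Complex.add_re, hΦ, hΨ, ContinuousMap.add_apply, mul_add]
    | smul c p _ hp =>
      intro a
      obtain ⟨Φ, hΦ⟩ := hp (a * c)
      refine ⟨Φ, fun x => ?_⟩
      rw [hΦ, ContinuousMap.smul_apply, smul_eq_mul, mul_assoc]
  have hmem : ∀ x : AddCircle (2 * π), (AddCircle.toCircle x : ℂ) ∈ Metric.sphere (0 : ℂ) 1 :=
    fun x => mem_sphere_zero_iff_norm.2 (Circle.norm_coe _)
  let c : C(AddCircle (2 * π), ℂ) :=
    ⟨fun x => (K (AddCircle.toCircle x) : ℂ), by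
      refine Complex.continuous_ofReal.comp (hK.comp_continuous ?_ hmem)
      exact continuous_subtype_val.comp AddCircle.continuous_toCircle⟩
  have hc : c ∈ (Submodule.span ℂ (range (@fourier (2 * π)))).topologicalClosure := by
    rw [span_fourier_closure_eq_top]; trivial
  obtain ⟨p, hp, hpc⟩ := Metric.mem_closure_iff.1 hc ε hε
  obtain ⟨Φ, hΦ⟩ := hspan p hp 1
  refine ⟨Φ - C ((Φ.coeff 0).im * Complex.I), by simp, fun z hz => ?_⟩
  obtain ⟨x, rfl⟩ : ∃ x : AddCircle (2 * π), (AddCircle.toCircle x : ℂ) = z := by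
    refine ⟨((Complex.arg z : ℝ) : AddCircle (2 * π)), ?_⟩
    rw [AddCircle.toCircle_apply_mk, div_self Real.two_pi_pos.ne', one_mul, Circle.coe_exp]
    have := Complex.norm_mul_exp_arg_mul_I z
    rwa [mem_sphere_zero_iff_norm.1 hz, Complex.ofReal_one, one_mul] at this
  have h1 := (ContinuousMap.dist_apply_le_dist (f := c) (g := p) x).trans_lt hpc
  rw [dist_comm, dist_eq_norm] at h1
  refine lt_of_le_of_lt ?_ h1
  refine le_trans (le_of_eq ?_) (Complex.abs_re_le_norm _)
  simp [hΦ, c]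

lemma angularCoeff_star (n : ℤ) (f : ℝ → ℂ) :
    angularCoeff n (fun θ => starRingEnd ℂ (f θ)) = starRingEnd ℂ (angularCoeff (-n) f) := by
  unfold angularCoeff
  rw [map_mul, ← intervalIntegral.intervalIntegral_conj]
  congr 1
  · simp [Complex.conj_ofNat]
  · refine intervalIntegral.integral_congr fun θ _ => ?_
    simp [← Complex.exp_conj]

lemma angularCoeff_one_of_ne_zero {n : ℤ} (hn : n ≠ 0) : angularCoeff n (fun _ => 1) = 0 := by
  have key : ∀ m : ℤ, m < 0 → angularCoeff m (fun _ => 1) = 0 := fun m hm =>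
    angularCoeff_neg_of_diffContOnCl (F := fun _ => 1) diffContOnCl_const hm
  rcases lt_or_gt_of_ne hn with h | h
  · exact key n h
  · have := angularCoeff_star n (fun _ => 1)
    rw [key (-n) (by omega)] at this
    simpa using this

open Polynomial in
lemma angularCoeff_polynomial (Φ : ℂ[X]) (n : ℕ) :
    angularCoeff n (fun θ => Φ.eval (circleMap 0 1 θ)) = Φ.coeff n := by
  have h := angularCoeff_polynomial_mul (F := fun _ => 1) diffContOnCl_const Φ n
  simp only [mul_one] at h
  rw [h, Finset.sum_range_succ, Finset.sum_eq_zero, zero_add, Nat.sub_self]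
  · have : angularCoeff ((0 : ℕ) : ℤ) (fun _ => 1) = 1 := by
      simpa using angularCoeff_zero_of_diffContOnCl (F := fun _ => 1) diffContOnCl_const
    rw [this, mul_one]
  · intro j hj
    have := Finset.mem_range.1 hj
    rw [angularCoeff_one_of_ne_zero (by omega), mul_zero]

open Polynomial in
/-- The coefficients of a polynomial are controlled by those of its real part. -/
lemma norm_coeff_le_two_mul_angularCoeff_re (Φ : ℂ[X]) (h0 : (Φ.coeff 0).im = 0) (n : ℕ) :
    ‖Φ.coeff n‖ ≤ 2 * ‖angularCoeff n (fun θ => ((Φ.eval (circleMap 0 1 θ)).re : ℂ))‖ := by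
  have hc : Continuous fun θ => Φ.eval (circleMap 0 1 θ) := by fun_prop
  have hs : Continuous fun θ => starRingEnd ℂ (Φ.eval (circleMap 0 1 θ)) :=
    Complex.continuous_conj.comp hc
  have e : (fun θ => ((Φ.eval (circleMap 0 1 θ)).re : ℂ)) = fun θ =>
      (2 : ℂ)⁻¹ * (Φ.eval (circleMap 0 1 θ) + starRingEnd ℂ (Φ.eval (circleMap 0 1 θ))) := by
    ext θ
    rw [Complex.add_conj]
    push_cast; ring
  rw [e, angularCoeff_const_mul, angularCoeff_add _ (hc.intervalIntegrable _ _)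
    (hs.intervalIntegrable _ _), angularCoeff_star, angularCoeff_polynomial]
  rcases Nat.eq_zero_or_pos n with rfl | hn
  · have := angularCoeff_polynomial Φ 0
    rw [Nat.cast_zero] at this ⊢
    rw [neg_zero, this, Complex.conj_eq_iff_im.2 h0, ← two_mul, inv_mul_cancel_left₀ two_ne_zero]
    linarith [norm_nonneg (Φ.coeff 0)]
  · have hd : DiffContOnCl ℂ (fun z => Φ.eval z) (Metric.ball 0 1) :=
      Differentiable.diffContOnCl (by fun_prop)
    rw [angularCoeff_neg_of_diffContOnCl hd (by omega), map_zero, add_zero, norm_mul]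
    norm_num
    linarith

open Polynomial in
/-- A polynomial whose real part is bounded below on the circle is so bounded on the disc. -/
lemma le_re_eval_of_forall_sphere {Φ : ℂ[X]} {ε : ℝ}
    (h : ∀ z ∈ Metric.sphere (0 : ℂ) 1, ε ≤ (Φ.eval z).re) :
    ∀ z ∈ Metric.closedBall (0 : ℂ) 1, ε ≤ (Φ.eval z).re := by
  intro z hz
  have hd : DiffContOnCl ℂ (fun z => Complex.exp (-(Φ.eval z))) (Metric.ball 0 1) :=
    Differentiable.diffContOnCl (by fun_prop)
  have := Complex.norm_le_of_forall_mem_frontier_norm_le (C := Real.exp (-ε))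
    Metric.isBounded_ball hd
    (fun w hw => ?_) (by rwa [closure_ball _ one_ne_zero])
  · rw [Complex.norm_exp, Real.exp_le_exp, Complex.neg_re] at this
    linarith
  · rw [frontier_ball _ one_ne_zero] at hw
    rw [Complex.norm_exp, Real.exp_le_exp, Complex.neg_re]
    linarith [h w hw]

lemma intervalIntegrable_of_bound {E : Type*} [NormedAddCommGroup E] {w : ℝ → E} {b C : ℝ}
    (hb : 0 ≤ b)
    (hw : AEStronglyMeasurable w (volume.restrict (Ioc 0 b))) (hC : ∀ θ ∈ Ioc 0 b, ‖w θ‖ ≤ C) :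
    IntervalIntegrable w volume 0 b := by
  rw [intervalIntegrable_iff_integrableOn_Ioc_of_le hb]
  exact IntegrableOn.of_bound (by simp) hw C
    (by filter_upwards [ae_restrict_mem measurableSet_Ioc] with θ hθ using hC θ hθ)

lemma intervalIntegrable_ofReal {f : ℝ → ℝ} {a b : ℝ} (hf : IntervalIntegrable f volume a b) :
    IntervalIntegrable (fun t => (f t : ℂ)) volume a b :=
  ⟨hf.1.ofReal, hf.2.ofReal⟩

/-- Hardy's inequality for an analytic function `F`, when `√‖F‖` is split as `u + (√‖F‖ - u)`. -/
lemma sum_angularCoeff_div_le_of_split {F : ℂ → ℂ} (hF : DiffContOnCl ℂ F (Metric.ball 0 1))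
    {u : ℝ → ℝ} (hu : AEStronglyMeasurable u (volume.restrict (Ioc 0 (2 * π))))
    (hu0 : ∀ θ, 0 ≤ u θ) (huF : ∀ θ, u θ ≤ √‖F (circleMap 0 1 θ)‖)
    {r : ℝ} (hr0 : 0 ≤ r) (hr1 : r < 1) (N : ℕ) :
    ∑ n ∈ Finset.range N, ‖angularCoeff n (fun θ => F (r * circleMap 0 1 θ))‖ / (n + 1 : ℝ) ≤
      40 * ((2 * π)⁻¹ * ∫ θ in (0 : ℝ)..2 * π, u θ ^ 2) +
      40 * ((2 * π)⁻¹ * ∫ θ in (0 : ℝ)..2 * π, (√‖F (circleMap 0 1 θ)‖ - u θ)) ^ 2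
        / (1 - r ^ 2) := by
  have hr2 : 0 < 1 - r ^ 2 := by nlinarith
  have hkc : Continuous fun θ => √‖F (circleMap 0 1 θ)‖ := (continuous_comp_circleMap hF).norm.sqrt
  obtain ⟨B, hB⟩ := isCompact_Icc.exists_bound_of_continuousOn
    (hkc.continuousOn (s := Icc 0 (2 * π)))
  have hkB : ∀ θ ∈ Ioc 0 (2 * π), √‖F (circleMap 0 1 θ)‖ ≤ B := fun θ hθ =>
    (le_abs_self _).trans (hB θ (Ioc_subset_Icc_self hθ))
  have huB : ∀ θ ∈ Ioc 0 (2 * π), ‖u θ‖ ≤ B := fun θ hθ => by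
    rw [Real.norm_of_nonneg (hu0 θ)]
    exact (huF θ).trans (hkB θ hθ)
  have huI : IntervalIntegrable u volume 0 (2 * π) :=
    intervalIntegrable_of_bound Real.two_pi_pos.le hu huB
  have huC : MemLp (fun θ => (u θ : ℂ)) 2 (volume.restrict (Ioc 0 (2 * π))) := by
    refine MemLp.of_bound (Complex.continuous_ofReal.comp_aestronglyMeasurable hu) B ?_
    filter_upwards [ae_restrict_mem measurableSet_Ioc] with θ hθ
    rw [Complex.norm_real]
    exact huB θ hθ
  set U := (2 * π)⁻¹ * ∫ θ in (0 : ℝ)..2 * π, u θ ^ 2 with hU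
  set V := (2 * π)⁻¹ * ∫ θ in (0 : ℝ)..2 * π, (√‖F (circleMap 0 1 θ)‖ - u θ) with hV
  suffices H : ∀ ε > 0,
      ∑ n ∈ Finset.range N, ‖angularCoeff n (fun θ => F (r * circleMap 0 1 θ))‖ / (n + 1 : ℝ) ≤
      40 * U + 40 * (V + 3 * ε) ^ 2 / (1 - r ^ 2) by
    have ht : Tendsto (fun ε : ℝ => 40 * U + 40 * (V + 3 * ε) ^ 2 / (1 - r ^ 2))
        (nhdsWithin 0 (Ioi 0)) (nhds (40 * U + 40 * (V + 3 * 0) ^ 2 / (1 - r ^ 2))) := by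
      refine Tendsto.mono_left ?_ nhdsWithin_le_nhds
      exact Continuous.tendsto (by fun_prop) 0
    have := ge_of_tendsto ht (by filter_upwards [self_mem_nhdsWithin] with ε hε using H ε hε)
    simpa using this
  intro ε hε
  have hKc : ContinuousOn (fun z => √‖F z‖ + 2 * ε) (Metric.sphere 0 1) :=
    ((hF.continuousOn_ball.mono Metric.sphere_subset_closedBall).norm.sqrt).add continuousOn_const
  obtain ⟨Φ, hΦ0, hΦ⟩ := exists_polynomial_re_near hKc hε
  have hlow : ∀ z ∈ Metric.sphere (0 : ℂ) 1, √‖F z‖ + ε ≤ (Φ.eval z).re := fun z hz => by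
    have := (abs_lt.1 (hΦ z hz)).1; linarith
  have hup : ∀ z ∈ Metric.sphere (0 : ℂ) 1, (Φ.eval z).re ≤ √‖F z‖ + 3 * ε := fun z hz => by
    have := (abs_lt.1 (hΦ z hz)).2; linarith
  have hpos : ∀ z ∈ Metric.closedBall (0 : ℂ) 1, ε ≤ (Φ.eval z).re :=
    le_re_eval_of_forall_sphere fun z hz => by linarith [hlow z hz, Real.sqrt_nonneg ‖F z‖]
  have hne : ∀ z ∈ Metric.closedBall (0 : ℂ) 1, Φ.eval z ≠ 0 := fun z hz h => by
    have := hpos z hz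
    rw [h, Complex.zero_re] at this
    linarith
  have hle : ∀ z ∈ Metric.closedBall (0 : ℂ) 1, ‖F z‖ ≤ ‖Φ.eval z‖ ^ 2 := by
    intro z hz
    have hd : DiffContOnCl ℂ (fun z => F z / Φ.eval z ^ 2) (Metric.ball 0 1) := by
      refine ⟨hF.differentiableOn.div (by fun_prop) fun z hz =>
        pow_ne_zero 2 (hne z (Metric.ball_subset_closedBall hz)), ?_⟩
      rw [closure_ball _ one_ne_zero]
      exact hF.continuousOn_ball.div (by fun_prop) fun z hz => pow_ne_zero 2 (hne z hz)
    have := Complex.norm_le_of_forall_mem_frontier_norm_le (C := 1) Metric.isBounded_ball hd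
      (fun w hw => ?_) (by rwa [closure_ball _ one_ne_zero])
    · rw [norm_div, norm_pow, div_le_one] at this
      · exact this
      · have := norm_pos_iff.2 (hne z hz); positivity
    · rw [frontier_ball _ one_ne_zero] at hw
      have hw' := norm_pos_iff.2 (hne w (Metric.sphere_subset_closedBall hw))
      rw [norm_div, norm_pow, div_le_one (by positivity), ← Real.sq_sqrt (norm_nonneg (F w))]
      gcongr
      linarith [hlow w hw, Complex.re_le_norm (Φ.eval w)]
  have hmaps : ∀ {z : ℂ} {s : ℝ}, ‖z‖ < s → s ≤ 1 → ‖(r : ℂ) * z‖ < 1 := fun {z s} hz hs => by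
    rw [norm_mul, Complex.norm_real, Real.norm_of_nonneg hr0]
    nlinarith [norm_nonneg z]
  have hFr : DiffContOnCl ℂ (fun z => F (r * z)) (Metric.ball 0 1) := by
    refine hF.comp (g := fun z => (r : ℂ) * z) (Differentiable.diffContOnCl (by fun_prop)) ?_
    intro z hz
    rw [mem_ball_zero_iff] at hz ⊢
    exact hmaps hz le_rfl
  have hmaps' : ∀ z ∈ Metric.closedBall (0 : ℂ) 1, (r : ℂ) * z ∈ Metric.closedBall (0 : ℂ) 1 := by
    intro z hz
    rw [mem_closedBall_zero_iff] at hz ⊢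
    rw [norm_mul, Complex.norm_real, Real.norm_of_nonneg hr0]
    nlinarith [norm_nonneg z]
  have hev : ∀ z, (Φ.comp (Polynomial.C (r : ℂ) * Polynomial.X)).eval z = Φ.eval (r * z) :=
    fun z => by simp
  refine (sum_angularCoeff_div_le_of_norm_le_sq hFr (Φ.comp (Polynomial.C (r : ℂ) * Polynomial.X))
    (fun z hz => by rw [hev]; exact hne _ (hmaps' z hz))
    (fun z hz => by rw [hev]; exact hle _ (hmaps' z hz)) N).trans ?_
  set w : ℝ → ℝ := fun θ => (Φ.eval (circleMap 0 1 θ)).re - u θ with hw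
  have hsph : ∀ θ, circleMap 0 1 θ ∈ Metric.sphere (0 : ℂ) 1 := fun θ => by simp [circleMap]
  have hReI : IntervalIntegrable (fun θ => (Φ.eval (circleMap 0 1 θ)).re) volume 0 (2 * π) :=
    Continuous.intervalIntegrable (by fun_prop) _ _
  have hwI : IntervalIntegrable w volume 0 (2 * π) := hReI.sub huI
  have hwA : (2 * π)⁻¹ * ∫ θ in (0 : ℝ)..2 * π, ‖(w θ : ℂ)‖ ≤ V + 3 * ε := by
    have : ∫ θ in (0 : ℝ)..2 * π, ‖(w θ : ℂ)‖ ≤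
        ∫ θ in (0 : ℝ)..2 * π, ((√‖F (circleMap 0 1 θ)‖ - u θ) + 3 * ε) := by
      refine intervalIntegral.integral_mono_on Real.two_pi_pos.le ?_ ?_ fun θ _ => ?_
      · simpa using hwI.norm
      · exact ((hkc.intervalIntegrable _ _).sub huI).add (by simp)
      · rw [Complex.norm_real, Real.norm_eq_abs, abs_le]
        constructor <;> simp only [hw] <;>
          linarith [hlow _ (hsph θ), hup _ (hsph θ), huF θ]
    rw [intervalIntegral.integral_add ((hkc.intervalIntegrable _ _).sub huI) (by simp),
      intervalIntegral.integral_const, smul_eq_mul, sub_zero] at this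
    calc _ ≤ (2 * π)⁻¹ * ((∫ θ in (0 : ℝ)..2 * π, (√‖F (circleMap 0 1 θ)‖ - u θ)) +
          2 * π * (3 * ε)) := by gcongr
      _ = V + 3 * ε := by
          rw [hV]; field_simp
  have hVn : 0 ≤ V + 3 * ε := le_trans (by
    have := intervalIntegral.integral_nonneg (μ := volume) (f := fun θ => ‖(w θ : ℂ)‖)
      Real.two_pi_pos.le (fun θ _ => norm_nonneg _)
    positivity) hwA
  have hcoef : ∀ j : ℕ, ‖Φ.coeff j‖ ^ 2 ≤
      8 * ‖angularCoeff j (fun θ => (u θ : ℂ))‖ ^ 2 + 8 * (V + 3 * ε) ^ 2 := by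
    intro j
    have h1 := norm_coeff_le_two_mul_angularCoeff_re Φ hΦ0 j
    have e : (fun θ => ((Φ.eval (circleMap 0 1 θ)).re : ℂ)) = fun θ => (u θ : ℂ) + (w θ : ℂ) := by
      ext θ; simp only [hw]; push_cast; ring
    rw [e, angularCoeff_add _ (intervalIntegrable_ofReal huI) (intervalIntegrable_ofReal hwI)] at h1
    have h2 := (norm_angularCoeff_le j (fun θ => (w θ : ℂ))).trans hwA
    have h3 := norm_add_le (angularCoeff j (fun θ => (u θ : ℂ))) (angularCoeff j fun θ => (w θ : ℂ))
    have h4 : ‖Φ.coeff j‖ ≤ 2 * (‖angularCoeff j (fun θ => (u θ : ℂ))‖ + (V + 3 * ε)) := by linarith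
    calc _ ≤ (2 * (‖angularCoeff j (fun θ => (u θ : ℂ))‖ + (V + 3 * ε))) ^ 2 := by gcongr
      _ ≤ _ := by nlinarith [sq_nonneg (‖angularCoeff j (fun θ => (u θ : ℂ))‖ - (V + 3 * ε))]
  set D := (Φ.comp (Polynomial.C (r : ℂ) * Polynomial.X)).natDegree + 1 with hD
  have hr2' : r ^ 2 < 1 := by linarith
  have hsum : ∑ j ∈ (Φ.comp (Polynomial.C (r : ℂ) * Polynomial.X)).support,
      ‖(Φ.comp (Polynomial.C (r : ℂ) * Polynomial.X)).coeff j‖ ^ 2 ≤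
      8 * U + 8 * (V + 3 * ε) ^ 2 / (1 - r ^ 2) := by
    calc _ ≤ ∑ j ∈ Finset.range D,
        ‖(Φ.comp (Polynomial.C (r : ℂ) * Polynomial.X)).coeff j‖ ^ 2 :=
          Finset.sum_le_sum_of_subset_of_nonneg Polynomial.supp_subset_range_natDegree_succ
            fun _ _ _ => by positivity
      _ ≤ ∑ j ∈ Finset.range D, (8 * ‖angularCoeff j (fun θ => (u θ : ℂ))‖ ^ 2 +
            8 * (V + 3 * ε) ^ 2 * (r ^ 2) ^ j) := by
          refine Finset.sum_le_sum fun j _ => ?_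
          rw [Polynomial.comp_C_mul_X_coeff, norm_mul, norm_pow, Complex.norm_real,
            Real.norm_of_nonneg hr0, mul_pow, ← pow_mul, mul_comm j 2, pow_mul]
          have hq0 : 0 ≤ (r ^ 2) ^ j := by positivity
          have hq1 : (r ^ 2) ^ j ≤ 1 := pow_le_one₀ (by positivity) hr2'.le
          calc _ ≤ (8 * ‖angularCoeff j (fun θ => (u θ : ℂ))‖ ^ 2 + 8 * (V + 3 * ε) ^ 2)
                * (r ^ 2) ^ j := by gcongr; exact hcoef j
            _ ≤ _ := by
              nlinarith [sq_nonneg ‖angularCoeff j (fun θ => (u θ : ℂ))‖]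
      _ ≤ _ := by
          rw [Finset.sum_add_distrib, ← Finset.mul_sum, ← Finset.mul_sum]
          have hB := sum_norm_sq_angularCoeff_le huC D
          simp only [Complex.norm_real, Real.norm_eq_abs, sq_abs] at hB
          have hG : ∑ j ∈ Finset.range D, (r ^ 2) ^ j ≤ (1 - r ^ 2)⁻¹ :=
            (summable_geometric_of_lt_one (by positivity) hr2').sum_le_tsum _
              (fun _ _ => by positivity) |>.trans_eq (tsum_geometric_of_lt_one (by positivity) hr2')
          have := mul_le_mul_of_nonneg_left hG (show 0 ≤ 8 * (V + 3 * ε) ^ 2 by positivity)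
          rw [div_eq_mul_inv]
          linarith
  calc _ ≤ 5 * (8 * U + 8 * (V + 3 * ε) ^ 2 / (1 - r ^ 2)) := by gcongr
    _ = _ := by ring

/-- The Cauchy integral of a density on the line wrapped around the unit circle. -/
noncomputable def cauchyInt (γ : ℝ → ℂ) (w : ℂ) : ℂ :=
  ∫ s, γ s / (1 - w * Complex.exp (-(s * Complex.I)))

lemma norm_exp_neg_ofReal_mul_I (s : ℝ) : ‖Complex.exp (-(s * Complex.I))‖ = 1 := by
  have := Complex.norm_exp_ofReal_mul_I (-s)
  push_cast at this
  rwa [neg_mul] at this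

lemma one_sub_norm_le (w : ℂ) (s : ℝ) :
    1 - ‖w‖ ≤ ‖1 - w * Complex.exp (-(s * Complex.I))‖ := by
  have := norm_sub_norm_le 1 (w * Complex.exp (-(s * Complex.I)))
  rwa [norm_mul, norm_exp_neg_ofReal_mul_I, mul_one, norm_one] at this

lemma one_sub_mul_exp_ne_zero {w : ℂ} (hw : ‖w‖ < 1) (s : ℝ) :
    1 - w * Complex.exp (-(s * Complex.I)) ≠ 0 :=
  norm_pos_iff.1 (lt_of_lt_of_le (by linarith) (one_sub_norm_le w s))

lemma continuous_one_sub_mul_exp_inv {w : ℂ} (hw : ‖w‖ < 1) :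
    Continuous fun s : ℝ => (1 - w * Complex.exp (-(s * Complex.I)))⁻¹ :=
  Continuous.inv₀ (by fun_prop) (one_sub_mul_exp_ne_zero hw)

lemma integrable_cauchyInt {γ : ℝ → ℂ} (hγ : Integrable γ) {w : ℂ} (hw : ‖w‖ < 1) :
    Integrable fun s : ℝ => γ s / (1 - w * Complex.exp (-(s * Complex.I))) := by
  simp_rw [div_eq_mul_inv]
  refine hγ.mul_bdd (c := (1 - ‖w‖)⁻¹) (continuous_one_sub_mul_exp_inv hw).aestronglyMeasurable
    (Eventually.of_forall fun s => ?_)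
  rw [norm_inv]
  have h1 : 0 < 1 - ‖w‖ := by linarith
  gcongr
  exact one_sub_norm_le w s

lemma differentiableOn_cauchyInt {γ : ℝ → ℂ} (hγ : Integrable γ) :
    DifferentiableOn ℂ (cauchyInt γ) (Metric.ball 0 1) := by
  intro w₀ hw₀
  rw [mem_ball_zero_iff] at hw₀
  refine DifferentiableAt.differentiableWithinAt ?_
  set ε := (1 - ‖w₀‖) / 2 with hε
  have hε0 : 0 < ε := by rw [hε]; linarith
  have hball : ∀ w ∈ Metric.ball w₀ ε, ‖w‖ < 1 - ε := fun w hw => by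
    have h1 : ‖w - w₀‖ < ε := by simpa [dist_eq_norm] using hw
    have h2 : ‖w‖ ≤ ‖w₀‖ + ‖w - w₀‖ := by simpa using norm_add_le w₀ (w - w₀)
    linarith
  have hm : ∀ w : ℂ, ‖w‖ < 1 → AEStronglyMeasurable
      (fun s : ℝ => γ s / (1 - w * Complex.exp (-(s * Complex.I)))) volume :=
    fun w hw => (integrable_cauchyInt hγ hw).aestronglyMeasurable
  refine (hasDerivAt_integral_of_dominated_loc_of_deriv_le (μ := volume)
    (F' := fun w s => γ s * (Complex.exp (-(s * Complex.I)) *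
      (1 - w * Complex.exp (-(s * Complex.I)))⁻¹ ^ 2))
    (bound := fun s => ‖γ s‖ * ε⁻¹ ^ 2)
    (Metric.ball_mem_nhds w₀ hε0) ?_ (integrable_cauchyInt hγ hw₀) ?_ ?_
    (hγ.norm.mul_const _) ?_).2.differentiableAt
  · filter_upwards [Metric.ball_mem_nhds w₀ hε0] with w hw
    exact hm w (by linarith [hball w hw])
  · refine hγ.aestronglyMeasurable.mul (Continuous.aestronglyMeasurable ?_)
    exact Continuous.mul (by fun_prop) ((continuous_one_sub_mul_exp_inv hw₀).pow 2)
  · refine Eventually.of_forall fun s w hw => ?_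
    rw [norm_mul, norm_mul, norm_exp_neg_ofReal_mul_I, one_mul, norm_pow, norm_inv]
    gcongr
    linarith [one_sub_norm_le w s, hball w hw]
  · refine Eventually.of_forall fun s w hw => ?_
    have hne := one_sub_mul_exp_ne_zero (w := w) (by linarith [hball w hw]) s
    have h1 : HasDerivAt (fun w : ℂ => 1 - w * Complex.exp (-(s * Complex.I)))
        (-(Complex.exp (-(s * Complex.I)))) w := by
      simpa using ((hasDerivAt_id w).mul_const (Complex.exp (-(s * Complex.I)))).const_sub 1
    have h2 := (h1.inv hne).const_mul (γ s)
    rw [neg_neg, div_eq_mul_inv, ← inv_pow] at h2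
    exact h2

lemma diffContOnCl_comp_mul {F : ℂ → ℂ} (hF : DifferentiableOn ℂ F (Metric.ball 0 1)) {r : ℝ}
    (hr0 : 0 ≤ r) (hr1 : r < 1) : DiffContOnCl ℂ (fun z => F (r * z)) (Metric.ball 0 1) := by
  have h : DifferentiableOn ℂ (fun z : ℂ => F (r * z)) {z | ‖(r : ℂ) * z‖ < 1} :=
    hF.comp (t := Metric.ball 0 1) (by fun_prop) fun z hz => by simpa using hz
  refine h.diffContOnCl_ball fun z hz => ?_
  rw [mem_closedBall_zero_iff] at hz
  rw [mem_ofPred_eq, norm_mul, Complex.norm_real, Real.norm_of_nonneg hr0]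
  nlinarith [norm_nonneg z]

lemma cauchyInt_zero (γ : ℝ → ℂ) : cauchyInt γ 0 = ∫ s, γ s := by simp [cauchyInt]

lemma integrable_mul_exp {γ : ℝ → ℂ} (hγ : Integrable γ) :
    Integrable fun s : ℝ => γ s * Complex.exp (-(s * Complex.I)) := by
  refine hγ.mul_bdd (c := 1) (Continuous.aestronglyMeasurable (by fun_prop))
    (Eventually.of_forall fun s => (norm_exp_neg_ofReal_mul_I s).le)

lemma cauchyInt_eq_add {γ : ℝ → ℂ} (hγ : Integrable γ) {w : ℂ} (hw : ‖w‖ < 1) :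
    cauchyInt γ w =
      (∫ s, γ s) + w * cauchyInt (fun s => γ s * Complex.exp (-(s * Complex.I))) w := by
  unfold cauchyInt
  rw [← integral_const_mul, ← integral_add hγ
    ((integrable_cauchyInt (integrable_mul_exp hγ) hw).const_mul w)]
  refine integral_congr_ae (Eventually.of_forall fun s => ?_)
  have := one_sub_mul_exp_ne_zero hw s
  simp only
  field_simp
  ring

lemma angularCoeff_cauchyInt {r : ℝ} (hr0 : 0 ≤ r) (hr1 : r < 1) (n : ℕ) :
    ∀ {γ : ℝ → ℂ}, Integrable γ →
    angularCoeff n (fun θ => cauchyInt γ (r * circleMap 0 1 θ)) =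
      r ^ n * ∫ s, γ s * Complex.exp (-(s * Complex.I)) ^ n := by
  induction n with
  | zero =>
    intro γ hγ
    have := angularCoeff_zero_of_diffContOnCl
      (diffContOnCl_comp_mul (differentiableOn_cauchyInt hγ) hr0 hr1)
    simpa [cauchyInt_zero] using this
  | succ n ih =>
    intro γ hγ
    have hγ' := integrable_mul_exp hγ
    have hd := diffContOnCl_comp_mul (differentiableOn_cauchyInt hγ') hr0 hr1
    have hw : ∀ θ, ‖(r : ℂ) * circleMap 0 1 θ‖ < 1 := fun θ => by
      rw [norm_mul, Complex.norm_real, Real.norm_of_nonneg hr0]; simpa using hr1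
    have e : (fun θ => cauchyInt γ (r * circleMap 0 1 θ)) = fun θ => (∫ s, γ s) * 1 +
        r * (circleMap 0 1 θ ^ 1 *
          cauchyInt (fun s => γ s * Complex.exp (-(s * Complex.I))) (r * circleMap 0 1 θ)) := by
      ext θ
      rw [cauchyInt_eq_add hγ (hw θ)]
      ring
    have hc := continuous_comp_circleMap hd
    have hc' : Continuous fun θ => (r : ℂ) * (circleMap 0 1 θ ^ 1 *
        cauchyInt (fun s => γ s * Complex.exp (-(s * Complex.I))) (r * circleMap 0 1 θ)) :=
      continuous_const.mul (((continuous_circleMap 0 1).pow 1).mul hc)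
    rw [e, angularCoeff_add _ intervalIntegrable_const (hc'.intervalIntegrable _ _),
      angularCoeff_const_mul, angularCoeff_one_of_ne_zero (by omega), mul_zero, zero_add,
      angularCoeff_const_mul, angularCoeff_circleMap_mul_pow]
    have : ((n + 1 : ℕ) : ℤ) - (1 : ℕ) = n := by push_cast; ring
    rw [this, ih hγ', ← mul_assoc, pow_succ']
    congr 2
    ext s
    ring

/-- The Herglotz integral of a real density on the line wrapped around the unit circle. -/
noncomputable def herglotz (γ : ℝ → ℝ) (w : ℂ) : ℂ :=
  ∫ s, (γ s : ℂ) * ((1 + w * Complex.exp (-(s * Complex.I))) /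
    (1 - w * Complex.exp (-(s * Complex.I))))

lemma herglotz_integrand_eq {w : ℂ} (hw : ‖w‖ < 1) (c : ℂ) (s : ℝ) :
    c * ((1 + w * Complex.exp (-(s * Complex.I))) / (1 - w * Complex.exp (-(s * Complex.I)))) =
      2 * (c / (1 - w * Complex.exp (-(s * Complex.I)))) - c := by
  have := one_sub_mul_exp_ne_zero hw s
  field_simp
  ring

lemma integrable_herglotz {γ : ℝ → ℝ} (hγ : Integrable γ) {w : ℂ} (hw : ‖w‖ < 1) :
    Integrable fun s : ℝ => (γ s : ℂ) * ((1 + w * Complex.exp (-(s * Complex.I))) /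
      (1 - w * Complex.exp (-(s * Complex.I)))) := by
  simp_rw [herglotz_integrand_eq hw]
  exact ((integrable_cauchyInt hγ.ofReal hw).const_mul 2).sub hγ.ofReal

lemma herglotz_eq {γ : ℝ → ℝ} (hγ : Integrable γ) {w : ℂ} (hw : ‖w‖ < 1) :
    herglotz γ w = 2 * cauchyInt (fun s => (γ s : ℂ)) w - ∫ s, (γ s : ℂ) := by
  unfold herglotz cauchyInt
  simp_rw [herglotz_integrand_eq hw]
  have hγc : Integrable fun s => (γ s : ℂ) := hγ.ofReal
  rw [integral_sub ((integrable_cauchyInt hγc hw).const_mul 2) hγc, integral_const_mul]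

lemma herglotz_zero (γ : ℝ → ℝ) : herglotz γ 0 = ((∫ s, γ s : ℝ) : ℂ) := by
  simpa [herglotz] using integral_complex_ofReal

lemma differentiableOn_herglotz {γ : ℝ → ℝ} (hγ : Integrable γ) :
    DifferentiableOn ℂ (herglotz γ) (Metric.ball 0 1) := by
  refine DifferentiableOn.congr (f := fun w => 2 * cauchyInt (fun s => (γ s : ℂ)) w -
    ∫ s, (γ s : ℂ)) ?_ fun w hw => herglotz_eq hγ (by simpa using hw)
  exact ((differentiableOn_cauchyInt hγ.ofReal).const_mul 2).sub_const _

/-- Fourier coefficients of the Herglotz integral dominate those of the density. -/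
lemma norm_integral_exp_le_angularCoeff_herglotz {γ : ℝ → ℝ} (hγ : Integrable γ) {r : ℝ}
    (hr0 : 0 ≤ r) (hr1 : r < 1) (n : ℕ) :
    r ^ n * ‖∫ s, (γ s : ℂ) * Complex.exp (-(s * Complex.I)) ^ n‖ ≤
      ‖angularCoeff n (fun θ => herglotz γ (r * circleMap 0 1 θ))‖ := by
  have hw : ∀ θ, ‖(r : ℂ) * circleMap 0 1 θ‖ < 1 := fun θ => by
    rw [norm_mul, Complex.norm_real, Real.norm_of_nonneg hr0]; simpa using hr1
  have hγc : Integrable fun s => (γ s : ℂ) := hγ.ofReal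
  have hc := continuous_comp_circleMap
    (diffContOnCl_comp_mul (differentiableOn_cauchyInt hγc) hr0 hr1)
  have e : (fun θ => herglotz γ (r * circleMap 0 1 θ)) = fun θ =>
      2 * cauchyInt (fun s => (γ s : ℂ)) (r * circleMap 0 1 θ) + (-∫ s, (γ s : ℂ)) * 1 := by
    ext θ; rw [herglotz_eq hγ (hw θ)]; ring
  have hc' : Continuous fun θ => 2 * cauchyInt (fun s => (γ s : ℂ)) (r * circleMap 0 1 θ) :=
    continuous_const.mul hc
  rw [e, angularCoeff_add _ (hc'.intervalIntegrable _ _) intervalIntegrable_const,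
    angularCoeff_const_mul, angularCoeff_const_mul, angularCoeff_cauchyInt hr0 hr1 n hγc]
  have hn : ‖(r : ℂ) ^ n * ∫ s, (γ s : ℂ) * Complex.exp (-(s * Complex.I)) ^ n‖ =
      r ^ n * ‖∫ s, (γ s : ℂ) * Complex.exp (-(s * Complex.I)) ^ n‖ := by
    rw [norm_mul, norm_pow, Complex.norm_real, Real.norm_of_nonneg hr0]
  rcases Nat.eq_zero_or_pos n with rfl | hn0
  · have h1 : angularCoeff ((0 : ℕ) : ℤ) (fun _ => 1) = 1 := by
      simpa using angularCoeff_zero_of_diffContOnCl (F := fun _ => 1) diffContOnCl_const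
    rw [h1]
    simp only [pow_zero, mul_one, one_mul]
    refine le_of_eq ?_
    congr 1
    ring
  · rw [angularCoeff_one_of_ne_zero (by omega), mul_zero, add_zero, norm_mul, ← hn]
    have := norm_nonneg ((r : ℂ) ^ n * ∫ s, (γ s : ℂ) * Complex.exp (-(s * Complex.I)) ^ n)
    norm_num at this ⊢
    linarith

lemma re_herglotz_kernel_nonneg {w : ℂ} (hw : ‖w‖ < 1) (s : ℝ) :
    0 ≤ ((1 + w * Complex.exp (-(s * Complex.I))) /
      (1 - w * Complex.exp (-(s * Complex.I)))).re := by
  set ζ := w * Complex.exp (-(s * Complex.I)) with hζ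
  have h : Complex.normSq ζ ≤ 1 := by
    rw [Complex.normSq_eq_norm_sq, hζ, norm_mul, norm_exp_neg_ofReal_mul_I, mul_one]
    nlinarith [norm_nonneg w]
  rw [Complex.normSq_apply] at h
  rw [Complex.div_re, ← add_div]
  refine div_nonneg ?_ (Complex.normSq_nonneg _)
  simp
  nlinarith

lemma re_herglotz {γ : ℝ → ℝ} (hγ : Integrable γ) {w : ℂ} (hw : ‖w‖ < 1) :
    (herglotz γ w).re = ∫ s, γ s * ((1 + w * Complex.exp (-(s * Complex.I))) /
      (1 - w * Complex.exp (-(s * Complex.I)))).re := by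
  have := integral_re (integrable_herglotz hγ hw)
  rw [herglotz]
  refine this.symm.trans (integral_congr_ae (Eventually.of_forall fun s => ?_))
  exact Complex.re_ofReal_mul _ _

lemma re_herglotz_nonneg {γ : ℝ → ℝ} (hγ : Integrable γ) (h0 : ∀ s, 0 ≤ γ s) {w : ℂ}
    (hw : ‖w‖ < 1) : 0 ≤ (herglotz γ w).re := by
  rw [re_herglotz hγ hw]
  exact integral_nonneg fun s => mul_nonneg (h0 s) (re_herglotz_kernel_nonneg hw s)

lemma abs_re_herglotz_le {γ : ℝ → ℝ} (hγ : Integrable γ) {w : ℂ} (hw : ‖w‖ < 1) :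
    |(herglotz γ w).re| ≤ (herglotz (fun s => |γ s|) w).re := by
  rw [re_herglotz hγ hw, re_herglotz hγ.abs hw]
  refine abs_integral_le_integral_abs.trans (le_of_eq (integral_congr_ae
    (Eventually.of_forall fun s => ?_)))
  simp only [abs_mul, abs_of_nonneg (re_herglotz_kernel_nonneg hw s)]

lemma norm_mul_circleMap_lt {ρ : ℝ} (h0 : 0 ≤ ρ) (h1 : ρ < 1) (θ : ℝ) :
    ‖(ρ : ℂ) * circleMap 0 1 θ‖ < 1 := by
  rw [norm_mul, Complex.norm_real, Real.norm_of_nonneg h0]; simpa using h1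

lemma integral_comp_circleMap_eq {F : ℂ → ℂ} (hF : DiffContOnCl ℂ F (Metric.ball 0 1)) :
    ∫ θ in (0 : ℝ)..2 * π, F (circleMap 0 1 θ) = 2 * π * F 0 := by
  rw [← angularCoeff_zero_of_diffContOnCl hF, angularCoeff]
  simp only [Int.cast_zero, zero_mul, neg_zero, Complex.exp_zero, one_mul]
  rw [mul_inv_cancel_left₀ (by simp)]

lemma integral_re_comp_circleMap_eq {F : ℂ → ℂ} (hF : DiffContOnCl ℂ F (Metric.ball 0 1)) :
    ∫ θ in (0 : ℝ)..2 * π, (F (circleMap 0 1 θ)).re = 2 * π * (F 0).re := by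
  have h := congrArg Complex.re (integral_comp_circleMap_eq hF)
  have h2 := Complex.reCLM.intervalIntegral_comp_comm
    ((continuous_comp_circleMap hF).intervalIntegrable (μ := volume) 0 (2 * π))
  simp only [Complex.reCLM_apply] at h2
  rw [h2, h]
  have : (2 * π * F 0 : ℂ) = ((2 * π : ℝ) : ℂ) * F 0 := by push_cast; ring
  rw [this, Complex.re_ofReal_mul]

lemma integral_abs_re_herglotz_le {γ : ℝ → ℝ} (hγ : Integrable γ) {ρ : ℝ}
    (h0 : 0 ≤ ρ) (h1 : ρ < 1) :
    ∫ θ in (0 : ℝ)..2 * π, |(herglotz γ (ρ * circleMap 0 1 θ)).re| ≤ 2 * π * ∫ s, |γ s| := by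
  have hd := diffContOnCl_comp_mul (differentiableOn_herglotz hγ) h0 h1
  have hd' := diffContOnCl_comp_mul (differentiableOn_herglotz hγ.abs) h0 h1
  have e := integral_re_comp_circleMap_eq hd'
  simp only [mul_zero, herglotz_zero, Complex.ofReal_re] at e
  rw [← e]
  refine intervalIntegral.integral_mono_on Real.two_pi_pos.le
    ((Complex.continuous_re.comp (continuous_comp_circleMap hd)).abs.intervalIntegrable _ _)
    ((Complex.continuous_re.comp (continuous_comp_circleMap hd')).intervalIntegrable _ _)
    fun θ _ => abs_re_herglotz_le hγ (norm_mul_circleMap_lt h0 h1 θ)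

lemma re_cpow_three_quarters_ge {z : ℂ} (hz : 0 < z.re) :
    Real.cos (3 * π / 8) * ‖z‖ ^ (3 / 4 : ℝ) ≤ (z ^ ((3 / 4 : ℝ) : ℂ)).re := by
  rw [Complex.cpow_ofReal, Complex.re_ofReal_mul, mul_comm]
  have hpi := Real.pi_pos
  have harg : |Complex.arg z| ≤ π / 2 := Complex.abs_arg_le_pi_div_two_iff.2 hz.le
  have hcos : Real.cos (3 * π / 8) ≤ Real.cos (Complex.arg z * (3 / 4)) := by
    rw [← Real.cos_abs (Complex.arg z * (3 / 4)), abs_mul, abs_of_pos (by norm_num : (0:ℝ) < 3 / 4)]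
    refine Real.cos_le_cos_of_nonneg_of_le_pi (by positivity) (by linarith) (by linarith)
  refine mul_le_mul_of_nonneg_left ?_ (by positivity)
  simpa [← Complex.ofReal_cos, ← Complex.ofReal_sin] using hcos

/-- Kolmogorov's inequality for densities that are nonnegative. -/
lemma integral_norm_herglotz_rpow_le_of_nonneg {γ : ℝ → ℝ} (hγ : Integrable γ)
    (hγ0 : ∀ s, 0 ≤ γ s) {ρ : ℝ} (h0 : 0 ≤ ρ) (h1 : ρ < 1) :
    ∫ θ in (0 : ℝ)..2 * π, ‖herglotz γ (ρ * circleMap 0 1 θ)‖ ^ (3 / 4 : ℝ) ≤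
      2 * π * ((∫ s, γ s) + 1) ^ (3 / 4 : ℝ) / Real.cos (3 * π / 8) := by
  have hpi := Real.pi_pos
  have hcos : 0 < Real.cos (3 * π / 8) := Real.cos_pos_of_mem_Ioo ⟨by linarith, by linarith⟩
  have hre : ∀ w ∈ Metric.ball (0 : ℂ) 1, 0 < (herglotz γ w + 1).re := fun w hw => by
    have := re_herglotz_nonneg hγ hγ0 (w := w) (by simpa using hw)
    rw [Complex.add_re, Complex.one_re]; linarith
  have hH : DifferentiableOn ℂ (fun w => (herglotz γ w + 1) ^ ((3 / 4 : ℝ) : ℂ))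
      (Metric.ball 0 1) :=
    DifferentiableOn.cpow ((differentiableOn_herglotz hγ).add_const _)
      (differentiableOn_const _) fun w hw => Or.inl (hre w hw)
  have hd := diffContOnCl_comp_mul hH h0 h1
  have e := integral_re_comp_circleMap_eq hd
  have hnn : 0 ≤ ∫ s, γ s := integral_nonneg hγ0
  have hv : ((herglotz γ (ρ * 0) + 1) ^ ((3 / 4 : ℝ) : ℂ)).re = ((∫ s, γ s) + 1) ^ (3 / 4 : ℝ) := by
    rw [mul_zero, herglotz_zero, ← Complex.ofReal_one, ← Complex.ofReal_add,
      ← Complex.ofReal_cpow (by linarith), Complex.ofReal_re]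
  rw [hv] at e
  rw [le_div_iff₀ hcos, ← e, ← intervalIntegral.integral_mul_const]
  have hd' := diffContOnCl_comp_mul (differentiableOn_herglotz hγ) h0 h1
  refine intervalIntegral.integral_mono_on Real.two_pi_pos.le
    ((((continuous_comp_circleMap hd').norm.rpow_const fun _ => Or.inr (by norm_num)).mul
      continuous_const).intervalIntegrable _ _)
    ((Complex.continuous_re.comp (continuous_comp_circleMap hd)).intervalIntegrable _ _)
    fun θ _ => ?_
  have hw := norm_mul_circleMap_lt h0 h1 θ
  refine le_trans ?_ (re_cpow_three_quarters_ge (hre _ (by simpa using hw)))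
  rw [mul_comm]
  gcongr
  have hr := re_herglotz_nonneg hγ hγ0 hw
  rw [← sq_le_sq₀ (norm_nonneg _) (norm_nonneg _), ← Complex.normSq_eq_norm_sq,
    ← Complex.normSq_eq_norm_sq, Complex.normSq_apply, Complex.normSq_apply]
  simp
  nlinarith

lemma herglotz_sub {γ₁ γ₂ : ℝ → ℝ} (h₁ : Integrable γ₁) (h₂ : Integrable γ₂) {w : ℂ}
    (hw : ‖w‖ < 1) : herglotz (fun s => γ₁ s - γ₂ s) w = herglotz γ₁ w - herglotz γ₂ w := by
  unfold herglotz
  rw [← integral_sub (integrable_herglotz h₁ hw) (integrable_herglotz h₂ hw)]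
  congr 1
  ext s
  push_cast
  ring

/-- Kolmogorov's inequality, uniformly in the radius. -/
lemma exists_integral_norm_herglotz_rpow_le {γ : ℝ → ℝ} (hγ : Integrable γ) :
    ∃ B : ℝ, ∀ ρ : ℝ, 0 ≤ ρ → ρ < 1 →
      ∫ θ in (0 : ℝ)..2 * π, ‖herglotz γ (ρ * circleMap 0 1 θ)‖ ^ (3 / 4 : ℝ) ≤ B := by
  refine ⟨2 * π * ((∫ s, max (γ s) 0) + 1) ^ (3 / 4 : ℝ) / Real.cos (3 * π / 8) +
    2 * π * ((∫ s, max (-γ s) 0) + 1) ^ (3 / 4 : ℝ) / Real.cos (3 * π / 8), fun ρ h0 h1 => ?_⟩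
  have hp := hγ.pos_part
  have hn := hγ.neg_part
  have e : γ = fun s => max (γ s) 0 - max (-γ s) 0 := by
    ext s
    rcases le_total 0 (γ s) with h | h
    · rw [max_eq_left h, max_eq_right (by linarith)]; ring
    · rw [max_eq_right h, max_eq_left (by linarith)]; ring
  have hc : ∀ {η : ℝ → ℝ}, Integrable η → Continuous fun θ =>
      ‖herglotz η (ρ * circleMap 0 1 θ)‖ ^ (3 / 4 : ℝ) := fun hη =>
    (continuous_comp_circleMap
      (diffContOnCl_comp_mul (differentiableOn_herglotz hη) h0 h1)).norm.rpow_const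
      fun _ => Or.inr (by norm_num)
  refine le_trans ?_ (add_le_add
    (integral_norm_herglotz_rpow_le_of_nonneg hp (fun s => le_max_right _ _) h0 h1)
    (integral_norm_herglotz_rpow_le_of_nonneg hn (fun s => le_max_right _ _) h0 h1))
  rw [← intervalIntegral.integral_add ((hc hp).intervalIntegrable _ _)
    ((hc hn).intervalIntegrable _ _)]
  refine intervalIntegral.integral_mono_on Real.two_pi_pos.le ((hc hγ).intervalIntegrable _ _)
    (((hc hp).add (hc hn)).intervalIntegrable _ _) fun θ _ => ?_
  have hw := norm_mul_circleMap_lt h0 h1 θ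
  refine le_trans ?_ (Real.rpow_add_le_add_rpow (norm_nonneg _) (norm_nonneg _) (by norm_num)
    (by norm_num))
  refine Real.rpow_le_rpow (norm_nonneg _) ?_ (by norm_num)
  conv_lhs => rw [e, herglotz_sub hp hn hw]
  exact norm_sub_le _ _

/-- Convergence of integrals under a uniform bound in `L^{3/2}`. -/
lemma tendsto_integral_zero_of_rpow_bound {μ : Measure ℝ} [IsFiniteMeasure μ] {l : Filter ℝ}
    [l.IsCountablyGenerated] {v w : ℝ → ℝ → ℝ} {B : ℝ}
    (hm : ∀ᶠ ρ in l, AEStronglyMeasurable (v ρ) μ) (h0 : ∀ ρ θ, 0 ≤ v ρ θ)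
    (hvw : ∀ ρ θ, v ρ θ ^ (3 / 2 : ℝ) ≤ w ρ θ) (hw : ∀ᶠ ρ in l, Integrable (w ρ) μ)
    (hB : ∀ᶠ ρ in l, ∫ θ, w ρ θ ∂μ ≤ B)
    (hlim : ∀ᵐ θ ∂μ, Tendsto (fun ρ => v ρ θ) l (nhds 0)) :
    Tendsto (fun ρ => ∫ θ, v ρ θ ∂μ) l (nhds 0) := by
  rw [Metric.tendsto_nhds]
  intro ε hε
  set L := 2 * (|B| + 1) / ε with hL
  have hL0 : 0 < L := by positivity
  have hmin : Tendsto (fun ρ => ∫ θ, min (v ρ θ) (L ^ 2) ∂μ) l (nhds (∫ _, (0 : ℝ) ∂μ)) := by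
    refine tendsto_integral_filter_of_dominated_convergence (fun _ => L ^ 2) ?_ ?_
      (integrable_const _) ?_
    · filter_upwards [hm] with ρ hρ
      exact hρ.inf aestronglyMeasurable_const
    · refine Eventually.of_forall fun ρ => Eventually.of_forall fun θ => ?_
      rw [Real.norm_of_nonneg (le_min (h0 ρ θ) (by positivity))]
      exact min_le_right _ _
    · filter_upwards [hlim] with θ hθ
      have := hθ.min (tendsto_const_nhds (x := L ^ 2))
      rwa [min_eq_left (by positivity)] at this
  rw [integral_zero] at hmin
  have hev : ∀ᶠ ρ in l, ∫ θ, min (v ρ θ) (L ^ 2) ∂μ < ε / 2 :=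
    hmin.eventually (gt_mem_nhds (by positivity))
  filter_upwards [hev, hm, hw, hB] with ρ h1 h2 h3 h4
  have hpt : ∀ θ, v ρ θ ≤ min (v ρ θ) (L ^ 2) + w ρ θ / L := by
    intro θ
    have hw0 : 0 ≤ w ρ θ := (Real.rpow_nonneg (h0 ρ θ) _).trans (hvw ρ θ)
    rcases le_total (v ρ θ) (L ^ 2) with h | h
    · rw [min_eq_left h]
      have : 0 ≤ w ρ θ / L := by positivity
      linarith
    · have hv0 : 0 < v ρ θ := lt_of_lt_of_le (by positivity) h
      have : v ρ θ ≤ w ρ θ / L := by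
        rw [le_div_iff₀ hL0]
        refine le_trans ?_ (hvw ρ θ)
        have e : v ρ θ ^ (3 / 2 : ℝ) = v ρ θ * √(v ρ θ) := by
          rw [Real.sqrt_eq_rpow, ← Real.rpow_one_add' hv0.le (by norm_num)]
          norm_num
        rw [e]
        gcongr
        exact Real.le_sqrt_of_sq_le h
      have h5 : 0 ≤ min (v ρ θ) (L ^ 2) := le_min hv0.le (by positivity)
      linarith
  have hmi : Integrable (fun θ => min (v ρ θ) (L ^ 2)) μ := by
    refine Integrable.of_bound (h2.inf aestronglyMeasurable_const) (L ^ 2)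
      (Eventually.of_forall fun θ => ?_)
    rw [Real.norm_of_nonneg (le_min (h0 ρ θ) (by positivity))]
    exact min_le_right _ _
  have hsum := hmi.add (h3.div_const L)
  have hle : ∫ θ, v ρ θ ∂μ ≤ ∫ θ, (min (v ρ θ) (L ^ 2) + w ρ θ / L) ∂μ :=
    integral_mono_of_nonneg (Eventually.of_forall (h0 ρ)) hsum (Eventually.of_forall hpt)
  rw [integral_add hmi (h3.div_const L), integral_div] at hle
  have hBL : (∫ θ, w ρ θ ∂μ) / L < ε / 2 := by
    rw [div_lt_iff₀ hL0, hL]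
    have : ε / 2 * (2 * (|B| + 1) / ε) = |B| + 1 := by field_simp
    rw [this]
    linarith [le_abs_self B]
  rw [Real.dist_eq, sub_zero, abs_of_nonneg (integral_nonneg (h0 ρ))]
  linarith

lemma sqrt_norm_le_add (z : ℂ) : √‖z‖ ≤ √|z.re| + √|z.im| := by
  rw [Real.sqrt_le_left (by positivity)]
  have h1 := Complex.norm_le_abs_re_add_abs_im z
  nlinarith [Real.sq_sqrt (abs_nonneg z.re), Real.sq_sqrt (abs_nonneg z.im),
    Real.sqrt_nonneg |z.re|, Real.sqrt_nonneg |z.im|,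
    mul_nonneg (Real.sqrt_nonneg |z.re|) (Real.sqrt_nonneg |z.im|)]

/-- If the conjugate function of an integrable density is dominated by an integrable function,
the Fourier coefficients of the density satisfy Hardy's inequality. -/
lemma sum_norm_integral_exp_div_le {γ M : ℝ → ℝ} (hγ : Integrable γ) (hM0 : ∀ θ, 0 ≤ M θ)
    (hM : IntervalIntegrable M volume 0 (2 * π))
    (hlim : ∀ᵐ θ ∂(volume.restrict (Ioc 0 (2 * π))), ∀ η > 0, ∀ᶠ ρ : ℝ in nhdsWithin 1 (Iio 1),
      |(herglotz γ (ρ * circleMap 0 1 θ)).im| ≤ M θ + η) (N : ℕ) :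
    ∑ n ∈ Finset.range N, ‖∫ s, (γ s : ℂ) * Complex.exp (-(s * Complex.I)) ^ n‖ / (n + 1 : ℝ) ≤
      80 * ((∫ s, |γ s|) + ∫ θ in (0 : ℝ)..2 * π, M θ) := by
  have hpi := Real.pi_pos
  set F : ℝ → ℝ → ℂ := fun ρ θ => herglotz γ (ρ * circleMap 0 1 θ) with hFdef
  set u : ℝ → ℝ → ℝ := fun ρ θ => min (√‖F ρ θ‖) (√|(F ρ θ).re| + √(M θ)) with hu
  set v : ℝ → ℝ → ℝ := fun ρ θ => √‖F ρ θ‖ - u ρ θ with hv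
  set U := (∫ s, |γ s|) + ∫ θ in (0 : ℝ)..2 * π, M θ with hU
  have hradius : ∀ᶠ ρ : ℝ in nhdsWithin 1 (Iio 1), 0 ≤ ρ ∧ ρ < 1 := by
    filter_upwards [self_mem_nhdsWithin,
      nhdsWithin_le_nhds (Ioi_mem_nhds (zero_lt_one' ℝ))] with ρ h1 h2
    exact ⟨le_of_lt h2, h1⟩
  have hd : ∀ {ρ : ℝ}, 0 ≤ ρ → ρ < 1 → DiffContOnCl ℂ (fun z => herglotz γ (ρ * z))
      (Metric.ball 0 1) := fun h0 h1 => diffContOnCl_comp_mul (differentiableOn_herglotz hγ) h0 h1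
  have hFc : ∀ {ρ : ℝ}, 0 ≤ ρ → ρ < 1 → Continuous (F ρ) := fun h0 h1 =>
    continuous_comp_circleMap (hd h0 h1)
  have hMm : AEStronglyMeasurable M (volume.restrict (Ioc 0 (2 * π))) := hM.1.aestronglyMeasurable
  have hu0 : ∀ ρ θ, 0 ≤ u ρ θ := fun ρ θ => le_min (Real.sqrt_nonneg _) (by positivity)
  have huk : ∀ ρ θ, u ρ θ ≤ √‖F ρ θ‖ := fun ρ θ => min_le_left _ _
  have hum : ∀ {ρ : ℝ}, 0 ≤ ρ → ρ < 1 →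
      AEStronglyMeasurable (u ρ) (volume.restrict (Ioc 0 (2 * π))) := fun h0 h1 => by
    refine (hFc h0 h1).norm.sqrt.aestronglyMeasurable.inf ?_
    exact (Complex.continuous_re.comp (hFc h0 h1)).abs.sqrt.aestronglyMeasurable.add
      (Real.continuous_sqrt.comp_aestronglyMeasurable hMm)
  have hu2 : ∀ {ρ : ℝ}, 0 ≤ ρ → ρ < 1 → (2 * π)⁻¹ * ∫ θ in (0 : ℝ)..2 * π, u ρ θ ^ 2 ≤ 2 * U := by
    intro ρ h0 h1
    have hR : Continuous fun θ => |(F ρ θ).re| := (Complex.continuous_re.comp (hFc h0 h1)).abs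
    have hI : IntervalIntegrable (fun θ => 2 * |(F ρ θ).re| + 2 * M θ) volume 0 (2 * π) :=
      ((hR.intervalIntegrable _ _).const_mul 2).add (hM.const_mul 2)
    have hpt : ∀ θ, u ρ θ ^ 2 ≤ 2 * |(F ρ θ).re| + 2 * M θ := fun θ => by
      have h2 : u ρ θ ≤ √|(F ρ θ).re| + √(M θ) := min_le_right _ _
      calc u ρ θ ^ 2 ≤ (√|(F ρ θ).re| + √(M θ)) ^ 2 := by gcongr
        _ ≤ 2 * √|(F ρ θ).re| ^ 2 + 2 * √(M θ) ^ 2 := by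
            nlinarith [sq_nonneg (√|(F ρ θ).re| - √(M θ))]
        _ = _ := by rw [Real.sq_sqrt (abs_nonneg _), Real.sq_sqrt (hM0 θ)]
    have h3 : ∫ θ in (0 : ℝ)..2 * π, u ρ θ ^ 2 ≤
        ∫ θ in (0 : ℝ)..2 * π, (2 * |(F ρ θ).re| + 2 * M θ) := by
      rw [intervalIntegral.integral_of_le Real.two_pi_pos.le,
        intervalIntegral.integral_of_le Real.two_pi_pos.le]
      exact integral_mono_of_nonneg (Eventually.of_forall fun θ => sq_nonneg _) hI.1
        (Eventually.of_forall hpt)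
    rw [intervalIntegral.integral_add ((hR.intervalIntegrable _ _).const_mul 2) (hM.const_mul 2),
      intervalIntegral.integral_const_mul, intervalIntegral.integral_const_mul] at h3
    have h4 := integral_abs_re_herglotz_le hγ h0 h1
    have hMn : 0 ≤ ∫ θ in (0 : ℝ)..2 * π, M θ :=
      intervalIntegral.integral_nonneg Real.two_pi_pos.le fun θ _ => hM0 θ
    rw [inv_mul_le_iff₀ Real.two_pi_pos, hU]
    have : 2 ≤ 2 * π * 2 := by nlinarith [Real.pi_gt_three]
    nlinarith [Real.pi_gt_three]
  have hvlim : Tendsto (fun ρ => ∫ θ in (0 : ℝ)..2 * π, v ρ θ) (nhdsWithin 1 (Iio 1)) (nhds 0) := by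
    obtain ⟨B, hB⟩ := exists_integral_norm_herglotz_rpow_le hγ
    simp only [intervalIntegral.integral_of_le Real.two_pi_pos.le] at hB ⊢
    have hv0 : ∀ ρ θ, 0 ≤ v ρ θ := fun ρ θ => sub_nonneg.2 (huk ρ θ)
    refine tendsto_integral_zero_of_rpow_bound (w := fun ρ θ => ‖F ρ θ‖ ^ (3 / 4 : ℝ)) (B := B)
      ?_ hv0 (fun ρ θ => ?_) ?_ ?_ ?_
    · filter_upwards [hradius] with ρ hρ
      exact (hFc hρ.1 hρ.2).norm.sqrt.aestronglyMeasurable.sub (hum hρ.1 hρ.2)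
    · calc v ρ θ ^ (3 / 2 : ℝ) ≤ √‖F ρ θ‖ ^ (3 / 2 : ℝ) :=
            Real.rpow_le_rpow (hv0 ρ θ) (by simp only [hv]; linarith [hu0 ρ θ]) (by norm_num)
        _ = ‖F ρ θ‖ ^ (3 / 4 : ℝ) := by
            rw [Real.sqrt_eq_rpow, ← Real.rpow_mul (norm_nonneg _)]
            norm_num
    · filter_upwards [hradius] with ρ hρ
      exact (((hFc hρ.1 hρ.2).norm.rpow_const fun _ => Or.inr (by norm_num)).intervalIntegrable
        0 (2 * π)).1
    · filter_upwards [hradius] with ρ hρ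
      exact hB ρ hρ.1 hρ.2
    · filter_upwards [hlim] with θ hθ
      rw [Metric.tendsto_nhds]
      intro ε hε
      filter_upwards [hθ ((ε / 2) ^ 2) (by positivity)] with ρ hρ
      rw [Real.dist_eq, sub_zero, abs_of_nonneg (hv0 ρ θ)]
      have h1 : √|(F ρ θ).im| ≤ √(M θ) + ε / 2 := by
        rw [Real.sqrt_le_left (by positivity)]
        nlinarith [Real.sq_sqrt (hM0 θ), Real.sqrt_nonneg (M θ),
          mul_nonneg (Real.sqrt_nonneg (M θ)) hε.le]
      have h2 := sqrt_norm_le_add (F ρ θ)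
      simp only [hv, hu]
      rcases min_cases (√‖F ρ θ‖) (√|(F ρ θ).re| + √(M θ)) with h | h <;> rw [h.1] <;> linarith
  set c : ℕ → ℝ := fun n => ‖∫ s, (γ s : ℂ) * Complex.exp (-(s * Complex.I)) ^ n‖ with hc
  have key : ∀ r ρ : ℝ, 0 ≤ r → r < 1 → 0 ≤ ρ → ρ < 1 →
      ∑ n ∈ Finset.range N, (r * ρ) ^ n * c n / (n + 1 : ℝ) ≤ 80 * U +
        40 * ((2 * π)⁻¹ * ∫ θ in (0 : ℝ)..2 * π, v ρ θ) ^ 2 / (1 - r ^ 2) := by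
    intro r ρ hr0 hr1 h0 h1
    have hr2 : 0 < 1 - r ^ 2 := by nlinarith
    have h := sum_angularCoeff_div_le_of_split (hd h0 h1) (hum h0 h1) (hu0 ρ) (huk ρ) hr0 hr1 N
    refine (Finset.sum_le_sum fun n _ => ?_).trans (h.trans ?_)
    · gcongr
      have := norm_integral_exp_le_angularCoeff_herglotz hγ (r := r * ρ) (by positivity)
        (by nlinarith) n
      refine this.trans (le_of_eq ?_)
      congr 2
      ext θ
      congr 1
      push_cast
      ring
    · have := hu2 h0 h1
      exact add_le_add (by linarith) le_rfl
  have key2 : ∀ r : ℝ, 0 ≤ r → r < 1 →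
      ∑ n ∈ Finset.range N, (r * 1) ^ n * c n / (n + 1 : ℝ) ≤ 80 * U := by
    intro r hr0 hr1
    have t1 : Tendsto (fun ρ : ℝ => ∑ n ∈ Finset.range N, (r * ρ) ^ n * c n / (n + 1 : ℝ))
        (nhdsWithin 1 (Iio 1)) (nhds (∑ n ∈ Finset.range N, (r * 1) ^ n * c n / (n + 1 : ℝ))) := by
      refine Tendsto.mono_left ?_ nhdsWithin_le_nhds
      exact Continuous.tendsto (by fun_prop) 1
    have t2 := (((hvlim.const_mul (2 * π)⁻¹).pow 2).const_mul 40).div_const (1 - r ^ 2)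
    have t3 := t2.const_add (80 * U)
    have := le_of_tendsto_of_tendsto t1 t3 (by
      filter_upwards [hradius] with ρ hρ
      exact key r ρ hr0 hr1 hρ.1 hρ.2)
    simpa using this
  have t1 : Tendsto (fun r : ℝ => ∑ n ∈ Finset.range N, (r * 1) ^ n * c n / (n + 1 : ℝ))
      (nhdsWithin 1 (Iio 1)) (nhds (∑ n ∈ Finset.range N, (1 * 1) ^ n * c n / (n + 1 : ℝ))) := by
    refine Tendsto.mono_left ?_ nhdsWithin_le_nhds
    exact Continuous.tendsto (by fun_prop) 1
  have := le_of_tendsto t1 (by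
    filter_upwards [hradius] with r hr
    exact key2 r hr.1 hr.2)
  simpa using this

/-- Interchange of the order of integration over a triangle. -/
lemma integral_triangle_swap {E : Type*} [NormedAddCommGroup E] [NormedSpace ℝ E] [CompleteSpace E]
    {w : ℝ → ℝ} {h : ℝ → E} {d : ℝ → ℝ} {b : ℝ} (hb : 0 ≤ b) (hw : Continuous w)
    (hh : AEStronglyMeasurable h (volume.restrict (Ioc 0 b))) (hd : IntegrableOn d (Ioc 0 b))
    (hle : ∀ t s, 0 < t → t < s → s ≤ b → |w t| * ‖h s‖ ≤ d s) :
    ∫ t in (0 : ℝ)..b, w t • ∫ s in t..b, h s =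
      ∫ s in (0 : ℝ)..b, (∫ t in (0 : ℝ)..s, w t) • h s := by
  set μ := volume.restrict (Ioc (0 : ℝ) b) with hμ
  set k : ℝ → ℝ → E := fun t s => (Ioi t).indicator (fun s => w t • h s) s with hk
  have hmeas : AEStronglyMeasurable (Function.uncurry k) (μ.prod μ) := by
    have e : Function.uncurry k = {p : ℝ × ℝ | p.1 < p.2}.indicator (fun p => w p.1 • h p.2) := by
      ext ⟨t, s⟩
      simp only [Function.uncurry, hk, indicator, mem_Ioi, mem_ofPred_eq]
    rw [e]
    refine AEStronglyMeasurable.indicator ?_ (measurableSet_lt measurable_fst measurable_snd)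
    exact ((hw.comp continuous_fst).aestronglyMeasurable).smul hh.comp_snd
  have hint : Integrable (Function.uncurry k) (μ.prod μ) := by
    have hdm : Integrable (fun p : ℝ × ℝ => d p.2) (μ.prod μ) := by
      simpa using (integrable_const (1 : ℝ)).mul_prod (μ := μ) hd
    refine hdm.mono' hmeas ?_
    have hmem : ∀ᵐ p ∂(μ.prod μ), p ∈ Ioc (0 : ℝ) b ×ˢ Ioc (0 : ℝ) b := by
      rw [hμ, Measure.prod_restrict]
      exact ae_restrict_mem (measurableSet_Ioc.prod measurableSet_Ioc)
    have hdn : ∀ s, 0 < s → s ≤ b → 0 ≤ d s := fun s h1 h2 =>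
      le_trans (by positivity) (hle (s / 2) s (by linarith) (by linarith) h2)
    filter_upwards [hmem] with p hp
    obtain ⟨⟨h1, h2⟩, ⟨h3, h4⟩⟩ := hp
    simp only [Function.uncurry, hk, indicator, mem_Ioi]
    split_ifs with hlt
    · rw [norm_smul]
      exact hle _ _ h1 hlt h4
    · simpa using hdn _ h3 h4
  have hsw := integral_integral_swap hint
  rw [intervalIntegral.integral_of_le hb, intervalIntegral.integral_of_le hb]
  calc _ = ∫ t, ∫ s, k t s ∂μ ∂μ := by
        refine setIntegral_congr_fun measurableSet_Ioc fun t ht => ?_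
        simp only [hk, hμ]
        rw [setIntegral_indicator measurableSet_Ioi, intervalIntegral.integral_of_le ht.2,
          ← integral_smul]
        congr 2
        ext s
        simp only [mem_Ioc, mem_inter_iff, mem_Ioi]
        constructor
        · exact fun h => ⟨⟨ht.1.trans h.1, h.2⟩, h.1⟩
        · exact fun h => ⟨h.2, h.1.2⟩
    _ = _ := hsw
    _ = _ := by
        refine setIntegral_congr_fun measurableSet_Ioc fun s hs => ?_
        have e : (fun t => k t s) = (Iio s).indicator (fun t => w t • h s) := by
          ext t
          simp only [hk, indicator, mem_Ioi, mem_Iio]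
        simp only [e, hμ]
        rw [setIntegral_indicator measurableSet_Iio, integral_smul_const,
          intervalIntegral.integral_of_le hs.1.le, integral_Ioc_eq_integral_Ioo]
        congr 3
        ext t
        simp only [mem_Ioc, mem_inter_iff, mem_Iio, mem_Ioo]
        constructor
        · exact fun h => ⟨h.1.1, h.2⟩
        · exact fun h => ⟨⟨h.1, h.2.le.trans hs.2⟩, h.2⟩

lemma continuous_poissonWeight {ε : ℝ} (hε : 0 < ε) :
    Continuous fun t : ℝ => 2 * t * ε ^ 2 / (t ^ 2 + ε ^ 2) ^ 2 :=
  Continuous.div (by fun_prop) (by fun_prop) fun t => by positivity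

lemma integral_poissonWeight {ε : ℝ} (hε : 0 < ε) (a s : ℝ) :
    ∫ t in a..s, 2 * t * ε ^ 2 / (t ^ 2 + ε ^ 2) ^ 2 =
      s ^ 2 / (s ^ 2 + ε ^ 2) - a ^ 2 / (a ^ 2 + ε ^ 2) := by
  refine intervalIntegral.integral_eq_sub_of_hasDerivAt (f := fun t => t ^ 2 / (t ^ 2 + ε ^ 2))
    (fun t _ => ?_)
    ((continuous_poissonWeight hε).intervalIntegrable _ _)
  have h1 : HasDerivAt (fun t : ℝ => t ^ 2) (2 * t) t := by simpa using hasDerivAt_pow 2 t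
  have hne : t ^ 2 + ε ^ 2 ≠ 0 := by positivity
  refine (h1.div (h1.add_const (ε ^ 2)) hne).congr_deriv ?_
  congr 1
  ring

/-- Abelian theorem: truncated principal values and Poisson-smoothed ones have the same limit. -/
lemma tendsto_integral_poisson_of_tendsto_truncated {D : ℝ → ℝ} {b L : ℝ} (hb : 0 < b)
    (hD : IntervalIntegrable D volume 0 b)
    (hL : Tendsto (fun δ => ∫ s in δ..b, D s / s) (nhdsWithin 0 (Ioi 0)) (nhds L)) :
    Tendsto (fun ε => ∫ s in (0 : ℝ)..b, D s * (s / (s ^ 2 + ε ^ 2))) (nhdsWithin 0 (Ioi 0))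
      (nhds L) := by
  set A : ℝ → ℝ := fun δ => ∫ s in δ..b, D s / s with hA
  have hswap : ∀ ε > 0, ∫ s in (0 : ℝ)..b, D s * (s / (s ^ 2 + ε ^ 2)) =
      ∫ t in (0 : ℝ)..b, 2 * t * ε ^ 2 / (t ^ 2 + ε ^ 2) ^ 2 * A t := by
    intro ε hε
    have h := integral_triangle_swap (w := fun t => 2 * t * ε ^ 2 / (t ^ 2 + ε ^ 2) ^ 2)
      (h := fun s => D s / s) (d := fun s => 2 / ε ^ 2 * |D s|) hb.le
      (continuous_poissonWeight hε)
      (hD.1.aestronglyMeasurable.mul measurable_inv.aestronglyMeasurable)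
      (hD.1.abs.const_mul _) ?_
    · simp only [smul_eq_mul] at h
      rw [h]
      rw [intervalIntegral.integral_of_le hb.le, intervalIntegral.integral_of_le hb.le]
      refine setIntegral_congr_fun measurableSet_Ioc fun s hs => ?_
      have : s ≠ 0 := hs.1.ne'
      simp only [integral_poissonWeight hε]
      field_simp
      ring
    · intro t s ht hts _
      have hs : 0 < s := ht.trans hts
      have h1 : |2 * t * ε ^ 2 / (t ^ 2 + ε ^ 2) ^ 2| ≤ 2 * s / ε ^ 2 := by
        rw [abs_of_nonneg (by positivity), div_le_div_iff₀ (by positivity) (by positivity)]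
        have : (ε ^ 2) ^ 2 ≤ (t ^ 2 + ε ^ 2) ^ 2 := by gcongr; nlinarith
        calc 2 * t * ε ^ 2 * ε ^ 2 = 2 * t * (ε ^ 2) ^ 2 := by ring
          _ ≤ 2 * s * (t ^ 2 + ε ^ 2) ^ 2 := by gcongr
      calc _ ≤ 2 * s / ε ^ 2 * ‖D s / s‖ := by gcongr
        _ = _ := by
          rw [norm_div, Real.norm_eq_abs, Real.norm_of_nonneg hs.le]; field_simp
  have hAI : ∀ τ, 0 < τ → τ ≤ b → IntervalIntegrable (fun s => D s / s) volume τ b := by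
    intro τ h0 h1
    refine IntervalIntegrable.mul_continuousOn (hD.mono_set ?_) (continuousOn_inv₀.mono ?_)
    · rw [uIcc_of_le h1, uIcc_of_le hb.le]; exact Icc_subset_Icc_left h0.le
    · rw [uIcc_of_le h1]; intro s hs; exact (h0.trans_le hs.1).ne'
  have hAcont : ContinuousOn A (Ioc 0 b) := by
    intro t ht
    have ht2 : t / 2 ≤ b := by linarith [ht.1, ht.2]
    have h2 := intervalIntegral.continuousOn_primitive_interval_left
      (f := fun s => D s / s) (μ := volume) (a := t / 2) (b := b) (by
        rw [uIcc_of_le ht2, ← intervalIntegrable_iff_integrableOn_Icc_of_le ht2]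
        exact hAI (t / 2) (by linarith [ht.1]) ht2)
    rw [uIcc_of_le ht2] at h2
    refine (h2 t ⟨by linarith [ht.1], ht.2⟩).mono_of_mem_nhdsWithin ?_
    filter_upwards [self_mem_nhdsWithin,
      mem_nhdsWithin_of_mem_nhds (lt_mem_nhds (by linarith [ht.1] : t / 2 < t))] with u hu hu'
    exact ⟨hu'.le, hu.2⟩
  have hAm : AEStronglyMeasurable A (volume.restrict (Ioc 0 b)) :=
    hAcont.aestronglyMeasurable measurableSet_Ioc
  rw [Metric.tendsto_nhds]
  intro η hη
  obtain ⟨τ, hτ0, hτ⟩ : ∃ τ > 0, ∀ t, 0 < t → t ≤ τ → |A t - L| ≤ η / 4 := by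
    rw [Metric.tendsto_nhdsWithin_nhds] at hL
    obtain ⟨τ, h1, h2⟩ := hL (η / 4) (by positivity)
    refine ⟨τ / 2, by positivity, fun t ht htτ => ?_⟩
    have := h2 (x := t) ht (by rw [dist_zero_right, Real.norm_of_nonneg ht.le]; linarith)
    exact (le_of_lt this)
  set τ' := min τ b with hτ'
  have hτ'0 : 0 < τ' := lt_min hτ0 hb
  obtain ⟨C, hC⟩ : ∃ C, ∀ t ∈ Ioc τ' b, |A t - L| ≤ C := by
    refine ⟨(∫ s in τ'..b, |D s / s|) + |L|, fun t ht => ?_⟩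
    refine (abs_sub _ _).trans (add_le_add ?_ le_rfl)
    rw [hA]
    refine (intervalIntegral.abs_integral_le_integral_abs ht.2).trans ?_
    refine intervalIntegral.integral_mono_interval ht.1.le ht.2 le_rfl
      (Eventually.of_forall fun s => abs_nonneg _) (hAI τ' hτ'0 (min_le_right _ _)).abs
  have hC0 : 0 ≤ |C| := abs_nonneg C
  have hlim : Tendsto (fun ε : ℝ => η / 4 + |C| * (1 - τ' ^ 2 / (τ' ^ 2 + ε ^ 2)) +
      |L| * (1 - b ^ 2 / (b ^ 2 + ε ^ 2))) (nhdsWithin 0 (Ioi 0))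
      (nhds (η / 4 + |C| * (1 - τ' ^ 2 / (τ' ^ 2 + 0 ^ 2)) +
      |L| * (1 - b ^ 2 / (b ^ 2 + 0 ^ 2)))) := by
    refine Tendsto.mono_left ?_ nhdsWithin_le_nhds
    refine ContinuousAt.tendsto ?_
    have : τ' ^ 2 + 0 ^ 2 ≠ 0 := by positivity
    have : b ^ 2 + 0 ^ 2 ≠ 0 := by positivity
    fun_prop (disch := assumption)
  have hz : η / 4 + |C| * (1 - τ' ^ 2 / (τ' ^ 2 + 0 ^ 2)) +
      |L| * (1 - b ^ 2 / (b ^ 2 + 0 ^ 2)) = η / 4 := by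
    have : τ' ^ 2 ≠ 0 := by positivity
    have : b ^ 2 ≠ 0 := by positivity
    rw [zero_pow two_ne_zero, add_zero, add_zero, div_self ‹_›, div_self ‹_›]
    ring
  rw [hz] at hlim
  filter_upwards [self_mem_nhdsWithin, hlim.eventually (gt_mem_nhds (by linarith : η / 4 < η))]
    with ε hε hlt
  have hε : 0 < ε := hε
  refine lt_of_le_of_lt ?_ hlt
  set W : ℝ → ℝ := fun t => 2 * t * ε ^ 2 / (t ^ 2 + ε ^ 2) ^ 2 with hW
  have hWc : Continuous W := continuous_poissonWeight hε
  have hW0 : ∀ t, 0 ≤ t → 0 ≤ W t := fun t ht => by simp only [hW]; positivity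
  have hτ'b : τ' ≤ b := min_le_right _ _
  have hAb : IntervalIntegrable (fun t => W t * (A t - L)) volume 0 b := by
    have hbd : ∀ t ∈ Ioc 0 b, ‖A t - L‖ ≤ max (η / 4) C := fun t ht => by
      rcases le_or_gt t τ' with h | h
      · exact (hτ t ht.1 (h.trans (min_le_left _ _))).trans (le_max_left _ _)
      · exact (hC t ⟨h, ht.2⟩).trans (le_max_right _ _)
    exact (intervalIntegrable_of_bound hb.le (hAm.sub aestronglyMeasurable_const)
      hbd).continuousOn_mul hWc.continuousOn
  have hsub1 : IntervalIntegrable (fun t => W t * (A t - L)) volume 0 τ' :=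
    hAb.mono_set (by rw [uIcc_of_le hτ'0.le, uIcc_of_le hb.le]; exact Icc_subset_Icc_right hτ'b)
  have hsub2 : IntervalIntegrable (fun t => W t * (A t - L)) volume τ' b :=
    hAb.mono_set (by rw [uIcc_of_le hτ'b, uIcc_of_le hb.le]; exact Icc_subset_Icc_left hτ'0.le)
  have e1 : (∫ t in (0 : ℝ)..b, W t * A t) - L =
      (∫ t in (0 : ℝ)..τ', W t * (A t - L)) + (∫ t in τ'..b, W t * (A t - L)) +
        L * (b ^ 2 / (b ^ 2 + ε ^ 2) - 1) := by
    rw [intervalIntegral.integral_add_adjacent_intervals hsub1 hsub2]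
    have e2 : (∫ t in (0 : ℝ)..b, W t * A t) =
        ∫ t in (0 : ℝ)..b, (W t * (A t - L) + W t * L) := by
      congr 1; ext t; ring
    have hWL : IntervalIntegrable (fun t => W t * L) volume 0 b :=
      (hWc.mul continuous_const).intervalIntegrable _ _
    rw [e2, intervalIntegral.integral_add hAb hWL,
      intervalIntegral.integral_mul_const, hW, integral_poissonWeight hε]
    ring
  have b1 : |∫ t in (0 : ℝ)..τ', W t * (A t - L)| ≤ η / 4 := by
    have := intervalIntegral.norm_integral_le_of_norm_le (f := fun t => W t * (A t - L))
      (g := fun t => W t * (η / 4)) hτ'0.le (μ := volume)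
      (Eventually.of_forall fun t ht => by
        rw [norm_mul, Real.norm_of_nonneg (hW0 t ht.1.le)]
        exact mul_le_mul_of_nonneg_left (hτ t ht.1 (ht.2.trans (min_le_left _ _))) (hW0 t ht.1.le))
      ((hWc.mul continuous_const).intervalIntegrable _ _)
    refine this.trans ?_
    rw [intervalIntegral.integral_mul_const, hW, integral_poissonWeight hε]
    have h1 : τ' ^ 2 / (τ' ^ 2 + ε ^ 2) ≤ 1 := by
      rw [div_le_one (by positivity)]; nlinarith
    have h2 : 0 ≤ τ' ^ 2 / (τ' ^ 2 + ε ^ 2) := by positivity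
    simp only [ne_eq, OfNat.ofNat_ne_zero, not_false_eq_true, zero_pow, zero_div, sub_zero]
    nlinarith
  have b2 : |∫ t in τ'..b, W t * (A t - L)| ≤ |C| * (1 - τ' ^ 2 / (τ' ^ 2 + ε ^ 2)) := by
    have := intervalIntegral.norm_integral_le_of_norm_le (f := fun t => W t * (A t - L))
      (g := fun t => W t * |C|) hτ'b (μ := volume)
      (Eventually.of_forall fun t ht => by
        have ht0 : 0 ≤ t := hτ'0.le.trans ht.1.le
        rw [norm_mul, Real.norm_of_nonneg (hW0 t ht0)]
        exact mul_le_mul_of_nonneg_left ((hC t ht).trans (le_abs_self C)) (hW0 t ht0))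
      ((hWc.mul continuous_const).intervalIntegrable _ _)
    refine this.trans ?_
    rw [intervalIntegral.integral_mul_const, hW, integral_poissonWeight hε, mul_comm]
    gcongr
    rw [div_le_one (by positivity)]; nlinarith
  have b3 : |L * (b ^ 2 / (b ^ 2 + ε ^ 2) - 1)| = |L| * (1 - b ^ 2 / (b ^ 2 + ε ^ 2)) := by
    rw [abs_mul, abs_sub_comm, abs_of_nonneg (a := 1 - _)]
    rw [sub_nonneg, div_le_one (by positivity)]; nlinarith
  rw [Real.dist_eq, hswap ε hε, e1]
  refine (abs_add_le _ _).trans (add_le_add ((abs_add_le _ _).trans (add_le_add b1 b2)) b3.le)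

/-- The conjugate Poisson kernel of the disc, in the normalisation of `herglotz`. -/
noncomputable def conjKernel (ρ u : ℝ) : ℝ := 2 * ρ * sin u / ((1 - ρ) ^ 2 + 2 * ρ * (1 - cos u))

/-- The conjugate Poisson kernel of the half plane. -/
noncomputable def conjKernelLine (δ u : ℝ) : ℝ := 2 * u / (u ^ 2 + δ ^ 2)

lemma abs_conjKernelLine_mul_le (δ u : ℝ) : |conjKernelLine δ u| * |u| ≤ 2 := by
  rw [← abs_mul, conjKernelLine, div_mul_eq_mul_div, abs_div,
    abs_of_nonneg (by nlinarith [sq_nonneg u] : 0 ≤ 2 * u * u),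
    abs_of_nonneg (by positivity : 0 ≤ u ^ 2 + δ ^ 2)]
  refine div_le_of_le_mul₀ (by positivity) (by norm_num) ?_
  nlinarith [sq_nonneg δ]

lemma abs_conjKernel_sub_le_of_abs_le_one {ρ u : ℝ} (h0 : 1 / 2 ≤ ρ) (h1 : ρ < 1) (hu : |u| ≤ 1) :
    |conjKernel ρ u - conjKernelLine (1 - ρ) u| ≤ 10 := by
  obtain ⟨δ, hδ⟩ : ∃ δ, δ = 1 - ρ := ⟨_, rfl⟩
  have hδ0 : 0 < δ := by linarith
  have hδ1 : δ ≤ 1 := by linarith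
  rw [conjKernel, conjKernelLine, ← hδ]
  have hc := cos_bound hu
  have hs := sin_bound hu
  have hpi : π ^ 2 < 10 := by nlinarith [pi_lt_d2, pi_pos]
  have hq := cos_le_one_sub_mul_cos_sq (x := u) (by linarith [pi_gt_three])
  have hq' : u ^ 2 / 5 ≤ 1 - cos u := by
    have : 1 / 5 ≤ 2 / π ^ 2 := by rw [div_le_div_iff₀ (by norm_num) (by positivity)]; linarith
    nlinarith [sq_nonneg u]
  have hd : (δ ^ 2 + u ^ 2) / 5 ≤ δ ^ 2 + 2 * ρ * (1 - cos u) := by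
    nlinarith [sq_nonneg δ, sq_nonneg u]
  have hp : 0 < u ^ 2 + δ ^ 2 := by positivity
  have hd0 : 0 < δ ^ 2 + 2 * ρ * (1 - cos u) := by nlinarith
  have ha : 0 ≤ |u| := abs_nonneg u
  have hsq : |u| ^ 2 = u ^ 2 := sq_abs u
  have hu2 : u ^ 2 ≤ 1 := by nlinarith
  have hu4 : |u| ^ 4 = u ^ 4 := by rw [show |u| ^ 4 = (|u| ^ 2) ^ 2 by ring, hsq]; ring
  rw [hu4] at hc
  have hu54 : |u| ^ 5 ≤ u ^ 4 := by rw [← hu4]; exact pow_le_pow_of_le_one ha hu (by norm_num)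
  have hu42 : u ^ 4 ≤ |u| ^ 3 := by rw [← hu4]; exact pow_le_pow_of_le_one ha hu (by norm_num)
  have hu32 : |u| ^ 3 ≤ u ^ 2 := by rw [← hsq]; exact pow_le_pow_of_le_one ha hu (by norm_num)
  have hu40 : 0 ≤ u ^ 4 := by positivity
  have hsin : |sin u - u| ≤ |u| ^ 3 := by
    have e : sin u - u = (sin u - (u - u ^ 3 / 6)) + (- (u ^ 3 / 6)) := by ring
    rw [e]
    refine (abs_add_le _ _).trans ?_
    rw [abs_neg, abs_div, abs_pow, abs_of_nonneg (by norm_num : (0:ℝ) ≤ 6)]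
    nlinarith [pow_nonneg ha 3]
  have hA : |ρ * sin u - u| ≤ δ * |u| + u ^ 2 := by
    have e : ρ * sin u - u = ρ * (sin u - u) + (- (δ * u)) := by rw [hδ]; ring
    rw [e]
    refine (abs_add_le _ _).trans ?_
    rw [abs_neg, abs_mul, abs_mul, abs_of_nonneg hδ0.le, abs_of_nonneg (by linarith : 0 ≤ ρ)]
    nlinarith [abs_nonneg (sin u - u)]
  have hB : |u * sin u - 2 * (1 - cos u)| ≤ u ^ 4 := by
    have e : u * sin u - 2 * (1 - cos u) =
        u * (sin u - (u - u ^ 3 / 6)) + 2 * (cos u - (1 - u ^ 2 / 2)) + (- (u ^ 4 / 6)) := by ring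
    rw [e]
    refine (abs_add_three _ _ _).trans ?_
    rw [abs_neg, abs_mul, abs_mul, abs_of_nonneg (by norm_num : (0:ℝ) ≤ 2),
      abs_of_nonneg (by positivity : 0 ≤ u ^ 4 / 6)]
    nlinarith [abs_nonneg (sin u - (u - u ^ 3 / 6))]
  have e : 2 * ρ * sin u / (δ ^ 2 + 2 * ρ * (1 - cos u)) - 2 * u / (u ^ 2 + δ ^ 2) =
      (2 * δ ^ 2 * (ρ * sin u - u) + 2 * ρ * u * (u * sin u - 2 * (1 - cos u))) /
        ((δ ^ 2 + 2 * ρ * (1 - cos u)) * (u ^ 2 + δ ^ 2)) := by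
    rw [div_sub_div _ _ hd0.ne' hp.ne']
    congr 1
    ring
  rw [e, abs_div, abs_of_pos (mul_pos hd0 hp)]
  refine div_le_of_le_mul₀ (mul_pos hd0 hp).le (by norm_num) ?_
  have h3 : |2 * δ ^ 2 * (ρ * sin u - u) + 2 * ρ * u * (u * sin u - 2 * (1 - cos u))| ≤
      2 * δ ^ 2 * (δ * |u| + u ^ 2) + 2 * u ^ 4 := by
    refine (abs_add_le _ _).trans (add_le_add ?_ ?_)
    · rw [abs_mul, abs_of_nonneg (by positivity : 0 ≤ 2 * δ ^ 2)]
      gcongr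
    · rw [abs_mul, abs_mul, abs_of_nonneg (by positivity : 0 ≤ 2 * ρ)]
      have : 2 * ρ * |u| ≤ 2 := by nlinarith
      gcongr
  have h4 : 2 * (u ^ 2 + δ ^ 2) ^ 2 ≤ 10 * ((δ ^ 2 + 2 * ρ * (1 - cos u)) * (u ^ 2 + δ ^ 2)) := by
    have := mul_le_mul_of_nonneg_right hd hp.le
    linarith
  have h5 : 2 * (δ * |u|) ≤ δ ^ 2 + u ^ 2 := by nlinarith [sq_nonneg (δ - |u|)]
  have h6 : 2 * δ ^ 2 * (δ * |u|) ≤ δ ^ 2 * (δ ^ 2 + u ^ 2) := by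
    have := mul_le_mul_of_nonneg_left h5 (sq_nonneg δ)
    linarith
  linarith [mul_nonneg (sq_nonneg δ) (sq_nonneg u), sq_nonneg (δ ^ 2)]

lemma one_sub_cos_ge {u : ℝ} (h1 : 1 ≤ |u|) (h2 : |u| ≤ 5.3) : 0.19 ≤ 1 - cos u := by
  have hpi : π ^ 2 < 10 := by nlinarith [pi_lt_d2, pi_pos]
  have hpi' : 1 / 5 ≤ 2 / π ^ 2 := by rw [div_le_div_iff₀ (by norm_num) (by positivity)]; linarith
  rw [← cos_abs]
  rcases le_or_gt |u| π with h | h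
  · have hq := cos_le_one_sub_mul_cos_sq (x := |u|) (by rwa [abs_abs])
    nlinarith
  · have h3 : |2 * π - (|u|)| ≤ π := by
      rw [abs_le]; constructor <;> linarith [pi_gt_three]
    have hq := cos_le_one_sub_mul_cos_sq h3
    rw [cos_two_pi_sub] at hq
    have : 0.982 ≤ 2 * π - |u| := by linarith [pi_gt_d4]
    nlinarith

lemma abs_conjKernel_sub_le {ρ u : ℝ} (h0 : 1 / 2 ≤ ρ) (h1 : ρ < 1) (hu : |u| ≤ 5.3) :
    |conjKernel ρ u - conjKernelLine (1 - ρ) u| ≤ 13 := by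
  rcases le_or_gt |u| 1 with h | h
  · exact (abs_conjKernel_sub_le_of_abs_le_one h0 h1 h).trans (by norm_num)
  · have hc := one_sub_cos_ge h.le hu
    have hd : 0.19 ≤ (1 - ρ) ^ 2 + 2 * ρ * (1 - cos u) := by nlinarith [sq_nonneg (1 - ρ)]
    have hq : |conjKernel ρ u| ≤ 11 := by
      rw [conjKernel, abs_div, abs_of_pos (a := _ + _) (by linarith), abs_mul,
        abs_of_nonneg (by linarith : 0 ≤ 2 * ρ)]
      refine div_le_of_le_mul₀ (by linarith) (by norm_num) ?_
      nlinarith [abs_sin_le_one u, abs_nonneg (sin u)]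
    have hp : |conjKernelLine (1 - ρ) u| ≤ 2 := by
      nlinarith [abs_conjKernelLine_mul_le (1 - ρ) u, abs_nonneg (conjKernelLine (1 - ρ) u)]
    exact (abs_sub _ _).trans (by linarith)

/-- Replacing the conjugate kernel of the disc by that of the line costs only a bounded error. -/
lemma abs_cutoff_conjKernel_sub_le {χ : ℝ → ℝ} {B K : ℝ} (hB : ∀ t, |χ t| ≤ B)
    (hK : ∀ s t, |χ s - χ t| ≤ K * |s - t|) (h0 : ∀ t, t ∉ Icc (1 : ℝ) 2 → χ t = 0)
    {ρ θ : ℝ} (hρ0 : 1 / 2 ≤ ρ) (hρ1 : ρ < 1) (hθ : θ ∈ Ioc 0 (2 * π)) (s : ℝ) :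
    |χ s * conjKernel ρ (θ - s) -
      (Ioc (θ / 2) (θ + θ / 2)).indicator (fun s => χ θ * conjKernelLine (1 - ρ) (θ - s)) s| ≤
      (Icc (1 / 2 : ℝ) 3).indicator (fun _ => 21 * B + 2 * K) s := by
  have hB0 : 0 ≤ B := (abs_nonneg _).trans (hB 0)
  have hK0 : 0 ≤ K := by have := (abs_nonneg _).trans (hK 1 0); simpa using this
  obtain ⟨hθ0, hθ1⟩ := hθ
  have hpi := pi_lt_d4
  have hL := abs_conjKernelLine_mul_le (1 - ρ) (θ - s)
  have hLn := abs_nonneg (conjKernelLine (1 - ρ) (θ - s))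
  have hfar : s ∈ Icc (1 : ℝ) 2 → |θ - s| ≤ 5.3 := fun hs => by
    rw [abs_le]; constructor <;> linarith [hs.1, hs.2]
  have hR : s ∈ Icc (1 / 2 : ℝ) 3 →
      (Icc (1 / 2 : ℝ) 3).indicator (fun _ => 21 * B + 2 * K) s = 21 * B + 2 * K :=
    fun h => indicator_of_mem h _
  have hR0 : 0 ≤ (Icc (1 / 2 : ℝ) 3).indicator (fun _ => 21 * B + 2 * K) s :=
    indicator_nonneg (fun _ _ => by positivity) _
  by_cases hs : s ∈ Ioc (θ / 2) (θ + θ / 2)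
  · rw [indicator_of_mem hs]
    have hdiff : |(χ s - χ θ) * conjKernelLine (1 - ρ) (θ - s)| ≤ 2 * K := by
      rw [abs_mul]
      calc _ ≤ K * |s - θ| * |conjKernelLine (1 - ρ) (θ - s)| := by gcongr; exact hK s θ
        _ = K * (|conjKernelLine (1 - ρ) (θ - s)| * |θ - s|) := by rw [abs_sub_comm]; ring
        _ ≤ K * 2 := by gcongr
        _ = _ := by ring
    by_cases hs' : s ∈ Icc (1 : ℝ) 2
    · rw [hR ⟨by linarith [hs'.1], by linarith [hs'.2]⟩]
      have e : χ s * conjKernel ρ (θ - s) - χ θ * conjKernelLine (1 - ρ) (θ - s) =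
          χ s * (conjKernel ρ (θ - s) - conjKernelLine (1 - ρ) (θ - s)) +
            (χ s - χ θ) * conjKernelLine (1 - ρ) (θ - s) := by ring
      rw [e]
      refine (abs_add_le _ _).trans (add_le_add ?_ hdiff)
      rw [abs_mul]
      calc _ ≤ B * 13 := mul_le_mul (hB s) (abs_conjKernel_sub_le hρ0 hρ1 (hfar hs'))
            (abs_nonneg _) hB0
        _ ≤ _ := by linarith
    · have hz := h0 s hs'
      by_cases hθ' : θ ∈ Icc (1 : ℝ) 2
      · rw [hR ⟨by linarith [hs.1, hθ'.1], by linarith [hs.2, hθ'.2]⟩]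
        have e : χ s * conjKernel ρ (θ - s) - χ θ * conjKernelLine (1 - ρ) (θ - s) =
            (χ s - χ θ) * conjKernelLine (1 - ρ) (θ - s) := by rw [hz]; ring
        rw [e]
        exact hdiff.trans (by linarith)
      · rw [hz, h0 θ hθ']
        simpa using hR0
  · rw [indicator_of_notMem hs, sub_zero]
    by_cases hs' : s ∈ Icc (1 : ℝ) 2
    · rw [hR ⟨by linarith [hs'.1], by linarith [hs'.2]⟩, abs_mul]
      have hge : 1 / 4 ≤ |θ - s| := by
        by_contra! hlt
        rw [abs_lt] at hlt
        exact hs ⟨by linarith [hs'.1], by linarith [hs'.1]⟩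
      have h8 : |conjKernelLine (1 - ρ) (θ - s)| ≤ 8 := by nlinarith
      have h13 := abs_conjKernel_sub_le hρ0 hρ1 (hfar hs')
      have h21 : |conjKernel ρ (θ - s)| ≤ 21 := by
        have := abs_sub_abs_le_abs_sub (conjKernel ρ (θ - s)) (conjKernelLine (1 - ρ) (θ - s))
        linarith
      calc _ ≤ B * 21 := mul_le_mul (hB s) h21 (abs_nonneg _) hB0
        _ ≤ _ := by linarith
    · rw [h0 s hs']
      simpa using hR0

lemma im_herglotz {γ : ℝ → ℝ} (hγ : Integrable γ) {ρ : ℝ} (h0 : 0 ≤ ρ) (h1 : ρ < 1) (θ : ℝ) :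
    (herglotz γ (ρ * circleMap 0 1 θ)).im = ∫ s, γ s * conjKernel ρ (θ - s) := by
  have := integral_im (integrable_herglotz hγ (norm_mul_circleMap_lt h0 h1 θ))
  rw [herglotz]
  refine this.symm.trans (integral_congr_ae (Eventually.of_forall fun s => ?_))
  refine (Complex.im_ofReal_mul _ _).trans ?_
  congr 1
  have e : (ρ : ℂ) * circleMap 0 1 θ * Complex.exp (-(s * Complex.I)) =
      ρ * (Complex.cos (θ - s : ℝ) + Complex.sin (θ - s : ℝ) * Complex.I) := by
    rw [← Complex.exp_mul_I, circleMap, zero_add, Complex.ofReal_one, one_mul, mul_assoc,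
      ← Complex.exp_add]
    congr 2
    push_cast
    ring
  rw [e, ← Complex.ofReal_cos, ← Complex.ofReal_sin, conjKernel, Complex.div_im]
  have hsc := sin_sq_add_cos_sq (θ - s)
  have hn : Complex.normSq (1 - ρ * ((cos (θ - s) : ℝ) + (sin (θ - s) : ℝ) * Complex.I)) =
      (1 - ρ) ^ 2 + 2 * ρ * (1 - cos (θ - s)) := by
    rw [Complex.normSq_apply]
    simp only [Complex.sub_re, Complex.one_re, Complex.re_ofReal_mul, Complex.add_re,
      Complex.ofReal_re, Complex.I_re, mul_zero, add_zero, Complex.sub_im,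
      Complex.one_im, Complex.im_ofReal_mul, Complex.add_im, Complex.ofReal_im,
      Complex.I_im, mul_one, zero_add]
    linear_combination ρ ^ 2 * hsc
  rw [hn, ← sub_div]
  congr 1
  simp only [Complex.sub_re, Complex.one_re, Complex.re_ofReal_mul, Complex.add_re,
      Complex.ofReal_re, Complex.I_re, mul_zero, add_zero, Complex.sub_im,
      Complex.one_im, Complex.im_ofReal_mul, Complex.add_im, Complex.ofReal_im,
      Complex.I_im, mul_one, zero_add]
  ring

lemma continuous_conjKernelLine {δ : ℝ} (hδ : 0 < δ) : Continuous (conjKernelLine δ) :=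
  Continuous.div (by fun_prop) (by fun_prop) fun u => by positivity

lemma integral_mul_conjKernelLine {G : ℝ → ℝ} (hG : Integrable G) {δ θ : ℝ} (hδ : 0 < δ) :
    ∫ s in (θ / 2)..(θ + θ / 2), G s * conjKernelLine δ (θ - s) =
      -2 * ∫ u in (0 : ℝ)..(θ / 2), (G (θ + u) - G (θ - u)) * (u / (u ^ 2 + δ ^ 2)) := by
  have hI : ∀ a b, IntervalIntegrable (fun s => G s * conjKernelLine δ (θ - s)) volume a b :=
    fun a b => hG.intervalIntegrable.mul_continuousOn
      ((continuous_conjKernelLine hδ).comp (continuous_const.sub continuous_id)).continuousOn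
  have e1 : ∫ s in (θ / 2)..θ, G s * conjKernelLine δ (θ - s) =
      ∫ u in (0 : ℝ)..(θ / 2), G (θ - u) * conjKernelLine δ u := by
    have := intervalIntegral.integral_comp_sub_left (a := 0) (b := θ / 2)
      (fun s => G s * conjKernelLine δ (θ - s)) θ
    simp only [sub_sub_cancel, sub_zero] at this
    rw [this]
    congr 1; ring
  have e2 : ∫ s in θ..(θ + θ / 2), G s * conjKernelLine δ (θ - s) =
      ∫ u in (0 : ℝ)..(θ / 2), G (θ + u) * conjKernelLine δ (-u) := by
    have := intervalIntegral.integral_comp_add_left (a := 0) (b := θ / 2)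
      (fun s => G s * conjKernelLine δ (θ - s)) θ
    simp only [sub_add_cancel_left, add_zero] at this
    rw [this]
  have h1 : IntervalIntegrable (fun u => G (θ - u) * conjKernelLine δ u) volume 0 (θ / 2) :=
    (hG.comp_sub_left θ).intervalIntegrable.mul_continuousOn
      (continuous_conjKernelLine hδ).continuousOn
  have h2 : IntervalIntegrable (fun u => G (θ + u) * conjKernelLine δ (-u)) volume 0 (θ / 2) :=
    (hG.comp_add_left θ).intervalIntegrable.mul_continuousOn
      ((continuous_conjKernelLine hδ).comp continuous_neg).continuousOn
  rw [← intervalIntegral.integral_add_adjacent_intervals (hI (θ / 2) θ) (hI θ _), e1, e2,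
    ← intervalIntegral.integral_add h1 h2, ← intervalIntegral.integral_const_mul]
  congr 1
  ext u
  simp only [conjKernelLine, neg_sq]
  ring

/-- Boundary values of the conjugate function of a localised density. -/
lemma eventually_abs_im_herglotz_le {G χ : ℝ → ℝ} {B K : ℝ} (hG : Integrable G)
    (hB : ∀ t, |χ t| ≤ B)
    (hK : ∀ s t, |χ s - χ t| ≤ K * |s - t|) (h0 : ∀ t, t ∉ Icc (1 : ℝ) 2 → χ t = 0)
    (hγ : Integrable fun s => G s * χ s)
    {θ L : ℝ} (hθ : θ ∈ Ioc 0 (2 * π))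
    (hL : Tendsto (fun δ => ∫ s in δ..(θ / 2), (G (θ + s) - G (θ - s)) / s)
      (nhdsWithin 0 (Ioi 0)) (nhds L)) {η : ℝ} (hη : 0 < η) :
    ∀ᶠ ρ : ℝ in nhdsWithin 1 (Iio 1),
      |(herglotz (fun s => G s * χ s) (ρ * circleMap 0 1 θ)).im| ≤
        2 * |χ θ| * |L| + (21 * B + 2 * K) * (∫ s in Icc (1 / 2 : ℝ) 3, |G s|) + η := by
  have hθ2 : 0 < θ / 2 := by linarith [hθ.1]
  have hD : IntervalIntegrable (fun s => G (θ + s) - G (θ - s)) volume 0 (θ / 2) :=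
    ((hG.comp_add_left θ).sub (hG.comp_sub_left θ)).intervalIntegrable
  have hP := tendsto_integral_poisson_of_tendsto_truncated hθ2 hD hL
  have hδ : Tendsto (fun ρ : ℝ => 1 - ρ) (nhdsWithin 1 (Iio 1)) (nhdsWithin 0 (Ioi 0)) := by
    refine tendsto_nhdsWithin_iff.2 ⟨?_, ?_⟩
    · have : Tendsto (fun ρ : ℝ => 1 - ρ) (nhds 1) (nhds (1 - 1)) :=
        (continuous_const.sub continuous_id).tendsto 1
      rw [sub_self] at this
      exact this.mono_left nhdsWithin_le_nhds
    · filter_upwards [self_mem_nhdsWithin] with ρ hρ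
      exact sub_pos.2 (mem_Iio.1 hρ)
  have hQ := ((hP.comp hδ).abs.const_mul (2 * |χ θ|))
  have hhalf : ∀ᶠ ρ : ℝ in nhdsWithin 1 (Iio 1), 1 / 2 < ρ :=
    mem_nhdsWithin_of_mem_nhds (lt_mem_nhds (by norm_num))
  filter_upwards [self_mem_nhdsWithin, hhalf,
    hQ.eventually (gt_mem_nhds (lt_add_of_pos_right _ hη))] with ρ hρ1 hρ0 hlt
  have hρ1 : ρ < 1 := hρ1
  have hδ0 : 0 < 1 - ρ := sub_pos.2 hρ1
  simp only [Function.comp] at hlt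
  rw [im_herglotz hγ (by linarith) hρ1]
  set J := ∫ u in (0 : ℝ)..(θ / 2), (G (θ + u) - G (θ - u)) * (u / (u ^ 2 + (1 - ρ) ^ 2)) with hJ
  set S := Ioc (θ / 2) (θ + θ / 2) with hS
  have hcont : Continuous fun s => conjKernelLine (1 - ρ) (θ - s) :=
    (continuous_conjKernelLine hδ0).comp (continuous_const.sub continuous_id)
  have hI2 : Integrable (S.indicator fun s => χ θ * (G s * conjKernelLine (1 - ρ) (θ - s))) := by
    rw [integrable_indicator_iff measurableSet_Ioc, ← intervalIntegrable_iff_integrableOn_Ioc_of_le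
      (by linarith [hθ.1])]
    exact (hG.intervalIntegrable.mul_continuousOn hcont.continuousOn).const_mul _
  have e2 : ∫ s, S.indicator (fun s => χ θ * (G s * conjKernelLine (1 - ρ) (θ - s))) s =
      χ θ * (-2 * J) := by
    rw [integral_indicator measurableSet_Ioc, integral_const_mul, hJ,
      ← integral_mul_conjKernelLine hG hδ0, intervalIntegral.integral_of_le (by linarith [hθ.1])]
  have hcq : Continuous fun s => conjKernel ρ (θ - s) := by
    refine Continuous.div (by fun_prop) (by fun_prop) fun s => ?_
    have := cos_le_one (θ - s)
    have : 0 ≤ 2 * ρ * (1 - cos (θ - s)) := by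
      refine mul_nonneg (by linarith) (by linarith)
    positivity
  have hI1m : AEStronglyMeasurable (fun s => G s * χ s * conjKernel ρ (θ - s)) volume :=
    hγ.aestronglyMeasurable.mul hcq.aestronglyMeasurable
  have hptw : ∀ s, |G s * χ s * conjKernel ρ (θ - s) -
      S.indicator (fun s => χ θ * (G s * conjKernelLine (1 - ρ) (θ - s))) s| ≤
      (Icc (1 / 2 : ℝ) 3).indicator (fun s => (21 * B + 2 * K) * |G s|) s := by
    intro s
    have h := abs_cutoff_conjKernel_sub_le hB hK h0 hρ0.le hρ1 hθ s
    have e : G s * χ s * conjKernel ρ (θ - s) -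
      S.indicator (fun s => χ θ * (G s * conjKernelLine (1 - ρ) (θ - s))) s =
        G s * (χ s * conjKernel ρ (θ - s) -
          S.indicator (fun s => χ θ * conjKernelLine (1 - ρ) (θ - s)) s) := by
      simp only [indicator]
      split_ifs <;> ring
    rw [e, abs_mul]
    refine (mul_le_mul_of_nonneg_left h (abs_nonneg _)).trans (le_of_eq ?_)
    simp only [indicator]
    split_ifs <;> ring
  have hI3 : Integrable ((Icc (1 / 2 : ℝ) 3).indicator fun s => (21 * B + 2 * K) * |G s|) :=
    (hG.abs.const_mul _).indicator measurableSet_Icc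
  have hdiff : Integrable fun s => G s * χ s * conjKernel ρ (θ - s) -
      S.indicator (fun s => χ θ * (G s * conjKernelLine (1 - ρ) (θ - s))) s :=
    hI3.mono' (hI1m.sub hI2.aestronglyMeasurable) (Eventually.of_forall hptw)
  have e3 : ∫ s, G s * χ s * conjKernel ρ (θ - s) =
      (∫ s, (G s * χ s * conjKernel ρ (θ - s) -
      S.indicator (fun s => χ θ * (G s * conjKernelLine (1 - ρ) (θ - s))) s)) +
        χ θ * (-2 * J) := by
    rw [← e2, ← integral_add hdiff hI2]
    congr 1; ext s; ring
  have b1 : |∫ s, (G s * χ s * conjKernel ρ (θ - s) -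
      S.indicator (fun s => χ θ * (G s * conjKernelLine (1 - ρ) (θ - s))) s)| ≤
      (21 * B + 2 * K) * ∫ s in Icc (1 / 2 : ℝ) 3, |G s| := by
    rw [← integral_const_mul, ← integral_indicator measurableSet_Icc]
    exact abs_integral_le_integral_abs.trans (integral_mono hdiff.abs hI3 hptw)
  have b2 : |χ θ * (-2 * J)| = 2 * |χ θ| * |J| := by
    rw [abs_mul, abs_mul, abs_neg, abs_two]; ring
  rw [e3]
  refine (abs_add_le _ _).trans ?_
  rw [b2]
  linarith

/-- A normalised tent function supported in `[1/2, 1]`. -/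
noncomputable def tent (τ : ℝ) : ℝ := 16 * max 0 (1 / 4 - |τ - 3 / 4|)

lemma tent_nonneg (τ : ℝ) : 0 ≤ tent τ := by rw [tent]; positivity

lemma tent_le (τ : ℝ) : tent τ ≤ 4 := by
  have : max 0 (1 / 4 - |τ - 3 / 4|) ≤ 1 / 4 :=
    max_le (by norm_num) (by linarith [abs_nonneg (τ - 3 / 4)])
  rw [tent]; linarith

lemma tent_of_le {τ : ℝ} (h : τ ≤ 1 / 2) : tent τ = 0 := by
  rw [tent, max_eq_left, mul_zero]
  linarith [neg_le_abs (τ - 3 / 4)]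

lemma tent_of_ge {τ : ℝ} (h : 1 ≤ τ) : tent τ = 0 := by
  rw [tent, max_eq_left, mul_zero]
  linarith [le_abs_self (τ - 3 / 4)]

lemma abs_tent_sub_le (a b : ℝ) : |tent a - tent b| ≤ 16 * |a - b| := by
  rw [tent, tent, ← mul_sub, abs_mul, abs_of_nonneg (by norm_num : (0 : ℝ) ≤ 16)]
  refine mul_le_mul_of_nonneg_left ?_ (by norm_num)
  refine (abs_max_sub_max_le_max (0 : ℝ) (1 / 4 - |a - 3 / 4|) 0 (1 / 4 - |b - 3 / 4|)).trans ?_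
  rw [sub_self, abs_zero, max_eq_right (abs_nonneg _)]
  have := abs_abs_sub_abs_le (b - 3 / 4) (a - 3 / 4)
  rw [show (1 / 4 - |a - 3 / 4| - (1 / 4 - |b - 3 / 4|)) = |b - 3 / 4| - |a - 3 / 4| by ring]
  rwa [show b - 3 / 4 - (a - 3 / 4) = b - a by ring, abs_sub_comm b a] at this

lemma continuous_tent : Continuous tent := by unfold tent; fun_prop

lemma integral_tent {b : ℝ} (hb : 1 ≤ b) : ∫ τ in (0 : ℝ)..b, tent τ = 1 := by
  have hI : ∀ a b, IntervalIntegrable tent volume a b := fun a b =>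
    continuous_tent.intervalIntegrable a b
  rw [← intervalIntegral.integral_add_adjacent_intervals (hI 0 (1 / 2)) (hI _ b),
    ← intervalIntegral.integral_add_adjacent_intervals (hI (1 / 2) (3 / 4)) (hI _ b),
    ← intervalIntegral.integral_add_adjacent_intervals (hI (3 / 4) 1) (hI _ b)]
  have h1 : ∫ τ in (0 : ℝ)..1 / 2, tent τ = ∫ τ in (0 : ℝ)..1 / 2, (0 : ℝ) := by
    refine intervalIntegral.integral_congr fun τ hτ => ?_
    rw [uIcc_of_le (by norm_num)] at hτ
    exact tent_of_le hτ.2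
  have h2 : ∫ τ in (1 / 2 : ℝ)..3 / 4, tent τ = ∫ τ in (1 / 2 : ℝ)..3 / 4, (16 * τ - 8) := by
    refine intervalIntegral.integral_congr fun τ hτ => ?_
    rw [uIcc_of_le (by norm_num)] at hτ
    simp only [tent]
    rw [abs_of_nonpos (by linarith [hτ.2]), max_eq_right (by linarith [hτ.1])]
    ring
  have h3 : ∫ τ in (3 / 4 : ℝ)..1, tent τ = ∫ τ in (3 / 4 : ℝ)..1, (16 - 16 * τ) := by
    refine intervalIntegral.integral_congr fun τ hτ => ?_
    rw [uIcc_of_le (by norm_num)] at hτ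
    simp only [tent]
    rw [abs_of_nonneg (by linarith [hτ.1]), max_eq_right (by linarith [hτ.2])]
    ring
  have h4 : ∫ τ in (1 : ℝ)..b, tent τ = ∫ τ in (1 : ℝ)..b, (0 : ℝ) := by
    refine intervalIntegral.integral_congr fun τ hτ => ?_
    rw [uIcc_of_le hb] at hτ
    exact tent_of_ge hτ.1
  have i1 : ∀ a b : ℝ, IntervalIntegrable (fun τ : ℝ => 16 * τ) volume a b := fun a b =>
    Continuous.intervalIntegrable (by fun_prop) a b
  have i2 : ∀ c a b : ℝ, IntervalIntegrable (fun _ : ℝ => c) volume a b := fun c a b =>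
    Continuous.intervalIntegrable (by fun_prop) a b
  rw [h1, h2, h3, h4, intervalIntegral.integral_sub (i1 _ _) (i2 _ _ _),
    intervalIntegral.integral_sub (i2 _ _ _) (i1 _ _)]
  have hm : ∀ a b : ℝ, ∫ τ in a..b, 16 * τ = 8 * (b ^ 2 - a ^ 2) := fun a b => by
    rw [intervalIntegral.integral_const_mul, integral_id]; ring
  simp only [hm, intervalIntegral.integral_const, smul_eq_mul]
  norm_num

/-- The quadrature error for the tent function. -/
lemma abs_sum_tent_sub_integral_le {u : ℝ} (hu : 0 < u) (M : ℕ) :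
    |∑ n ∈ Finset.range M, tent ((n + 1) / u) / u - ∫ τ in (0 : ℝ)..M / u, tent τ| ≤
      M * (16 / u ^ 2) := by
  have hI : ∀ a b, IntervalIntegrable tent volume a b := fun a b =>
    continuous_tent.intervalIntegrable a b
  induction M with
  | zero => simp
  | succ M ih =>
    rw [Finset.sum_range_succ, ← intervalIntegral.integral_add_adjacent_intervals
      (hI 0 (M / u)) (hI _ _)]
    push_cast
    have hle : (M : ℝ) / u ≤ (M + 1) / u := by gcongr; linarith
    have e : tent ((M + 1) / u) / u - ∫ τ in (M / u : ℝ)..(M + 1) / u, tent τ =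
        ∫ τ in (M / u : ℝ)..(M + 1) / u, (tent ((M + 1) / u) - tent τ) := by
      rw [intervalIntegral.integral_sub (intervalIntegrable_const) (hI _ _),
        intervalIntegral.integral_const, smul_eq_mul]
      congr 1
      field_simp
      ring
    have hb : |tent ((M + 1) / u) / u - ∫ τ in (M / u : ℝ)..(M + 1) / u, tent τ| ≤ 16 / u ^ 2 := by
      rw [e]
      have := intervalIntegral.norm_integral_le_of_norm_le_const (a := (M / u : ℝ))
        (b := (M + 1) / u) (f := fun τ => tent ((M + 1) / u) - tent τ) (C := 16 / u) (by
          intro τ hτ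
          rw [uIoc_of_le hle] at hτ
          refine (abs_tent_sub_le _ _).trans ?_
          rw [abs_of_nonneg (by linarith [hτ.2])]
          have : ((M : ℝ) + 1) / u - τ ≤ 1 / u := by
            have := hτ.1
            rw [add_div]; linarith
          calc 16 * (((M : ℝ) + 1) / u - τ) ≤ 16 * (1 / u) := by gcongr
            _ = _ := by ring)
      refine this.trans (le_of_eq ?_)
      rw [abs_of_nonneg (by linarith)]
      field_simp
      ring
    have := abs_add_le (∑ n ∈ Finset.range M, tent ((n + 1) / u) / u -
      ∫ τ in (0 : ℝ)..M / u, tent τ)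
      (tent ((M + 1) / u) / u - ∫ τ in (M / u : ℝ)..(M + 1) / u, tent τ)
    refine le_trans (le_of_eq ?_) (this.trans ((add_le_add ih hb).trans (le_of_eq ?_)))
    · congr 1; ring
    · ring

/-- The multiplicative cutoff attached to `tent`, supported in `[1, 2]`. -/
noncomputable def cutoff (t : ℝ) : ℝ := tent (1 / t) / t

lemma cutoff_of_le {t : ℝ} (h : t ≤ 1) : cutoff t = 0 := by
  rw [cutoff]
  rcases le_or_gt t 0 with h0 | h0
  · rw [tent_of_le, zero_div]
    exact (one_div_nonpos.2 h0).trans (by norm_num)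
  · rw [tent_of_ge, zero_div]
    rwa [le_div_iff₀ h0, one_mul]

lemma cutoff_of_ge {t : ℝ} (h : 2 ≤ t) : cutoff t = 0 := by
  rw [cutoff, tent_of_le, zero_div]
  exact one_div_le_one_div_of_le (by norm_num) h

lemma cutoff_nonneg (t : ℝ) : 0 ≤ cutoff t := by
  rcases le_or_gt t 1 with h | h
  · rw [cutoff_of_le h]
  · exact div_nonneg (tent_nonneg _) (by linarith)

lemma cutoff_le (t : ℝ) : cutoff t ≤ 4 := by
  rcases le_or_gt t 1 with h | h
  · rw [cutoff_of_le h]; norm_num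
  · exact div_le_of_le_mul₀ (by linarith) (by norm_num) ((tent_le _).trans (by linarith))

lemma abs_cutoff_le (t : ℝ) : |cutoff t| ≤ 4 := by
  rw [abs_of_nonneg (cutoff_nonneg t)]; exact cutoff_le t

lemma cutoff_of_notMem {t : ℝ} (h : t ∉ Icc (1 : ℝ) 2) : cutoff t = 0 := by
  rcases le_or_gt t 1 with h1 | h1
  · exact cutoff_of_le h1
  · exact cutoff_of_ge (le_of_not_ge fun h2 => h ⟨h1.le, h2⟩)

lemma abs_cutoff_sub_le (s t : ℝ) : |cutoff s - cutoff t| ≤ 20 * |s - t| := by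
  have hmax : ∀ t, cutoff t = cutoff (max t 1) := fun t => by
    rcases le_or_gt t 1 with h | h
    · rw [max_eq_right h, cutoff_of_le h, cutoff_of_le le_rfl]
    · rw [max_eq_left h.le]
  have key : ∀ s t : ℝ, 1 ≤ s → 1 ≤ t → |cutoff s - cutoff t| ≤ 20 * |s - t| := by
    intro s t hs ht
    have hst : |1 / s - 1 / t| ≤ |s - t| := by
      rw [div_sub_div _ _ (by linarith) (by linarith), abs_div, abs_of_nonneg (a := s * t)
        (by nlinarith), one_mul, mul_one, abs_sub_comm]
      exact div_le_of_le_mul₀ (by nlinarith) (abs_nonneg _)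
        (le_mul_of_one_le_right (abs_nonneg _) (by nlinarith))
    have e : cutoff s - cutoff t =
        (tent (1 / s) - tent (1 / t)) * (1 / s) + tent (1 / t) * (1 / s - 1 / t) := by
      rw [cutoff, cutoff]; ring
    rw [e]
    refine (abs_add_le _ _).trans ?_
    rw [abs_mul, abs_mul, abs_of_nonneg (tent_nonneg _), abs_of_nonneg (a := 1 / s)
      (by positivity)]
    have h1 := abs_tent_sub_le (1 / s) (1 / t)
    have h2 : 1 / s ≤ 1 := by rw [div_le_one (by linarith)]; exact hs
    calc _ ≤ (16 * |1 / s - 1 / t|) * 1 + 4 * |1 / s - 1 / t| := by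
          gcongr
          exact tent_le _
      _ ≤ _ := by linarith
  rw [hmax s, hmax t]
  refine (key _ _ (le_max_right _ _) (le_max_right _ _)).trans ?_
  refine mul_le_mul_of_nonneg_left ?_ (by norm_num)
  exact abs_max_sub_max_le_abs s t 1

lemma continuous_cutoff : Continuous cutoff :=
  (LipschitzWith.of_dist_le_mul (K := 20) fun s t => by
    simpa [Real.dist_eq] using abs_cutoff_sub_le s t).continuous

/-- A smooth substitute for the indicator function of `u ≫ 1`, as a superposition of cutoffs. -/
noncomputable def cutoffSum (u : ℝ) : ℝ := ∑' n : ℕ, cutoff (u / (n + 1)) / (n + 1)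

lemma hasSum_cutoff {u : ℝ} {M : ℕ} (hM : u ≤ M) :
    HasSum (fun n : ℕ => cutoff (u / (n + 1)) / (n + 1))
      (∑ n ∈ Finset.range M, cutoff (u / (n + 1)) / (n + 1)) := by
  refine hasSum_sum_of_ne_finset_zero fun n hn => ?_
  rw [cutoff_of_le, zero_div]
  rw [Finset.mem_range, not_lt] at hn
  have : (M : ℝ) ≤ n := by exact_mod_cast hn
  rw [div_le_one (by positivity)]
  linarith

lemma hasSum_cutoffSum (u : ℝ) :
    HasSum (fun n : ℕ => cutoff (u / (n + 1)) / (n + 1)) (cutoffSum u) :=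
  (hasSum_cutoff (Nat.le_ceil u)).summable.hasSum

lemma cutoffSum_of_le {u : ℝ} (hu : u ≤ 1) : cutoffSum u = 0 := by
  rw [cutoffSum]
  convert tsum_zero with n
  rw [cutoff_of_le, zero_div]
  rw [div_le_one (by positivity)]
  linarith [n.cast_nonneg (α := ℝ)]

lemma cutoffSum_nonneg (u : ℝ) : 0 ≤ cutoffSum u :=
  tsum_nonneg fun n => div_nonneg (cutoff_nonneg _) (by positivity)

lemma abs_cutoffSum_sub_one_le {u : ℝ} (hu : 1 ≤ u) : |cutoffSum u - 1| ≤ 32 / u := by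
  have hu0 : 0 < u := by linarith
  have hM := Nat.le_ceil u
  have hM' := Nat.ceil_lt_add_one hu0.le
  set M := ⌈u⌉₊
  have h := abs_sum_tent_sub_integral_le hu0 M
  rw [integral_tent (by rwa [le_div_iff₀ hu0, one_mul])] at h
  have e : cutoffSum u = ∑ n ∈ Finset.range M, tent ((n + 1) / u) / u := by
    rw [(hasSum_cutoffSum u).unique (hasSum_cutoff hM)]
    refine Finset.sum_congr rfl fun n _ => ?_
    rw [cutoff, one_div_div]
    field_simp
  rw [e]
  refine h.trans ?_
  rw [← mul_div_assoc, div_le_div_iff₀ (by positivity) hu0]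
  nlinarith

lemma cutoffSum_le (u : ℝ) : cutoffSum u ≤ 33 := by
  rcases le_or_gt u 1 with h | h
  · rw [cutoffSum_of_le h]; norm_num
  · have h1 := (le_abs_self _).trans (abs_cutoffSum_sub_one_le h.le)
    have : 32 / u ≤ 32 := div_le_self (by norm_num) h.le
    linarith

lemma measurable_cutoffSum : Measurable cutoffSum := by
  refine measurable_of_tendsto_metrizable (f := fun N u =>
    ∑ n ∈ Finset.range N, cutoff (u / (n + 1)) / (n + 1)) (fun N => ?_) ?_
  · refine Finset.measurable_fun_sum _ fun n _ => ?_
    exact ((continuous_cutoff.comp (continuous_id.div_const _)).div_const _).measurable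
  · exact tendsto_pi_nhds.2 fun u => (hasSum_cutoffSum u).tendsto_sum_nat

/-- The remainder kernel left after the cutoff has been removed. -/
noncomputable def remainderKernel (u : ℝ) : ℝ :=
  (1 - cutoffSum u) * cos u - (Iio (π / 2)).indicator (fun _ => 1) u

lemma measurable_remainderKernel : Measurable remainderKernel :=
  ((measurable_const.sub measurable_cutoffSum).mul measurable_cos).sub
    (measurable_const.indicator measurableSet_Iio)

lemma abs_remainderKernel_le {u : ℝ} (hu : 0 < u) :
    |remainderKernel u| ≤ 34 * min u (1 / u) := by
  have hpi := pi_gt_three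
  have hpi' := pi_lt_d2
  rw [remainderKernel]
  rcases le_or_gt u 1 with h | h
  · rw [cutoffSum_of_le h, indicator_of_mem (by rw [mem_Iio]; linarith),
      min_eq_left (h.trans (by rwa [le_div_iff₀ hu, one_mul])), sub_zero, one_mul, abs_sub_comm,
      abs_of_nonneg (by linarith [cos_le_one u])]
    nlinarith [one_sub_sq_div_two_le_cos (x := u)]
  · rw [min_eq_right (by rw [div_le_iff₀ hu]; nlinarith)]
    refine (abs_sub _ _).trans ?_
    have h1 : |(1 - cutoffSum u) * cos u| ≤ 32 / u := by
      rw [abs_mul, abs_sub_comm]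
      exact (mul_le_of_le_one_right (abs_nonneg _) (abs_cos_le_one u)).trans
        (abs_cutoffSum_sub_one_le h.le)
    have h2 : |(Iio (π / 2)).indicator (fun _ => (1 : ℝ)) u| ≤ 2 / u := by
      simp only [indicator, mem_Iio]
      split_ifs with h3
      · rw [abs_one, le_div_iff₀ hu]; linarith
      · rw [abs_zero]; positivity
    calc _ ≤ 32 / u + 2 / u := add_le_add h1 h2
      _ = _ := by ring

lemma abs_integral_mul_cos_le {γ : ℝ → ℝ} (hγ : Integrable γ) (n : ℕ) :
    |∫ s, γ s * cos (n * s)| ≤ ‖∫ s, (γ s : ℂ) * Complex.exp (-(s * Complex.I)) ^ n‖ := by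
  have hγc : Integrable fun s => (γ s : ℂ) := hγ.ofReal
  have hI : Integrable fun s : ℝ => (γ s : ℂ) * Complex.exp (-(s * Complex.I)) ^ n := by
    refine hγc.mul_bdd (c := 1) (Continuous.aestronglyMeasurable (by fun_prop))
      (Eventually.of_forall fun s => ?_)
    rw [norm_pow, norm_exp_neg_ofReal_mul_I, one_pow]
  have h := integral_re hI
  have e : ∀ s : ℝ, ((γ s : ℂ) * Complex.exp (-(s * Complex.I)) ^ n).re = γ s * cos (n * s) := by
    intro s
    rw [Complex.re_ofReal_mul, ← Complex.exp_nat_mul,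
      show (n : ℂ) * -(s * Complex.I) = ((-(n * s) : ℝ) : ℂ) * Complex.I by push_cast; ring,
      Complex.exp_ofReal_mul_I_re, cos_neg]
  have h2 : ∫ s, γ s * cos (n * s) =
      (∫ s, (γ s : ℂ) * Complex.exp (-(s * Complex.I)) ^ n).re := by
    refine Eq.trans ?_ h
    exact integral_congr_ae (Eventually.of_forall fun s => (e s).symm)
  rw [h2]
  exact Complex.abs_re_le_norm _

lemma sum_abs_integral_cutoff_le {G T : ℝ → ℝ} (hG : Integrable G) (hT : Integrable T)
    (hlim : ∀ t, 0 < t → Tendsto (fun δ => ∫ s in δ..(t / 2), (G (t + s) - G (t - s)) / s)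
      (nhdsWithin 0 (Ioi 0)) (nhds (T t))) (N : ℕ) :
    ∑ n ∈ Finset.range N, |∫ s, G s * cutoff s * cos ((n + 1) * s)| / (n + 1) ≤
      130000 * ∫ s in Icc (1 / 2 : ℝ) 3, (|G s| + |T s|) := by
  have hγ : Integrable fun s => G s * cutoff s :=
    hG.mul_bdd (c := 4) continuous_cutoff.aestronglyMeasurable
      (Eventually.of_forall abs_cutoff_le)
  have hχT : Integrable fun s => 2 * |cutoff s| * |T s| :=
    hT.abs.bdd_mul (c := 8) (Continuous.aestronglyMeasurable
      (continuous_const.mul continuous_cutoff.abs)) (Eventually.of_forall fun s => by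
        rw [Real.norm_of_nonneg (by positivity)]; linarith [abs_cutoff_le s])
  set A := ∫ s in Icc (1 / 2 : ℝ) 3, |G s| with hA
  set B := ∫ s in Icc (1 / 2 : ℝ) 3, |T s| with hB
  have hA0 : 0 ≤ A := integral_nonneg fun s => abs_nonneg _
  have hB0 : 0 ≤ B := integral_nonneg fun s => abs_nonneg _
  have hind : ∀ s, |cutoff s| ≤ (Icc (1 / 2 : ℝ) 3).indicator (fun _ => 4) s := by
    intro s
    by_cases hs : s ∈ Icc (1 / 2 : ℝ) 3
    · rw [indicator_of_mem hs]; exact abs_cutoff_le s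
    · rw [indicator_of_notMem hs, cutoff_of_notMem, abs_zero]
      exact fun h => hs ⟨by linarith [h.1], by linarith [h.2]⟩
  have hloc : ∀ {H : ℝ → ℝ}, Integrable H →
      (∫ s, |cutoff s| * |H s|) ≤ 4 * ∫ s in Icc (1 / 2 : ℝ) 3, |H s| := by
    intro H hH
    rw [← integral_const_mul, ← integral_indicator measurableSet_Icc]
    refine integral_mono_of_nonneg (Eventually.of_forall fun s => by positivity)
      ((hH.abs.const_mul 4).indicator measurableSet_Icc) (Eventually.of_forall fun s => ?_)
    have := mul_le_mul_of_nonneg_right (hind s) (abs_nonneg (H s))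
    refine this.trans (le_of_eq ?_)
    simp only [indicator]
    split_ifs <;> ring
  set M : ℝ → ℝ := fun θ => 2 * |cutoff θ| * |T θ| + 124 * A with hM
  have hM0 : ∀ θ, 0 ≤ M θ := fun θ => by simp only [hM]; positivity
  have hMi : IntervalIntegrable M volume 0 (2 * π) :=
    hχT.intervalIntegrable.add intervalIntegrable_const
  have hD := sum_norm_integral_exp_div_le hγ hM0 hMi (by
    filter_upwards [ae_restrict_mem measurableSet_Ioc] with θ hθ η hη
    have h := eventually_abs_im_herglotz_le hG abs_cutoff_le abs_cutoff_sub_le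
      (fun t => cutoff_of_notMem) hγ hθ (hlim θ hθ.1) hη
    norm_num at h
    simpa only [hM, hA, one_div] using h) (N + 1)
  have b1 : ∫ s, |G s * cutoff s| ≤ 4 * A := by
    refine le_trans (le_of_eq ?_) (hloc hG)
    congr 1; ext s; rw [abs_mul, mul_comm]
  have b2 : ∫ θ in (0 : ℝ)..2 * π, M θ ≤ 8 * B + 2 * π * (124 * A) := by
    rw [intervalIntegral.integral_add hχT.intervalIntegrable intervalIntegrable_const,
      intervalIntegral.integral_const, sub_zero, smul_eq_mul]
    refine add_le_add ?_ le_rfl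
    rw [intervalIntegral.integral_of_le two_pi_pos.le]
    calc _ ≤ ∫ s, 2 * |cutoff s| * |T s| :=
          setIntegral_le_integral hχT (Eventually.of_forall fun s => by positivity)
      _ = 2 * ∫ s, |cutoff s| * |T s| := by
          rw [← integral_const_mul]; congr 1; ext s; ring
      _ ≤ _ := by linarith [hloc hT]
  have e : ∫ s in Icc (1 / 2 : ℝ) 3, (|G s| + |T s|) = A + B :=
    integral_add hG.abs.integrableOn hT.abs.integrableOn
  have hsum : ∑ n ∈ Finset.range N, |∫ s, G s * cutoff s * cos ((n + 1) * s)| / (n + 1) ≤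
      2 * ∑ n ∈ Finset.range (N + 1), ‖∫ s, ((G s * cutoff s : ℝ) : ℂ) *
        Complex.exp (-(s * Complex.I)) ^ n‖ / (n + 1 : ℝ) := by
    rw [Finset.sum_range_succ', mul_add]
    refine le_trans ?_ (le_add_of_nonneg_right (by positivity))
    rw [Finset.mul_sum]
    refine Finset.sum_le_sum fun n _ => ?_
    have h1 := abs_integral_mul_cos_le hγ (n + 1)
    push_cast at h1 ⊢
    have hn : (0 : ℝ) ≤ n := n.cast_nonneg
    rw [← mul_div_assoc, div_le_div_iff₀ (by positivity) (by positivity)]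
    nlinarith [abs_nonneg (∫ s, G s * cutoff s * cos ((n + 1) * s))]
  rw [e]
  have hpi := pi_lt_d2
  have hpA : π * A ≤ 3.15 * A := by gcongr
  linarith

lemma tendsto_rescale {g : ℝ → ℝ} {μ t L : ℝ} (hμ : 0 < μ)
    (hlim : Tendsto (fun δ => ∫ s in δ..(t / μ / 2), (g (t / μ + s) - g (t / μ - s)) / s)
      (nhdsWithin 0 (Ioi 0)) (nhds L)) :
    Tendsto (fun δ => ∫ s in δ..(t / 2), (μ⁻¹ * g ((t + s) / μ) - μ⁻¹ * g ((t - s) / μ)) / s)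
      (nhdsWithin 0 (Ioi 0)) (nhds (μ⁻¹ * L)) := by
  have hδ : Tendsto (fun δ : ℝ => δ / μ) (nhdsWithin 0 (Ioi 0)) (nhdsWithin 0 (Ioi 0)) := by
    refine tendsto_nhdsWithin_iff.2 ⟨?_, ?_⟩
    · have : Tendsto (fun δ : ℝ => δ / μ) (nhds 0) (nhds (0 / μ)) :=
        (continuous_id.div_const μ).tendsto 0
      rw [zero_div] at this
      exact this.mono_left nhdsWithin_le_nhds
    · filter_upwards [self_mem_nhdsWithin] with δ hδ
      exact div_pos (mem_Ioi.1 hδ) hμ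
  refine ((hlim.comp hδ).const_mul μ⁻¹).congr fun δ => ?_
  have h := intervalIntegral.integral_comp_div (a := δ) (b := t / 2)
    (fun s => (g (t / μ + s) - g (t / μ - s)) / s) hμ.ne'
  simp only [Function.comp]
  rw [show t / μ / 2 = t / 2 / μ by ring]
  have h' : ∫ s in (δ / μ)..(t / 2 / μ), (g (t / μ + s) - g (t / μ - s)) / s =
      μ⁻¹ * ∫ s in δ..(t / 2), (g (t / μ + s / μ) - g (t / μ - s / μ)) / (s / μ) := by
    rw [h, smul_eq_mul, inv_mul_cancel_left₀ hμ.ne']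
  rw [h', ← intervalIntegral.integral_const_mul, ← intervalIntegral.integral_const_mul]
  congr 1
  ext s
  rw [add_div, sub_div]
  field_simp

lemma sum_abs_integral_cutoff_scaled_le {g T : ℝ → ℝ} (hg : Integrable g) (hT : Integrable T)
    (hlim : ∀ t, 0 < t → Tendsto (fun δ => ∫ s in δ..(t / 2), (g (t + s) - g (t - s)) / s)
      (nhdsWithin 0 (Ioi 0)) (nhds (T t))) {μ : ℝ} (hμ : 0 < μ) (N : ℕ) :
    ∑ n ∈ Finset.range N, |∫ s, g s * cutoff (μ * s) * cos ((n + 1) * (μ * s))| / (n + 1) ≤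
      130000 * ∫ s, (Icc (1 / 2 : ℝ) 3).indicator (fun _ => |g s| + |T s|) (μ * s) := by
  have hscale : ∀ H : ℝ → ℝ, ∫ s, H s = ∫ t, μ⁻¹ * H (t / μ) := fun H => by
    rw [integral_const_mul, Measure.integral_comp_div, abs_of_pos hμ, smul_eq_mul,
      inv_mul_cancel_left₀ hμ.ne']
  have h := sum_abs_integral_cutoff_le (G := fun t => μ⁻¹ * g (t / μ))
    (T := fun t => μ⁻¹ * T (t / μ)) ((hg.comp_div hμ.ne').const_mul _)
    ((hT.comp_div hμ.ne').const_mul _)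
    (fun t ht => tendsto_rescale hμ (hlim (t / μ) (by positivity))) N
  have hc : ∀ t, μ * (t / μ) = t := fun t => mul_div_cancel₀ t hμ.ne'
  refine le_trans (le_of_eq ?_) (h.trans (le_of_eq ?_))
  · refine Finset.sum_congr rfl fun n _ => ?_
    rw [hscale]
    simp only [hc, mul_assoc]
  · rw [hscale, ← integral_indicator measurableSet_Icc]
    congr 2
    ext t
    simp only [hc, indicator]
    split_ifs
    · rw [abs_mul, abs_mul, abs_of_pos (inv_pos.2 hμ)]; ring
    · rw [mul_zero]

lemma lintegral_comp_div_Ioi {c : ℝ} (hc : 0 < c) (φ : ℝ → ℝ≥0∞) :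
    ∫⁻ x in Ioi (0 : ℝ), ENNReal.ofReal (1 / x) * φ (x / c) =
      ∫⁻ x in Ioi (0 : ℝ), ENNReal.ofReal (1 / x) * φ x := by
  have himg : (fun x : ℝ => c * x) '' Ioi 0 = Ioi 0 := by
    rw [image_const_mul_Ioi_zero hc]
  have h := lintegral_image_eq_lintegral_abs_deriv_mul (s := Ioi (0 : ℝ)) (f := fun x => c * x)
    (f' := fun _ => c) measurableSet_Ioi
    (fun x _ => by simpa using (hasDerivAt_id x).const_mul c |>.hasDerivWithinAt)
    (mul_right_injective₀ hc.ne').injOn (fun x => ENNReal.ofReal (1 / x) * φ (x / c))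
  rw [himg] at h
  rw [h]
  refine setLIntegral_congr_fun measurableSet_Ioi fun x hx => ?_
  have hx : 0 < x := hx
  rw [← mul_assoc, ← ENNReal.ofReal_mul (abs_nonneg _), abs_of_pos hc,
    mul_div_cancel_left₀ _ hc.ne']
  congr 2
  field_simp

/-- Tonelli's theorem for multiplicative convolutions. -/
lemma lintegral_mul_conv_le {h : ℝ → ℝ} (hh : AEStronglyMeasurable h) (h0 : ∀ s ≤ 0, h s = 0)
    {k : ℝ → ℝ≥0∞} (hk : Measurable k) {c : ℝ≥0∞}
    (hc : ∀ s, 0 < s → ∫⁻ x in Ioi (0 : ℝ), ENNReal.ofReal (1 / x) * k (x * s) ≤ c) :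
    ∫⁻ x in Ioi (0 : ℝ), ENNReal.ofReal (1 / x) * ∫⁻ s, ‖h s‖ₑ * k (x * s) ≤
      c * ∫⁻ s, ‖h s‖ₑ := by
  have hm : Measurable fun x : ℝ => ENNReal.ofReal (1 / x) := by fun_prop
  have hk2 : Measurable fun p : ℝ × ℝ => k (p.1 * p.2) := hk.comp (by fun_prop)
  calc _ = ∫⁻ x in Ioi (0 : ℝ), ∫⁻ s, ENNReal.ofReal (1 / x) * (‖h s‖ₑ * k (x * s)) := by
        refine lintegral_congr fun x => ?_
        exact (lintegral_const_mul'' _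
          (hh.enorm.mul (hk.comp (measurable_const_mul x)).aemeasurable)).symm
    _ = ∫⁻ s, ∫⁻ x in Ioi (0 : ℝ), ENNReal.ofReal (1 / x) * (‖h s‖ₑ * k (x * s)) := by
        refine lintegral_lintegral_swap ?_
        exact (hm.comp measurable_fst).aemeasurable.mul
          ((hh.comp_snd.enorm).mul hk2.aemeasurable)
    _ ≤ ∫⁻ s, c * ‖h s‖ₑ := by
        refine lintegral_mono fun s => ?_
        rcases le_or_gt s 0 with hs | hs
        · simp [h0 s hs]
        · calc _ = ∫⁻ x in Ioi (0 : ℝ), ‖h s‖ₑ * (ENNReal.ofReal (1 / x) * k (x * s)) := by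
                refine lintegral_congr fun x => ?_
                ring
            _ = ‖h s‖ₑ * ∫⁻ x in Ioi (0 : ℝ), (ENNReal.ofReal (1 / x) * k (x * s)) :=
                lintegral_const_mul _ (hm.mul (hk.comp (measurable_mul_const s)))
            _ ≤ ‖h s‖ₑ * c := by gcongr; exact hc s hs
            _ = _ := mul_comm _ _
    _ = _ := lintegral_const_mul'' _ hh.enorm

lemma lintegral_indicator_scaled_le {s : ℝ} (hs : 0 < s) :
    ∫⁻ x in Ioi (0 : ℝ), ENNReal.ofReal (1 / x) *
      (Icc (1 / 2 : ℝ) 3).indicator (fun _ => (1 : ℝ≥0∞)) (x * s) ≤ 5 := by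
  calc _ ≤ ∫⁻ x in Ioi (0 : ℝ), (Icc (1 / (2 * s)) (3 / s)).indicator
          (fun _ => ENNReal.ofReal (2 * s)) x := by
        refine setLIntegral_mono' measurableSet_Ioi fun x hx => ?_
        have hx : 0 < x := hx
        by_cases h : x * s ∈ Icc (1 / 2 : ℝ) 3
        · have h1 : 1 / (2 * s) ≤ x := by
            rw [div_le_iff₀ (by positivity)]; linarith [h.1]
          have hmem : x ∈ Icc (1 / (2 * s)) (3 / s) := ⟨h1, by rw [le_div_iff₀ hs]; exact h.2⟩
          rw [indicator_of_mem h, indicator_of_mem hmem, mul_one]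
          refine ENNReal.ofReal_le_ofReal ?_
          rw [div_le_iff₀ hx]
          linarith [h.1]
        · rw [indicator_of_notMem h, mul_zero]
          exact zero_le
    _ ≤ ∫⁻ x, (Icc (1 / (2 * s)) (3 / s)).indicator
          (fun _ => ENNReal.ofReal (2 * s)) x := setLIntegral_le_lintegral _ _
    _ = ENNReal.ofReal (2 * s) * ENNReal.ofReal (3 / s - 1 / (2 * s)) := by
        rw [lintegral_indicator_const measurableSet_Icc, Real.volume_Icc]
    _ = 5 := by
        rw [← ENNReal.ofReal_mul (by positivity)]
        rw [show 2 * s * (3 / s - 1 / (2 * s)) = 5 by field_simp; norm_num]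
        norm_num

lemma lintegral_remainderKernel_le {s : ℝ} (hs : 0 < s) :
    ∫⁻ x in Ioi (0 : ℝ), ENNReal.ofReal (1 / x) * ‖remainderKernel (x * s)‖ₑ ≤ 68 := by
  have hs' : 0 < 1 / s := by positivity
  have hpt : ∀ x, 0 < x → ENNReal.ofReal (1 / x) * ‖remainderKernel (x * s)‖ₑ ≤
      ENNReal.ofReal (34 * min s (1 / s * x ^ (-2 : ℝ))) := by
    intro x hx
    rw [← ofReal_norm, ← ENNReal.ofReal_mul (by positivity)]
    refine ENNReal.ofReal_le_ofReal ?_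
    have h := abs_remainderKernel_le (u := x * s) (by positivity)
    rw [Real.norm_eq_abs]
    calc _ ≤ 1 / x * (34 * min (x * s) (1 / (x * s))) := by gcongr
      _ = 34 * min (1 / x * (x * s)) (1 / x * (1 / (x * s))) := by
          rw [← mul_min_of_nonneg _ _ (by positivity : 0 ≤ 1 / x)]; ring
      _ = _ := by
          rw [rpow_neg hx.le, show (2 : ℝ) = ((2 : ℕ) : ℝ) by norm_num, rpow_natCast]
          congr 2 <;> field_simp
  have hI : IntegrableOn (fun x : ℝ => 34 * (1 / s * x ^ (-2 : ℝ))) (Ioi (1 / s)) :=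
    ((integrableOn_Ioi_rpow_of_lt (by norm_num) hs').const_mul _).const_mul _
  have hu : Ioi (0 : ℝ) = Ioc 0 (1 / s) ∪ Ioi (1 / s) := (Ioc_union_Ioi_eq_Ioi hs'.le).symm
  have h1 : ∫⁻ x in Ioc 0 (1 / s), ENNReal.ofReal (1 / x) * ‖remainderKernel (x * s)‖ₑ ≤ 34 := by
    calc _ ≤ ∫⁻ x in Ioc 0 (1 / s), ENNReal.ofReal (34 * s) :=
          setLIntegral_mono' measurableSet_Ioc fun x hx => (hpt x hx.1).trans
            (ENNReal.ofReal_le_ofReal (by gcongr; exact min_le_left _ _))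
      _ = 34 := by
          rw [setLIntegral_const, Real.volume_Ioc, ← ENNReal.ofReal_mul (by positivity),
            show 34 * s * (1 / s - 0) = 34 by field_simp; ring]
          norm_num
  have h2 : ∫⁻ x in Ioi (1 / s), ENNReal.ofReal (1 / x) * ‖remainderKernel (x * s)‖ₑ ≤ 34 := by
    calc _ ≤ ∫⁻ x in Ioi (1 / s), ENNReal.ofReal (34 * (1 / s * x ^ (-2 : ℝ))) :=
          setLIntegral_mono' measurableSet_Ioi fun x hx => (hpt x (hs'.trans hx)).trans
            (ENNReal.ofReal_le_ofReal (by gcongr; exact min_le_right _ _))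
      _ = ENNReal.ofReal (∫ x in Ioi (1 / s), 34 * (1 / s * x ^ (-2 : ℝ))) := by
          refine (ofReal_integral_eq_lintegral_ofReal hI ?_).symm
          filter_upwards [ae_restrict_mem measurableSet_Ioi] with x hx
          have : 0 < x := hs'.trans hx
          positivity
      _ = 34 := by
          rw [integral_const_mul, integral_const_mul, integral_Ioi_rpow_of_lt (by norm_num) hs',
            show (-2 : ℝ) + 1 = -1 by norm_num, rpow_neg_one]
          rw [show 34 * (1 / s * (-(1 / s)⁻¹ / -1)) = 34 by field_simp]
          norm_num
  rw [hu]
  refine (lintegral_union_le _ _ _).trans ((add_le_add h1 h2).trans ?_)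
  norm_num

lemma aestronglyMeasurable_integral_comp_mul {g k : ℝ → ℝ} (hg : AEStronglyMeasurable g)
    (hk : Measurable k) (ν : Measure ℝ) [SFinite ν] :
    AEStronglyMeasurable (fun x => ∫ s, g s * k (x * s)) ν := by
  refine AEStronglyMeasurable.integral_prod_right' (μ := ν) (ν := volume)
    (f := fun p : ℝ × ℝ => g p.2 * k (p.1 * p.2)) ?_
  exact hg.comp_snd.mul
    (hk.comp (by fun_prop : Measurable fun p : ℝ × ℝ => p.1 * p.2)).aestronglyMeasurable

lemma lintegral_remainder_le {g : ℝ → ℝ} (hg : AEStronglyMeasurable g) (h0 : ∀ s ≤ 0, g s = 0) :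
    ∫⁻ x in Ioi (0 : ℝ), ‖x⁻¹ * ∫ s, g s * remainderKernel (x * s)‖ₑ ≤ 68 * ∫⁻ s, ‖g s‖ₑ := by
  refine le_trans ?_ (lintegral_mul_conv_le hg h0 measurable_remainderKernel.enorm
    fun s => lintegral_remainderKernel_le)
  refine setLIntegral_mono' measurableSet_Ioi fun x hx => ?_
  have hx : 0 < x := hx
  rw [enorm_mul, Real.enorm_of_nonneg (by positivity), inv_eq_one_div]
  gcongr
  refine (enorm_integral_le_lintegral_enorm _).trans (le_of_eq ?_)
  simp only [enorm_mul]

lemma hasSum_integral_cutoff {g : ℝ → ℝ} (hg : Integrable g) (x : ℝ) :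
    HasSum (fun n : ℕ => (∫ s, g s * cutoff (x / (n + 1) * s) *
      cos ((n + 1) * (x / (n + 1) * s))) / (n + 1))
      (∫ s, g s * (cutoffSum (x * s) * cos (x * s))) := by
  have hsum : ∀ s : ℝ, HasSum (fun n : ℕ => cutoff (x / (n + 1) * s) / (n + 1))
      (cutoffSum (x * s)) := fun s => by
    simpa only [div_mul_eq_mul_div] using hasSum_cutoffSum (x * s)
  have hcos : ∀ (n : ℕ) (s : ℝ), ((n : ℝ) + 1) * (x / (n + 1) * s) = x * s := fun n s => by
    field_simp
  simp_rw [← integral_div]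
  refine hasSum_integral_of_dominated_convergence
    (fun n s => |g s| * (cutoff (x / (n + 1) * s) / (n + 1))) (fun n => ?_) (fun n => ?_) ?_ ?_ ?_
  · have hc : Continuous fun s => cutoff (x / (n + 1) * s) * cos ((n + 1) * (x / (n + 1) * s)) /
        (n + 1) := ((continuous_cutoff.comp (by fun_prop)).mul (by fun_prop)).div_const _
    refine (hg.aestronglyMeasurable.mul hc.aestronglyMeasurable).congr
      (Eventually.of_forall fun s => ?_)
    simp only [Pi.mul_apply]
    ring
  · refine Eventually.of_forall fun s => ?_
    rw [norm_div, norm_mul, norm_mul, Real.norm_of_nonneg (cutoff_nonneg _),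
      Real.norm_of_nonneg (by positivity : (0 : ℝ) ≤ n + 1), mul_assoc, mul_div_assoc]
    refine mul_le_mul_of_nonneg_left ?_ (abs_nonneg _)
    gcongr
    exact mul_le_of_le_one_right (cutoff_nonneg _) (abs_cos_le_one _)
  · exact Eventually.of_forall fun s => (hsum s).summable.mul_left _
  · have e : (fun s => ∑' n : ℕ, |g s| * (cutoff (x / (n + 1) * s) / (n + 1))) =
        fun s => |g s| * cutoffSum (x * s) := by
      ext s
      rw [tsum_mul_left, (hsum s).tsum_eq]
    rw [e]
    refine hg.abs.mul_bdd (c := 33)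
      (measurable_cutoffSum.comp (measurable_const_mul x)).aestronglyMeasurable
      (Eventually.of_forall fun s => ?_)
    rw [Real.norm_of_nonneg (cutoffSum_nonneg _)]
    exact cutoffSum_le _
  · refine Eventually.of_forall fun s => ?_
    have := ((hsum s).mul_right (cos (x * s))).mul_left (g s)
    refine this.congr_fun ?_
    intro n
    rw [hcos]
    ring

lemma lintegral_cutoff_le {g T : ℝ → ℝ} (hg : Integrable g) (hT : Integrable T)
    (hg0 : ∀ s ≤ 0, g s = 0) (hT0 : ∀ s ≤ 0, T s = 0)
    (hlim : ∀ t, 0 < t → Tendsto (fun δ => ∫ s in δ..(t / 2), (g (t + s) - g (t - s)) / s)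
      (nhdsWithin 0 (Ioi 0)) (nhds (T t))) :
    ∫⁻ x in Ioi (0 : ℝ), ‖x⁻¹ * ∫ s, g s * (cutoffSum (x * s) * cos (x * s))‖ₑ ≤
      650000 * ((∫⁻ s, ‖g s‖ₑ) + ∫⁻ s, ‖T s‖ₑ) := by
  set φ : ℕ → ℝ → ℝ≥0∞ := fun n μ =>
    ‖(∫ s, g s * cutoff (μ * s) * cos ((n + 1) * (μ * s))) / (n + 1)‖ₑ with hφ
  have hmeas : ∀ (n : ℕ) (c : ℝ), AEMeasurable (fun x => ENNReal.ofReal (1 / x) * φ n (x / c))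
      (volume.restrict (Ioi 0)) := by
    intro n c
    have hk : Measurable fun u : ℝ => cutoff (u / c) * cos ((n + 1) * (u / c)) := by
      have := continuous_cutoff.measurable
      fun_prop
    have h := aestronglyMeasurable_integral_comp_mul hg.aestronglyMeasurable hk
      (volume.restrict (Ioi 0))
    have h2 := (h.aemeasurable.div_const ((n : ℝ) + 1)).enorm
    refine AEMeasurable.mul (by fun_prop) (h2.congr (Eventually.of_forall fun x => ?_))
    simp only [hφ, mul_assoc, div_mul_eq_mul_div]
  have hsum : ∀ μ, 0 < μ → ∑' n, φ n μ ≤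
      130000 * ∫⁻ s, ‖|g s| + |T s|‖ₑ * (Icc (1 / 2 : ℝ) 3).indicator (fun _ => 1) (μ * s) := by
    intro μ hμ
    have hInd : Integrable fun s => (Icc (1 / 2 : ℝ) 3).indicator (fun _ => |g s| + |T s|)
        (μ * s) := by
      have hms : MeasurableSet ((fun s => μ * s) ⁻¹' Icc (1 / 2 : ℝ) 3) :=
        measurableSet_Icc.preimage (measurable_const_mul μ)
      exact (hg.abs.add hT.abs).indicator hms
    have e : ∫⁻ s, ‖|g s| + |T s|‖ₑ * (Icc (1 / 2 : ℝ) 3).indicator (fun _ => 1) (μ * s) =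
        ENNReal.ofReal (∫ s, (Icc (1 / 2 : ℝ) 3).indicator (fun _ => |g s| + |T s|) (μ * s)) := by
      rw [ofReal_integral_eq_lintegral_ofReal hInd (Eventually.of_forall fun s =>
        indicator_nonneg (fun _ _ => by positivity) _)]
      refine lintegral_congr fun s => ?_
      simp only [indicator]
      split_ifs
      · rw [mul_one, Real.enorm_of_nonneg (by positivity)]
      · simp
    rw [e, show (130000 : ℝ≥0∞) = ENNReal.ofReal 130000 by norm_num,
      ← ENNReal.ofReal_mul (by norm_num)]
    refine ENNReal.tsum_le_of_sum_range_le fun N => ?_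
    refine le_trans (le_of_eq ?_) (ENNReal.ofReal_le_ofReal
      (sum_abs_integral_cutoff_scaled_le hg hT hlim hμ N))
    rw [ENNReal.ofReal_sum_of_nonneg (fun n _ => by positivity)]
    refine Finset.sum_congr rfl fun n _ => ?_
    simp only [hφ]
    rw [← ofReal_norm, norm_div, Real.norm_eq_abs,
      Real.norm_of_nonneg (by positivity : (0 : ℝ) ≤ n + 1)]
  calc _ ≤ ∫⁻ x in Ioi (0 : ℝ), ∑' n : ℕ, ENNReal.ofReal (1 / x) * φ n (x / (n + 1)) := by
        refine setLIntegral_mono' measurableSet_Ioi fun x hx => ?_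
        have hx : 0 < x := hx
        rw [ENNReal.tsum_mul_left, enorm_mul, Real.enorm_of_nonneg (by positivity), inv_eq_one_div,
          ← (hasSum_integral_cutoff hg x).tsum_eq]
        gcongr
        exact enorm_tsum_le_tsum_enorm
    _ = ∑' n : ℕ, ∫⁻ x in Ioi (0 : ℝ), ENNReal.ofReal (1 / x) * φ n (x / (n + 1)) :=
        lintegral_tsum fun n => hmeas n _
    _ = ∑' n : ℕ, ∫⁻ x in Ioi (0 : ℝ), ENNReal.ofReal (1 / x) * φ n x := by
        congr 1
        ext n
        exact lintegral_comp_div_Ioi (by positivity) _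
    _ = ∫⁻ x in Ioi (0 : ℝ), ∑' n : ℕ, ENNReal.ofReal (1 / x) * φ n x :=
        (lintegral_tsum fun n => by simpa using hmeas n 1).symm
    _ ≤ ∫⁻ x in Ioi (0 : ℝ), 130000 * (ENNReal.ofReal (1 / x) *
          ∫⁻ s, ‖|g s| + |T s|‖ₑ * (Icc (1 / 2 : ℝ) 3).indicator (fun _ => 1) (x * s)) := by
        refine setLIntegral_mono' measurableSet_Ioi fun x hx => ?_
        rw [ENNReal.tsum_mul_left, mul_left_comm]
        gcongr
        exact hsum x hx
    _ = 130000 * ∫⁻ x in Ioi (0 : ℝ), (ENNReal.ofReal (1 / x) *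
          ∫⁻ s, ‖|g s| + |T s|‖ₑ * (Icc (1 / 2 : ℝ) 3).indicator (fun _ => 1) (x * s)) :=
        lintegral_const_mul' _ _ (by norm_num)
    _ ≤ 130000 * (5 * ∫⁻ s, ‖|g s| + |T s|‖ₑ) := by
        gcongr
        refine lintegral_mul_conv_le (hg.abs.add hT.abs).aestronglyMeasurable ?_
          (measurable_const.indicator measurableSet_Icc) fun s => lintegral_indicator_scaled_le
        intro s hs
        simp [hg0 s hs, hT0 s hs]
    _ ≤ 130000 * (5 * ((∫⁻ s, ‖g s‖ₑ) + ∫⁻ s, ‖T s‖ₑ)) := by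
        gcongr
        rw [← lintegral_add_left' hg.aestronglyMeasurable.enorm]
        refine lintegral_mono fun s => (enorm_add_le _ _).trans (le_of_eq ?_)
        simp only [Real.enorm_abs]
    _ = _ := by rw [← mul_assoc]; norm_num

/-- The kernel of the error term. -/
noncomputable def sineKernel (u : ℝ) : ℝ := cos u - (Iio (π / 2)).indicator (fun _ => 1) u

lemma measurable_sineKernel : Measurable sineKernel :=
  measurable_cos.sub (measurable_const.indicator measurableSet_Iio)

lemma abs_sineKernel_le (u : ℝ) : |sineKernel u| ≤ 2 := by
  refine (abs_sub _ _).trans ?_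
  have : |(Iio (π / 2)).indicator (fun _ => (1 : ℝ)) u| ≤ 1 := by
    simp only [indicator]
    split_ifs <;> simp
  linarith [abs_cos_le_one u]

lemma lintegral_sineKernel_le {g T : ℝ → ℝ} (hg : Integrable g) (hT : Integrable T)
    (hg0 : ∀ s ≤ 0, g s = 0) (hT0 : ∀ s ≤ 0, T s = 0)
    (hlim : ∀ t, 0 < t → Tendsto (fun δ => ∫ s in δ..(t / 2), (g (t + s) - g (t - s)) / s)
      (nhdsWithin 0 (Ioi 0)) (nhds (T t))) :
    ∫⁻ x in Ioi (0 : ℝ), ‖x⁻¹ * ∫ s, g s * sineKernel (x * s)‖ₑ ≤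
      700000 * ((∫⁻ s, ‖g s‖ₑ) + ∫⁻ s, ‖T s‖ₑ) := by
  have hSm : Measurable fun u => cutoffSum u * cos u := measurable_cutoffSum.mul measurable_cos
  have hI1 : ∀ x : ℝ, Integrable fun s => g s * (cutoffSum (x * s) * cos (x * s)) := fun x => by
    refine hg.mul_bdd (c := 33) (hSm.comp (measurable_const_mul x)).aestronglyMeasurable
      (Eventually.of_forall fun s => ?_)
    rw [norm_mul, Real.norm_of_nonneg (cutoffSum_nonneg _)]
    exact (mul_le_of_le_one_right (cutoffSum_nonneg _) (abs_cos_le_one _)).trans (cutoffSum_le _)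
  have hI : ∀ x : ℝ, Integrable fun s => g s * sineKernel (x * s) := fun x =>
    hg.mul_bdd (c := 2) (measurable_sineKernel.comp (measurable_const_mul x)).aestronglyMeasurable
      (Eventually.of_forall fun s => abs_sineKernel_le _)
  have hsplit : ∀ x : ℝ, ∫ s, g s * sineKernel (x * s) =
      (∫ s, g s * (cutoffSum (x * s) * cos (x * s))) + ∫ s, g s * remainderKernel (x * s) := by
    intro x
    rw [← sub_eq_iff_eq_add', ← integral_sub (hI x) (hI1 x)]
    congr 1
    ext s
    rw [sineKernel, remainderKernel]
    ring
  have hAm := (aestronglyMeasurable_integral_comp_mul hg.aestronglyMeasurable hSm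
    (volume.restrict (Ioi 0)))
  have hAm' : AEMeasurable (fun x : ℝ =>
      ‖x⁻¹ * ∫ s, g s * (cutoffSum (x * s) * cos (x * s))‖ₑ) (volume.restrict (Ioi 0)) :=
    (measurable_inv.aestronglyMeasurable.mul hAm).enorm
  calc _ ≤ ∫⁻ x in Ioi (0 : ℝ), (‖x⁻¹ * ∫ s, g s * (cutoffSum (x * s) * cos (x * s))‖ₑ +
        ‖x⁻¹ * ∫ s, g s * remainderKernel (x * s)‖ₑ) := by
        refine lintegral_mono fun x => ?_
        simp only [hsplit, mul_add]
        exact enorm_add_le _ _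
    _ = _ := lintegral_add_left' hAm' _
    _ ≤ 650000 * ((∫⁻ s, ‖g s‖ₑ) + ∫⁻ s, ‖T s‖ₑ) + 68 * ((∫⁻ s, ‖g s‖ₑ) + ∫⁻ s, ‖T s‖ₑ) := by
        refine add_le_add (lintegral_cutoff_le hg hT hg0 hT0 hlim)
          ((lintegral_remainder_le hg.aestronglyMeasurable hg0).trans ?_)
        gcongr
        exact le_self_add
    _ ≤ _ := by
        rw [← add_mul]
        gcongr
        norm_num

/-- Integration by parts for the truncated sine transform. -/
lemma integral_mul_sin_eq {f f' : ℝ → ℂ}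
    (hf : ∀ a b : ℝ, 0 < a → a ≤ b → f b - f a = ∫ t in a..b, f' t)
    (hf' : IntegrableOn f' (Ioi 0)) {x N : ℝ} (hx : 0 < x) (hN : 0 < N) :
    ∫ t in (0 : ℝ)..N, f t * (sin (x * t) : ℂ) =
      ((1 - cos (x * N)) / x : ℝ) * f N -
        ∫ s in (0 : ℝ)..N, (((1 - cos (x * s)) / x : ℝ) : ℂ) * f' s := by
  have hw : Continuous fun t => sin (x * t) := by fun_prop
  have hfN : IntegrableOn f' (Ioc 0 N) := hf'.mono_set Ioc_subset_Ioi_self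
  have hprim : ∀ s : ℝ, ∫ t in (0 : ℝ)..s, sin (x * t) = (1 - cos (x * s)) / x := by
    intro s
    rw [intervalIntegral.integral_comp_mul_left (fun u => sin u) hx.ne', integral_sin]
    simp [div_eq_inv_mul]
  have hswap := integral_triangle_swap (w := fun t => sin (x * t)) hN.le hw
    hfN.aestronglyMeasurable hfN.norm (fun t s _ _ _ =>
      mul_le_of_le_one_left (norm_nonneg _) (abs_sin_le_one _))
  simp only [hprim, Complex.real_smul] at hswap
  rw [← hswap]
  have hcongr : ∫ t in (0 : ℝ)..N, f t * (sin (x * t) : ℂ) =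
      ∫ t in (0 : ℝ)..N, ((sin (x * t) : ℂ) * f N - (sin (x * t) : ℂ) * ∫ s in t..N, f' s) := by
    refine intervalIntegral.integral_congr_ae (Eventually.of_forall fun t ht => ?_)
    rw [uIoc_of_le hN.le] at ht
    rw [← hf t N ht.1 ht.2]
    ring
  have hcont : ContinuousOn (fun t => ∫ s in t..N, f' s) (uIcc 0 N) := by
    have := (intervalIntegral.continuousOn_primitive_interval' (a := N) (b₁ := 0) (b₂ := N)
      ((intervalIntegrable_iff_integrableOn_Ioc_of_le hN.le).2 hfN) right_mem_uIcc).neg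
    refine this.congr fun t _ => ?_
    simp [intervalIntegral.integral_symm N t]
  rw [hcongr, intervalIntegral.integral_sub]
  · congr 1
    rw [intervalIntegral.integral_mul_const]
    congr 1
    rw [intervalIntegral.integral_ofReal, hprim]
  · exact Continuous.intervalIntegrable (by fun_prop) _ _
  · refine ContinuousOn.intervalIntegrable (ContinuousOn.mul ?_ hcont)
    exact Continuous.continuousOn (by fun_prop)

lemma eq_neg_integral_Ioi {f f' : ℝ → ℂ}
    (hf : ∀ a b : ℝ, 0 < a → a ≤ b → f b - f a = ∫ t in a..b, f' t)
    (hf0 : Tendsto f atTop (nhds 0)) (hf' : IntegrableOn f' (Ioi 0)) {a : ℝ} (ha : 0 < a) :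
    f a = -∫ s in Ioi a, f' s := by
  have h1 := intervalIntegral_tendsto_integral_Ioi a
    (hf'.mono_set (Ioi_subset_Ioi ha.le)) tendsto_id
  have h2 : Tendsto (fun b => f b - f a) atTop (nhds (0 - f a)) := hf0.sub_const _
  have h3 := tendsto_nhds_unique (h1.congr' ?_) h2
  · rw [h3]; ring
  · filter_upwards [eventually_ge_atTop a] with b hb
    exact (hf a b ha hb).symm

lemma sine_transform_sub_eq {f f' : ℝ → ℂ}
    (hf : ∀ a b : ℝ, 0 < a → a ≤ b → f b - f a = ∫ t in a..b, f' t)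
    (hf0 : Tendsto f atTop (nhds 0)) (hf' : IntegrableOn f' (Ioi 0)) {x : ℝ} (hx : 0 < x) {y : ℂ}
    (hy : Tendsto (fun N : ℝ => ∫ t in (0 : ℝ)..N, f t * (sin (x * t) : ℂ)) atTop (nhds y)) :
    y = ((1 / x : ℝ) : ℂ) * f (π / (2 * x)) +
      (x⁻¹ : ℝ) * ∫ s in Ioi (0 : ℝ), f' s * (sineKernel (x * s) : ℂ) := by
  have hbd : ∀ s : ℝ, |(1 - cos (x * s)) / x| ≤ 2 / x := by
    intro s
    rw [abs_div, abs_of_pos hx]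
    gcongr
    rw [abs_le]
    constructor <;> linarith [neg_one_le_cos (x * s), cos_le_one (x * s)]
  have hI : IntegrableOn (fun s => (((1 - cos (x * s)) / x : ℝ) : ℂ) * f' s) (Ioi 0) := by
    refine Integrable.bdd_mul (c := 2 / x) hf' ?_ (Eventually.of_forall fun s => ?_)
    · exact Continuous.aestronglyMeasurable (by fun_prop)
    · rw [Complex.norm_real]
      exact hbd s
  have h1 : Tendsto (fun N : ℝ => ((1 - cos (x * N)) / x : ℝ) * f N) atTop (nhds 0) := by
    have h0 : Tendsto (fun N => 2 / x * ‖f N‖) atTop (nhds 0) := by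
      simpa using hf0.norm.const_mul (2 / x)
    refine squeeze_zero_norm (fun N => ?_) h0
    rw [norm_mul, Complex.norm_real]
    exact mul_le_mul_of_nonneg_right (hbd N) (norm_nonneg _)
  have h2 := h1.sub (intervalIntegral_tendsto_integral_Ioi 0 hI tendsto_id)
  have h3 : y = 0 - ∫ s in Ioi (0 : ℝ), (((1 - cos (x * s)) / x : ℝ) : ℂ) * f' s := by
    refine tendsto_nhds_unique hy (h2.congr' ?_)
    filter_upwards [eventually_gt_atTop 0] with N hN
    exact (integral_mul_sin_eq hf hf' hx hN).symm
  have ha : 0 < π / (2 * x) := by positivity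
  have hII : IntegrableOn (fun s => (Ioi (π / (2 * x))).indicator f' s) (Ioi 0) :=
    IntegrableOn.indicator hf' measurableSet_Ioi
  have h4 : ∫ s in Ioi (π / (2 * x)), f' s =
      ∫ s in Ioi (0 : ℝ), (Ioi (π / (2 * x))).indicator f' s := by
    rw [setIntegral_indicator measurableSet_Ioi, inter_eq_right.2 (Ioi_subset_Ioi ha.le)]
  rw [h3, eq_neg_integral_Ioi hf hf0 hf' ha, h4, ← sub_eq_iff_eq_add', mul_neg, sub_neg_eq_add,
    zero_sub, ← integral_const_mul, ← integral_const_mul, ← integral_neg]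
  refine (integral_add hI.neg (hII.const_mul _)).symm.trans (integral_congr_ae ?_)
  have hne : ∀ᵐ s ∂(volume.restrict (Ioi (0 : ℝ))), s ≠ π / (2 * x) :=
    ae_restrict_of_ae (by simp [ae_iff, measure_singleton])
  filter_upwards [hne] with s hs
  have hiff : s < π / (2 * x) ↔ x * s < π / 2 := by
    rw [lt_div_iff₀ (by positivity), lt_div_iff₀ (by positivity)]
    constructor <;> intro h <;> linarith
  have hxc : (x : ℂ) ≠ 0 := by exact_mod_cast hx.ne'
  rcases lt_or_gt_of_ne hs with h | h
  · have : x * s < π / 2 := hiff.1 h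
    simp only [Pi.neg_apply, sineKernel, indicator, mem_Ioi, mem_Iio, not_lt.2 h.le, this,
      if_true, if_false]
    push_cast
    field_simp
    ring
  · have : ¬ x * s < π / 2 := fun h' => not_lt.2 h.le (hiff.2 h')
    simp only [Pi.neg_apply, sineKernel, indicator, mem_Ioi, mem_Iio, h, this, if_true, if_false]
    push_cast
    field_simp
    ring

/-- A real-linear functional turns the principal-value limit of a complex function into that of a
real one. -/
lemma tendsto_T_transform_comp (L : ℂ →L[ℝ] ℝ) {g T : ℝ → ℂ} (hg : IntegrableOn g (Ioi 0))
    (hlim : ∀ t : ℝ, 0 < t →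
      Tendsto (fun δ : ℝ => ∫ s in δ..(t / 2), (g (t + s) - g (t - s)) / (s : ℂ))
        (nhdsWithin 0 (Ioi 0)) (nhds (T t))) {t : ℝ} (ht : 0 < t) :
    Tendsto (fun δ => ∫ s in δ..(t / 2), ((Ioi 0).indicator (fun u => L (g u)) (t + s) -
        (Ioi 0).indicator (fun u => L (g u)) (t - s)) / s)
      (nhdsWithin 0 (Ioi 0)) (nhds ((Ioi 0).indicator (fun u => L (T u)) t)) := by
  rw [indicator_of_mem (mem_Ioi.2 ht)]
  refine ((L.continuous.tendsto _).comp (hlim t ht)).congr' ?_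
  filter_upwards [Ioo_mem_nhdsGT (half_pos ht)] with δ hδ
  have hG : Integrable ((Ioi 0).indicator g) := hg.integrable_indicator measurableSet_Ioi
  have hcont : ContinuousOn (fun s : ℝ => ((s : ℂ))⁻¹) (uIcc δ (t / 2)) := by
    refine ContinuousOn.inv₀ (by fun_prop) fun s hs => ?_
    rw [uIcc_of_le hδ.2.le] at hs
    exact_mod_cast (hδ.1.trans_le hs.1).ne'
  have hI : IntervalIntegrable (fun s => (g (t + s) - g (t - s)) / (s : ℂ)) volume δ (t / 2) := by
    have h1 := (((hG.comp_add_left t).sub (hG.comp_sub_left t)).intervalIntegrable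
      (a := δ) (b := t / 2)).mul_continuousOn hcont
    refine h1.congr fun s hs => ?_
    rw [uIoc_of_le hδ.2.le] at hs
    have a1 : t + s ∈ Ioi (0 : ℝ) := by have := hs.1; have := hδ.1; simp only [mem_Ioi]; linarith
    have a2 : t - s ∈ Ioi (0 : ℝ) := by have := hs.2; simp only [mem_Ioi]; linarith
    simp only [Pi.sub_apply, indicator_of_mem a1, indicator_of_mem a2, div_eq_mul_inv]
  rw [Function.comp_apply, ← L.intervalIntegral_comp_comm hI]
  refine intervalIntegral.integral_congr_ae (Eventually.of_forall fun s hs => ?_)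
  rw [uIoc_of_le hδ.2.le] at hs
  have a1 : t + s ∈ Ioi (0 : ℝ) := by have := hs.1; have := hδ.1; simp only [mem_Ioi]; linarith
  have a2 : t - s ∈ Ioi (0 : ℝ) := by have := hs.2; simp only [mem_Ioi]; linarith
  rw [indicator_of_mem a1, indicator_of_mem a2, ← map_sub, div_eq_inv_mul, div_eq_inv_mul,
    ← Complex.ofReal_inv, ← Complex.real_smul, map_smul, smul_eq_mul]

lemma lintegral_sineKernel_comp_le (L : ℂ →L[ℝ] ℝ) (hL : ∀ z, ‖L z‖ ≤ ‖z‖) {g T : ℝ → ℂ}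
    (hg : IntegrableOn g (Ioi 0)) (hT : IntegrableOn T (Ioi 0))
    (hlim : ∀ t : ℝ, 0 < t →
      Tendsto (fun δ : ℝ => ∫ s in δ..(t / 2), (g (t + s) - g (t - s)) / (s : ℂ))
        (nhdsWithin 0 (Ioi 0)) (nhds (T t))) :
    ∫⁻ x in Ioi (0 : ℝ),
        ‖L ((x⁻¹ : ℝ) * ∫ s in Ioi (0 : ℝ), g s * (sineKernel (x * s) : ℂ))‖ₑ ≤
      700000 * ((∫⁻ s in Ioi (0 : ℝ), ‖g s‖ₑ) + ∫⁻ s in Ioi (0 : ℝ), ‖T s‖ₑ) := by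
  have hint : ∀ {h : ℝ → ℂ}, IntegrableOn h (Ioi 0) →
      Integrable ((Ioi 0).indicator fun u => L (h u)) := fun hh =>
    IntegrableOn.integrable_indicator (L.integrable_comp hh) measurableSet_Ioi
  have hzero : ∀ {h : ℝ → ℂ}, ∀ s ≤ 0, (Ioi (0 : ℝ)).indicator (fun u => L (h u)) s = 0 :=
    fun s hs => indicator_of_notMem (by simpa using hs) _
  have hle : ∀ {h : ℝ → ℂ}, ∫⁻ s, ‖(Ioi (0 : ℝ)).indicator (fun u => L (h u)) s‖ₑ ≤
      ∫⁻ s in Ioi (0 : ℝ), ‖h s‖ₑ := by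
    intro h
    simp only [enorm_indicator_eq_indicator_enorm]
    rw [lintegral_indicator measurableSet_Ioi]
    exact lintegral_mono fun s => enorm_le_iff_norm_le.2 (hL _)
  have key := lintegral_sineKernel_le (hint hg) (hint hT) hzero hzero
    fun t ht => tendsto_T_transform_comp L hg hlim ht
  refine le_trans (le_of_eq ?_) (key.trans (mul_le_mul_right (add_le_add hle hle) _))
  refine lintegral_congr fun x => ?_
  congr 1
  have hI : IntegrableOn (fun s => g s * (sineKernel (x * s) : ℂ)) (Ioi 0) := by
    refine Integrable.mul_bdd (c := 2) hg ?_ (Eventually.of_forall fun s => ?_)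
    · exact (Complex.measurable_ofReal.comp
        (measurable_sineKernel.comp (measurable_const_mul x))).aestronglyMeasurable
    · rw [Complex.norm_real]
      exact abs_sineKernel_le _
  rw [← Complex.real_smul, map_smul, smul_eq_mul, ← L.integral_comp_comm hI,
    ← integral_indicator measurableSet_Ioi]
  congr 2
  ext s
  by_cases hs : s ∈ Ioi (0 : ℝ)
  · rw [indicator_of_mem hs, indicator_of_mem hs, mul_comm (g s), ← Complex.real_smul, map_smul,
      smul_eq_mul, mul_comm]
  · rw [indicator_of_notMem hs, indicator_of_notMem hs, zero_mul]

lemma aestronglyMeasurable_sineKernel_transform {g : ℝ → ℂ} (hg : IntegrableOn g (Ioi 0)) :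
    AEStronglyMeasurable (fun x : ℝ =>
      ((x⁻¹ : ℝ) : ℂ) * ∫ s in Ioi (0 : ℝ), g s * (sineKernel (x * s) : ℂ))
      (volume.restrict (Ioi 0)) := by
  refine AEStronglyMeasurable.mul (Measurable.aestronglyMeasurable (by fun_prop)) ?_
  have hm : AEStronglyMeasurable (fun p : ℝ × ℝ => g p.2 * (sineKernel (p.1 * p.2) : ℂ))
      ((volume.restrict (Ioi 0)).prod (volume.restrict (Ioi 0))) := by
    refine hg.aestronglyMeasurable.comp_snd.mul ?_
    exact (Complex.measurable_ofReal.comp (measurable_sineKernel.comp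
      (measurable_fst.mul measurable_snd))).aestronglyMeasurable
  exact hm.integral_prod_right'

lemma lintegral_sineKernel_transform_le {g T : ℝ → ℂ}
    (hg : IntegrableOn g (Ioi 0)) (hT : IntegrableOn T (Ioi 0))
    (hlim : ∀ t : ℝ, 0 < t →
      Tendsto (fun δ : ℝ => ∫ s in δ..(t / 2), (g (t + s) - g (t - s)) / (s : ℂ))
        (nhdsWithin 0 (Ioi 0)) (nhds (T t))) :
    ∫⁻ x in Ioi (0 : ℝ), ‖((x⁻¹ : ℝ) : ℂ) * ∫ s in Ioi (0 : ℝ), g s * (sineKernel (x * s) : ℂ)‖ₑ ≤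
      1400000 * ((∫⁻ s in Ioi (0 : ℝ), ‖g s‖ₑ) + ∫⁻ s in Ioi (0 : ℝ), ‖T s‖ₑ) := by
  have hre := lintegral_sineKernel_comp_le Complex.reCLM Complex.abs_re_le_norm hg hT hlim
  have him := lintegral_sineKernel_comp_le Complex.imCLM Complex.abs_im_le_norm hg hT hlim
  have hm := aestronglyMeasurable_sineKernel_transform hg
  refine le_trans ?_ ((add_le_add hre him).trans (le_of_eq ?_))
  · rw [← lintegral_add_left' (Complex.reCLM.continuous.comp_aestronglyMeasurable hm).enorm]
    refine lintegral_mono fun x => ?_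
    rw [← ofReal_norm, ← ofReal_norm, ← ofReal_norm,
      ← ENNReal.ofReal_add (norm_nonneg _) (norm_nonneg _)]
    exact ENNReal.ofReal_le_ofReal (Complex.norm_le_abs_re_add_abs_im _)
  · rw [← add_mul]
    norm_num

/-- **Theorem 1 (sine part).** If `f : (0,∞) → ℂ` is locally absolutely continuous
(with derivative `f'`), of bounded variation, tends to `0` at infinity (so `f'` is
integrable on `(0,∞)`), and the `T`-transform `Tf'` is integrable on `(0,∞)`, then
the (improper) sine Fourier transform satisfies, for every `x > 0`,
`f̂_s(x) = (1/x) f(π/(2x)) + F(x)` where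
`‖F‖_{L¹(0,∞)} ≤ C (‖f'‖_{L¹(0,∞)} + ‖Tf'‖_{L¹(0,∞)})` for an absolute constant `C`. -/
theorem sine_fourier_transform_asymptotics_of_T_transform_integrable :
    ∃ C : ℝ, 0 < C ∧
      ∀ (f f' Tf' fs : ℝ → ℂ),
        -- local absolute continuity on (0,∞) with derivative f'
        (∀ a b : ℝ, 0 < a → a ≤ b → f b - f a = ∫ t in a..b, f' t) →
        -- bounded variation on (0,∞)
        BoundedVariationOn f (Set.Ioi 0) →
        -- vanishing at infinity
        Filter.Tendsto f Filter.atTop (nhds 0) →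
        -- f' is Lebesgue integrable on (0,∞)
        MeasureTheory.IntegrableOn f' (Set.Ioi 0) →
        -- Tf' is the T-transform of f' (improper/principal value integral)
        (∀ t : ℝ, 0 < t →
          Filter.Tendsto (fun δ : ℝ => ∫ s in δ..(t / 2), (f' (t + s) - f' (t - s)) / (s : ℂ))
            (nhdsWithin 0 (Set.Ioi 0)) (nhds (Tf' t))) →
        -- Tf' is Lebesgue integrable on (0,∞)
        MeasureTheory.IntegrableOn Tf' (Set.Ioi 0) →
        -- fs is the (improper) sine Fourier transform of f
        (∀ x : ℝ, 0 < x →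
          Filter.Tendsto (fun N : ℝ => ∫ t in (0 : ℝ)..N, f t * (Real.sin (x * t) : ℂ))
            Filter.atTop (nhds (fs x))) →
        ∃ F : ℝ → ℂ,
          (∀ x : ℝ, 0 < x →
            fs x = ((1 / x : ℝ) : ℂ) * f (Real.pi / (2 * x)) + F x) ∧
          MeasureTheory.IntegrableOn F (Set.Ioi 0) ∧
          (∫ x in Set.Ioi (0 : ℝ), ‖F x‖) ≤
            C * ((∫ t in Set.Ioi (0 : ℝ), ‖f' t‖) + ∫ t in Set.Ioi (0 : ℝ), ‖Tf' t‖) := by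
  refine ⟨1400000, by norm_num, fun f f' Tf' fs hf _ hf0 hf' hlim hT hfs => ?_⟩
  have hm := aestronglyMeasurable_sineKernel_transform hf'
  have hle := lintegral_sineKernel_transform_le hf' hT hlim
  have hfin : 1400000 * ((∫⁻ s in Ioi (0 : ℝ), ‖f' s‖ₑ) + ∫⁻ s in Ioi (0 : ℝ), ‖Tf' s‖ₑ) < ∞ :=
    ENNReal.mul_lt_top (by norm_num) (ENNReal.add_lt_top.2 ⟨hf'.2, hT.2⟩)
  refine ⟨_, fun x hx => sine_transform_sub_eq hf hf0 hf' hx (hfs x hx),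
    ⟨hm, hle.trans_lt hfin⟩, ?_⟩
  rw [integral_norm_eq_lintegral_enorm hm,
    integral_norm_eq_lintegral_enorm hf'.aestronglyMeasurable,
    integral_norm_eq_lintegral_enorm hT.aestronglyMeasurable,
    ← ENNReal.toReal_add hf'.2.ne hT.2.ne]
  refine (ENNReal.toReal_mono hfin.ne hle).trans (le_of_eq ?_)
  rw [ENNReal.toReal_mul]
  norm_num
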